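/- Assume Assumptions A1 and A2. Let M ≥ 1 be an integer and u ∈ H^{M+1}_κ(Ω) a solution of −Δu − κ²u = 0 in Ω. For integers N_e, N_n ≥ 1, set N = min(N_n, ⌈M/2⌉) and μ = min(2N_n, M); let β = (β_{p,m})_{p∈N_h,1≤m≤N} be the unique solution of the nodal collocation system Σ_{p,m} β_{p,m}(κ^{−1}∂₁)^{2n}ψ_{p,m}(q) = (κ^{−1}∂₁)^{2n}u(q) (0 ≤ n ≤ N−1, q ∈ N_h), let Vu = Σ_{p,m} β_{p,m}ψ_{p,m}, and let α = (α_{s,n})_{s∈Σ_h,1≤n≤N_e} with α_{s,n} = ((u − Vu), φ_{s,n})_{L²(s)} / ‖φ_{s,n}‖²_{L²(s)}. Then: ‖α‖_{ℓ²} ≤ (8ρ·max(1,κh)/h)·[ 1/2 + C₂·χ_{⌈μ/2⌉}·( ⌈μ/2⌉ + C₃·⌈μ/2⌉²·√(πρ/(κh)) ) ]·‖u‖_{H^{μ+1}_κ(Ω)}, and ‖β‖_{ℓ²} ≤ (3ρ·max(1,κh)²/h)·χ_{⌈μ/2⌉}·√(|N_h|·⌈μ/2⌉)·‖u‖_{H^{μ+1}_κ(Ω)},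 where χ_N = min(ρe^{κh}/(κh), e·max(1,κh)^{2(N−1)}), C₂ = 2π|N_h|ρ^{3/2}max(1,κh)²/(√2·κh·d̃) and C₃ = 2d̃/√(πρ·tanh(κh/ρ)·d̃₀). -/

import Mathlib

open MeasureTheory Real Set
open scoped Real Classical ENNReal NNReal

noncomputable section

/-- Partial derivative in the first coordinate. -/
def pd1 (f : ℝ × ℝ → ℂ) : ℝ × ℝ → ℂ := fun x => deriv (fun t => f (t, x.2)) x.1

/-- Partial derivative in the second coordinate. -/
def pd2 (f : ℝ × ℝ → ℂ) : ℝ × ℝ → ℂ := fun x => deriv (fun t => f (x.1, t)) x.2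

/-- Mixed partial derivative `∂₁^i ∂₂^j`. -/
def pdM (i j : ℕ) (f : ℝ × ℝ → ℂ) : ℝ × ℝ → ℂ := pd1^[i] (pd2^[j] f)

/-- Multi-indices of order at most `M`. -/
def idxLe (M : ℕ) : Finset (ℕ × ℕ) :=
  (Finset.range (M + 1) ×ˢ Finset.range (M + 1)).filter fun p => p.1 + p.2 ≤ M

/-- κ-weighted Sobolev inner product of order `M` on `D`. -/
def sobInner (κ : ℝ) (M : ℕ) (D : Set (ℝ × ℝ)) (f g : ℝ × ℝ → ℂ) : ℂ :=
  ∑ p ∈ idxLe M, ((κ : ℂ) ^ (2 * (p.1 + p.2)))⁻¹ *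
    ∫ x in D, pdM p.1 p.2 f x * (starRingEnd ℂ) (pdM p.1 p.2 g x)

/-- Square of the κ-weighted Sobolev norm of order `M` on `D`. -/
def sobNormSq (κ : ℝ) (M : ℕ) (D : Set (ℝ × ℝ)) (f : ℝ × ℝ → ℂ) : ℝ :=
  ∑ p ∈ idxLe M, (κ ^ (2 * (p.1 + p.2)))⁻¹ * ∫ x in D, ‖pdM p.1 p.2 f x‖ ^ 2

/-- κ-weighted Sobolev norm of order `M` on `D`. -/
def sobNorm (κ : ℝ) (M : ℕ) (D : Set (ℝ × ℝ)) (f : ℝ × ℝ → ℂ) : ℝ :=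
  Real.sqrt (sobNormSq κ M D f)

/-- Membership in `H^M_κ(D)` (for pointwise-differentiable representatives). -/
def MemSob (M : ℕ) (D : Set (ℝ × ℝ)) (f : ℝ × ℝ → ℂ) : Prop :=
  ∀ p ∈ idxLe M, IntegrableOn (fun x => ‖pdM p.1 p.2 f x‖ ^ 2) D

/-- `ν̂_n = nπ/(κ ĥ₁)`. -/
def nuHat (κ h1 : ℝ) (n : ℕ) : ℝ := n * π / (κ * h1)

/-- Principal complex square root of a real number. -/
def csqrt (r : ℝ) : ℂ := (r : ℂ) ^ (1 / 2 : ℂ)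

/-- The single-edge Helmholtz mode `φ̂_n` on the reference rectangle. -/
def phiHat (κ h1 h2 : ℝ) (n : ℕ) : ℝ × ℝ → ℂ := fun x =>
  Complex.sin (↑(κ * nuHat κ h1 n) * (x.1 : ℂ)) *
    Complex.sin ((x.2 : ℂ) * (κ : ℂ) * csqrt (1 - nuHat κ h1 n ^ 2)) /
    Complex.sin ((h2 : ℂ) * (κ : ℂ) * csqrt (1 - nuHat κ h1 n ^ 2))

/-- The open reference rectangle `K̂ = (0,ĥ₁) × (0,ĥ₂)`. -/
def Khat (h1 h2 : ℝ) : Set (ℝ × ℝ) := Ioo 0 h1 ×ˢ Ioo 0 h2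

/-- Assumption A0: `κ²` is not a Δ-Neumann eigenvalue of the rectangle with sides `h1, h2`. -/
def A0cond (κ h1 h2 : ℝ) : Prop :=
  ∀ n m : ℕ, κ ^ 2 ≠ (n * π / h1) ^ 2 + (m * π / h2) ^ 2

/-- Distributional (weak) solution of the homogeneous Helmholtz equation on `D`. -/
def WeakHelmholtz (κ : ℝ) (D : Set (ℝ × ℝ)) (u : ℝ × ℝ → ℂ) : Prop :=
  IntegrableOn u D ∧
  ∀ φ : ℝ × ℝ → ℂ, ContDiff ℝ (⊤ : ℕ∞) φ → HasCompactSupport φ → tsupport φ ⊆ D →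
    ∫ x in D, u x * (pdM 2 0 φ x + pdM 0 2 φ x + (κ : ℂ) ^ 2 * φ x) = 0

/-- The trace of `u` on the top edge (at height `h2`). -/
def traceTop (h2 : ℝ) (u : ℝ × ℝ → ℂ) : ℝ → ℂ := fun t => u (t, h2)

/-- The class `S^{N,M}_κ(K̂, ŝ)` of Helmholtz solutions with trace supported on the top edge. -/
structure SLoc (κ h1 h2 : ℝ) (N M : ℕ) (u : ℝ × ℝ → ℂ) : Prop where
  cont : ContinuousOn u (Icc 0 h1 ×ˢ Icc 0 h2)
  mem : MemSob 1 (Khat h1 h2) u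
  helm : WeakHelmholtz κ (Khat h1 h2) u
  left : ∀ y ∈ Icc (0 : ℝ) h2, u (0, y) = 0
  right : ∀ y ∈ Icc (0 : ℝ) h2, u (h1, y) = 0
  bottom : ∀ x ∈ Icc (0 : ℝ) h1, u (x, 0) = 0
  traceReg : ContDiffOn ℝ M (traceTop h2 u) (Icc 0 h1)
  endpt0 : ∀ j < N, iteratedDerivWithin (2 * j) (traceTop h2 u) (Icc 0 h1) 0 = 0
  endpt1 : ∀ j < N, iteratedDerivWithin (2 * j) (traceTop h2 u) (Icc 0 h1) h1 = 0

/-- Square of the trace seminorm `|u|_{H^M_κ(ŝ)}`. -/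
def traceSemiSq (κ h1 h2 : ℝ) (M : ℕ) (u : ℝ × ℝ → ℂ) : ℝ :=
  (κ ^ (2 * M))⁻¹ * ∫ t in (0 : ℝ)..h1, ‖iteratedDerivWithin M (traceTop h2 u) (Icc 0 h1) t‖ ^ 2

/-- The `L²(ŝ)` inner product of traces on the top edge. -/
def traceL2Inner (h1 h2 : ℝ) (u v : ℝ × ℝ → ℂ) : ℂ :=
  ∫ t in (0 : ℝ)..h1, u (t, h2) * (starRingEnd ℂ) (v (t, h2))

/-- The squared `L²(ŝ)` norm of the trace on the top edge. -/
def traceL2Sq (h1 h2 : ℝ) (u : ℝ × ℝ → ℂ) : ℝ :=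
  ∫ t in (0 : ℝ)..h1, ‖u (t, h2)‖ ^ 2

/-! ### Cartesian mesh machinery -/

/-- The open cell of the Cartesian grid indexed by `c ∈ ℤ²`. -/
def cellO (h1 h2 : ℝ) (c : ℤ × ℤ) : Set (ℝ × ℝ) :=
  Ioo ((c.1 : ℝ) * h1) (((c.1 : ℝ) + 1) * h1) ×ˢ Ioo ((c.2 : ℝ) * h2) (((c.2 : ℝ) + 1) * h2)

/-- The closed cell of the Cartesian grid indexed by `c ∈ ℤ²`. -/
def cellC (h1 h2 : ℝ) (c : ℤ × ℤ) : Set (ℝ × ℝ) :=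
  Icc ((c.1 : ℝ) * h1) (((c.1 : ℝ) + 1) * h1) ×ˢ Icc ((c.2 : ℝ) * h2) (((c.2 : ℝ) + 1) * h2)

/-- Horizontal edges of the mesh: `(i,j)` corresponds to `[i h₁,(i+1)h₁] × {j h₂}`. -/
def hEdges (cells : Finset (ℤ × ℤ)) : Finset (ℤ × ℤ) :=
  cells ∪ cells.image fun c => (c.1, c.2 + 1)

/-- Vertical edges of the mesh: `(i,j)` corresponds to `{i h₁} × [j h₂,(j+1)h₂]`. -/
def vEdges (cells : Finset (ℤ × ℤ)) : Finset (ℤ × ℤ) :=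
  cells ∪ cells.image fun c => (c.1 + 1, c.2)

/-- Nodes of the mesh: `(i,j)` corresponds to the point `(i h₁, j h₂)`. -/
def meshNodes (cells : Finset (ℤ × ℤ)) : Finset (ℤ × ℤ) :=
  ((cells ∪ cells.image fun c => (c.1 + 1, c.2)) ∪
    cells.image fun c => (c.1, c.2 + 1)) ∪
    cells.image fun c => (c.1 + 1, c.2 + 1)

/-- The point of `ℝ²` corresponding to the node index `p`. -/
def nodePt (h1 h2 : ℝ) (p : ℤ × ℤ) : ℝ × ℝ := ((p.1 : ℝ) * h1, (p.2 : ℝ) * h2)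

/-- `Ω` is exactly tessellated by the cells of the Cartesian grid indexed by `cells`. -/
def IsTessellation (h1 h2 : ℝ) (cells : Finset (ℤ × ℤ)) (Ω : Set (ℝ × ℝ)) : Prop :=
  cells.Nonempty ∧ Ω = interior (⋃ c ∈ cells, cellC h1 h2 c) ∧
    closure Ω = ⋃ c ∈ cells, cellC h1 h2 c

/-- The edge basis function `φ_{s,n}` associated with the horizontal edge `e`. -/
def phiEdgeH (κ h1 h2 : ℝ) (cells : Finset (ℤ × ℤ)) (e : ℤ × ℤ) (n : ℕ) : ℝ × ℝ → ℂ :=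
  fun x =>
    if e ∈ cells ∧ x ∈ cellC h1 h2 e then
      phiHat κ h1 h2 n (x.1 - (e.1 : ℝ) * h1, h2 + ((e.2 : ℝ) * h2 - x.2))
    else if (e.1, e.2 - 1) ∈ cells ∧ x ∈ cellC h1 h2 (e.1, e.2 - 1) then
      phiHat κ h1 h2 n (x.1 - (e.1 : ℝ) * h1, h2 - ((e.2 : ℝ) * h2 - x.2))
    else 0

/-- The edge basis function `φ_{s,n}` associated with the vertical edge `e`. -/
def phiEdgeV (κ h1 h2 : ℝ) (cells : Finset (ℤ × ℤ)) (e : ℤ × ℤ) (n : ℕ) : ℝ × ℝ → ℂ :=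
  fun x =>
    if e ∈ cells ∧ x ∈ cellC h1 h2 e then
      phiHat κ h2 h1 n (x.2 - (e.2 : ℝ) * h2, h1 + ((e.1 : ℝ) * h1 - x.1))
    else if (e.1 - 1, e.2) ∈ cells ∧ x ∈ cellC h1 h2 (e.1 - 1, e.2) then
      phiHat κ h2 h1 n (x.2 - (e.2 : ℝ) * h2, h1 - ((e.1 : ℝ) * h1 - x.1))
    else 0

/-- The node basis function `ψ_{p,n}` associated with the node `p`. -/
def psiNode (κ h1 h2 : ℝ) (p : ℤ × ℤ) (n : ℕ) : ℝ × ℝ → ℂ :=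
  fun x =>
    if x ∈ Icc (((p.1 : ℝ) - 1) * h1) (((p.1 : ℝ) + 1) * h1) ×ˢ
        Icc ((p.2 : ℝ) * h2) (((p.2 : ℝ) + 1) * h2) then
      phiHat κ (2 * h1) h2 (2 * n - 1) (h1 - ((p.1 : ℝ) * h1 - x.1), h2 + ((p.2 : ℝ) * h2 - x.2))
    else if x ∈ Icc (((p.1 : ℝ) - 1) * h1) (((p.1 : ℝ) + 1) * h1) ×ˢ
        Icc (((p.2 : ℝ) - 1) * h2) ((p.2 : ℝ) * h2) then
      phiHat κ (2 * h1) h2 (2 * n - 1) (h1 - ((p.1 : ℝ) * h1 - x.1), h2 - ((p.2 : ℝ) * h2 - x.2))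
    else 0

/-- The set of edge basis functions with at most `Ne` modes per edge. -/
def edgeFuns (κ h1 h2 : ℝ) (cells : Finset (ℤ × ℤ)) (Ne : ℕ) : Set (ℝ × ℝ → ℂ) :=
  {f | ∃ e ∈ hEdges cells, ∃ n : ℕ, 1 ≤ n ∧ n ≤ Ne ∧ f = phiEdgeH κ h1 h2 cells e n} ∪
  {f | ∃ e ∈ vEdges cells, ∃ n : ℕ, 1 ≤ n ∧ n ≤ Ne ∧ f = phiEdgeV κ h1 h2 cells e n}

/-- The set of node basis functions with at most `Nn` modes per node. -/
def nodeFuns (κ h1 h2 : ℝ) (cells : Finset (ℤ × ℤ)) (Nn : ℕ) : Set (ℝ × ℝ → ℂ) :=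
  {f | ∃ p ∈ meshNodes cells, ∃ n : ℕ, 1 ≤ n ∧ n ≤ Nn ∧ f = psiNode κ h1 h2 p n}

/-- The edge-based Trefftz space `V_{N_e}(Σ_h)`. -/
def edgeSpace (κ h1 h2 : ℝ) (cells : Finset (ℤ × ℤ)) (Ne : ℕ) :
    Submodule ℂ (ℝ × ℝ → ℂ) :=
  Submodule.span ℂ (edgeFuns κ h1 h2 cells Ne)

/-- The combined edge-and-node Trefftz space `V_𝐍(T_h)`. -/
def combinedSpace (κ h1 h2 : ℝ) (cells : Finset (ℤ × ℤ)) (Ne Nn : ℕ) :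
    Submodule ℂ (ℝ × ℝ → ℂ) :=
  Submodule.span ℂ (edgeFuns κ h1 h2 cells Ne ∪ nodeFuns κ h1 h2 cells Nn)

/-- Square of the broken Sobolev norm `‖·‖²_{H^r_κ(T_h)}`. -/
def brokenNormSq (κ : ℝ) (r : ℕ) (h1 h2 : ℝ) (cells : Finset (ℤ × ℤ))
    (f : ℝ × ℝ → ℂ) : ℝ :=
  ∑ c ∈ cells, sobNormSq κ r (cellO h1 h2 c) f

/-- The global class `S^{N,M}_κ(T_h)`. -/
structure SGlob (κ h1 h2 : ℝ) (cells : Finset (ℤ × ℤ)) (Ω : Set (ℝ × ℝ)) (N M : ℕ)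
    (u : ℝ × ℝ → ℂ) : Prop where
  cont : ContinuousOn u (closure Ω)
  mem : ∀ c ∈ cells, MemSob 1 (cellO h1 h2 c) u
  helm : ∀ c ∈ cells, WeakHelmholtz κ (cellO h1 h2 c) u
  htraceReg : ∀ e ∈ hEdges cells,
    ContDiffOn ℝ M (fun t => u (t, (e.2 : ℝ) * h2)) (Icc ((e.1 : ℝ) * h1) (((e.1 : ℝ) + 1) * h1))
  hend : ∀ e ∈ hEdges cells, ∀ j < N,
    iteratedDerivWithin (2 * j) (fun t => u (t, (e.2 : ℝ) * h2))
        (Icc ((e.1 : ℝ) * h1) (((e.1 : ℝ) + 1) * h1)) ((e.1 : ℝ) * h1) = 0 ∧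
    iteratedDerivWithin (2 * j) (fun t => u (t, (e.2 : ℝ) * h2))
        (Icc ((e.1 : ℝ) * h1) (((e.1 : ℝ) + 1) * h1)) (((e.1 : ℝ) + 1) * h1) = 0
  vtraceReg : ∀ e ∈ vEdges cells,
    ContDiffOn ℝ M (fun t => u ((e.1 : ℝ) * h1, t)) (Icc ((e.2 : ℝ) * h2) (((e.2 : ℝ) + 1) * h2))
  vend : ∀ e ∈ vEdges cells, ∀ j < N,
    iteratedDerivWithin (2 * j) (fun t => u ((e.1 : ℝ) * h1, t))
        (Icc ((e.2 : ℝ) * h2) (((e.2 : ℝ) + 1) * h2)) ((e.2 : ℝ) * h2) = 0 ∧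
    iteratedDerivWithin (2 * j) (fun t => u ((e.1 : ℝ) * h1, t))
        (Icc ((e.2 : ℝ) * h2) (((e.2 : ℝ) + 1) * h2)) (((e.2 : ℝ) + 1) * h2) = 0

/-- Square of the skeleton seminorm `|u|²_{H^μ_κ(Σ_h)}`. -/
def skelSemiSq (κ h1 h2 : ℝ) (cells : Finset (ℤ × ℤ)) (μ : ℕ) (u : ℝ × ℝ → ℂ) : ℝ :=
  (∑ e ∈ hEdges cells, (κ ^ (2 * μ))⁻¹ *
    ∫ t in ((e.1 : ℝ) * h1)..(((e.1 : ℝ) + 1) * h1),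
      ‖iteratedDerivWithin μ (fun t => u (t, (e.2 : ℝ) * h2))
          (Icc ((e.1 : ℝ) * h1) (((e.1 : ℝ) + 1) * h1)) t‖ ^ 2) +
  ∑ e ∈ vEdges cells, (κ ^ (2 * μ))⁻¹ *
    ∫ t in ((e.2 : ℝ) * h2)..(((e.2 : ℝ) + 1) * h2),
      ‖iteratedDerivWithin μ (fun t => u ((e.1 : ℝ) * h1, t))
          (Icc ((e.2 : ℝ) * h2) (((e.2 : ℝ) + 1) * h2)) t‖ ^ 2

/-- `ν̃_n = (2n−1)π/(2κh₁)`. -/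
def nuTil (κ h1 : ℝ) (n : ℕ) : ℝ := (2 * (n : ℝ) - 1) * π / (2 * (κ * h1))

/-- `d̃`: distance to the node-associated propagative resonances. -/
def dTil (κ h1 h2 : ℝ) : ℝ :=
  sInf {d : ℝ | ∃ n : ℕ, 1 ≤ n ∧ nuTil κ h1 n < 1 ∧
    ∃ m : ℕ, d = |Real.sqrt (1 - nuTil κ h1 n ^ 2) - m * π / (κ * h2)|}

/-- `d̃₀`. -/
def dTil0 (κ h1 : ℝ) : ℝ :=
  sInf {d : ℝ | ∃ n : ℕ, 1 ≤ n ∧ 1 < nuTil κ h1 n ∧ d = Real.sqrt (nuTil κ h1 n ^ 2 - 1)}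

/-- `χ_N = min(ρe^{κh}/(κh), e·max(1,κh)^{2(N−1)})`. -/
def chiN (ρ kh : ℝ) (N : ℕ) : ℝ :=
  min (ρ * Real.exp kh / kh) (Real.exp 1 * max 1 kh ^ (2 * (N - 1)))

/-- Assumption A2: `κ² ∉ σ(2h₁,h₂)`. -/
def A2cond (κ h1 h2 : ℝ) : Prop := A0cond κ (2 * h1) h2

/-- The mesh size `h = max(h₁,h₂)`. -/
def meshH (h1 h2 : ℝ) : ℝ := max h1 h2

/-- The shape parameter `ρ = h/min(h₁,h₂)`. -/
def meshRho (h1 h2 : ℝ) : ℝ := max h1 h2 / min h1 h2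

/-- The constant `C₂`. -/
def C2const (κ h1 h2 : ℝ) (cells : Finset (ℤ × ℤ)) : ℝ :=
  2 * π * ((meshNodes cells).card : ℝ) * meshRho h1 h2 ^ ((3 : ℝ) / 2) *
      max 1 (κ * meshH h1 h2) ^ 2 /
    (Real.sqrt 2 * (κ * meshH h1 h2) * dTil κ h1 h2)

/-- The constant `C₃`. -/
def C3const (κ h1 h2 : ℝ) : ℝ :=
  2 * dTil κ h1 h2 /
    Real.sqrt (π * meshRho h1 h2 *
      Real.tanh (κ * meshH h1 h2 / meshRho h1 h2) * dTil0 κ h1)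

/-- The nodal collocation system for coefficients `β` and datum `u`. -/
def CollocationSystem (κ h1 h2 : ℝ) (cells : Finset (ℤ × ℤ)) (N : ℕ)
    (u : ℝ × ℝ → ℂ) (β : {p : ℤ × ℤ // p ∈ meshNodes cells} × Fin N → ℂ) : Prop :=
  ∀ n : ℕ, n ≤ N - 1 → ∀ q ∈ meshNodes cells,
    (∑ p ∈ (meshNodes cells).attach, ∑ m : Fin N,
        β (p, m) * (((κ : ℂ)⁻¹) ^ (2 * n) *
          pdM (2 * n) 0 (psiNode κ h1 h2 p.1 ((m : ℕ) + 1)) (nodePt h1 h2 q))) =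
      ((κ : ℂ)⁻¹) ^ (2 * n) * pdM (2 * n) 0 u (nodePt h1 h2 q)

/-- The nodal interpolant `𝒱u = Σ β_{p,m} ψ_{p,m}`. -/
def nodeInterp (κ h1 h2 : ℝ) (cells : Finset (ℤ × ℤ)) (N : ℕ)
    (β : {p : ℤ × ℤ // p ∈ meshNodes cells} × Fin N → ℂ) : ℝ × ℝ → ℂ :=
  fun x => ∑ p ∈ (meshNodes cells).attach, ∑ m : Fin N,
    β (p, m) * psiNode κ h1 h2 p.1 ((m : ℕ) + 1) x

/-- The edge coefficient `α_{s,n} = (w, φ_{s,n})_{L²(s)}/‖φ_{s,n}‖²_{L²(s)}` for the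
horizontal edge `e`. -/
def alphaH (κ h1 h2 : ℝ) (cells : Finset (ℤ × ℤ)) (w : ℝ × ℝ → ℂ) (e : ℤ × ℤ)
    (n : ℕ) : ℂ :=
  (∫ t in ((e.1 : ℝ) * h1)..(((e.1 : ℝ) + 1) * h1),
      w (t, (e.2 : ℝ) * h2) *
        (starRingEnd ℂ) (phiEdgeH κ h1 h2 cells e n (t, (e.2 : ℝ) * h2))) /
    ((∫ t in ((e.1 : ℝ) * h1)..(((e.1 : ℝ) + 1) * h1),
        ‖phiEdgeH κ h1 h2 cells e n (t, (e.2 : ℝ) * h2)‖ ^ 2 : ℝ) : ℂ)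

/-- The edge coefficient `α_{s,n}` for the vertical edge `e`. -/
def alphaV (κ h1 h2 : ℝ) (cells : Finset (ℤ × ℤ)) (w : ℝ × ℝ → ℂ) (e : ℤ × ℤ)
    (n : ℕ) : ℂ :=
  (∫ t in ((e.2 : ℝ) * h2)..(((e.2 : ℝ) + 1) * h2),
      w ((e.1 : ℝ) * h1, t) *
        (starRingEnd ℂ) (phiEdgeV κ h1 h2 cells e n ((e.1 : ℝ) * h1, t))) /
    ((∫ t in ((e.2 : ℝ) * h2)..(((e.2 : ℝ) + 1) * h2),
        ‖phiEdgeV κ h1 h2 cells e n ((e.1 : ℝ) * h1, t)‖ ^ 2 : ℝ) : ℂ)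

/-- Signed Lagrange weight of the odd integer `2m+1` among the first `N` odd integers. -/
def oddWeight (N m : ℕ) : ℝ :=
  ∏ j ∈ (Finset.range N).erase m, (1 - (2 * m + 1 : ℝ) ^ 2 / (2 * j + 1) ^ 2)⁻¹

lemma prod_range_sub_mul_add (m : ℕ) :
    ∏ j ∈ Finset.range m, (((m : ℝ) - j) * (m + 1 + j)) = ((2 * m).factorial : ℝ) := by
  have h1 : (∏ j ∈ Finset.range m, ((m : ℝ) - j)) = (m.factorial : ℝ) := by
    rw [← Nat.descFactorial_self, Nat.descFactorial_eq_prod_range, Nat.cast_prod]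
    refine Finset.prod_congr rfl fun j hj => ?_
    rw [Nat.cast_sub (Finset.mem_range.1 hj).le]
  have h2 : (∏ j ∈ Finset.range m, ((m : ℝ) + 1 + j)) = ((m + 1).ascFactorial m : ℝ) := by
    rw [Nat.ascFactorial_eq_prod_range, Nat.cast_prod]
    refine Finset.prod_congr rfl fun j hj => ?_
    push_cast; ring
  rw [Finset.prod_mul_distrib, h1, h2, ← Nat.cast_mul, Nat.factorial_mul_ascFactorial, two_mul]

lemma oddWeight_closed (m k : ℕ) :
    oddWeight (m + 1 + k) m = (-1) ^ m * (4 * ∏ j ∈ Finset.range (m + 1 + k), ((2 * j + 1 : ℝ) ^ 2 / 4)) /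
      ((2 * m + 1) * k.factorial * (2 * m + 1 + k).factorial) := by
  induction k with
  | zero =>
    have he : (Finset.range (m + 1 + 0)).erase m = Finset.range m := by
      ext j; simp; omega
    have h : oddWeight (m + 1 + 0) m = ∏ j ∈ Finset.range m,
        ((-1) * ((2 * j + 1 : ℝ) ^ 2 / 4) * (((m : ℝ) - j) * (m + 1 + j))⁻¹) := by
      unfold oddWeight
      rw [he]
      refine Finset.prod_congr rfl fun j hj => ?_
      have hj' : (j : ℝ) < m := by exact_mod_cast Finset.mem_range.1 hj
      have h1 : (m : ℝ) - j ≠ 0 := by linarith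
      have h2 : (m : ℝ) + 1 + j ≠ 0 := by positivity
      have h3 : (2 * j + 1 : ℝ) ≠ 0 := by positivity
      have h4 : (1 - (2 * m + 1 : ℝ) ^ 2 / (2 * j + 1) ^ 2) =
        -(4 * (((m : ℝ) - j) * (m + 1 + j))) / (2 * j + 1) ^ 2 := by field_simp; ring
      rw [h4]; field_simp
    rw [h, Finset.prod_mul_distrib, Finset.prod_mul_distrib, Finset.prod_inv_distrib,
      prod_range_sub_mul_add, Finset.prod_const, Finset.card_range, add_zero, Finset.prod_range_succ,
      Nat.factorial_zero, add_zero, Nat.factorial_succ]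
    have := Nat.factorial_pos (2 * m)
    push_cast
    have h3 : (2 * m + 1 : ℝ) ≠ 0 := by positivity
    field_simp
  | succ k ih =>
    have he : (Finset.range (m + 1 + (k + 1))).erase m =
        insert (m + 1 + k) ((Finset.range (m + 1 + k)).erase m) := by
      ext j; simp; omega
    have hn : (m + 1 + k) ∉ ((Finset.range (m + 1 + k)).erase m) := by simp
    have h : oddWeight (m + 1 + (k + 1)) m =
        (1 - (2 * m + 1 : ℝ) ^ 2 / (2 * (m + 1 + k : ℕ) + 1) ^ 2)⁻¹ * oddWeight (m + 1 + k) m := by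
      unfold oddWeight
      rw [he, Finset.prod_insert hn]
    have h4 : (1 - (2 * m + 1 : ℝ) ^ 2 / (2 * (m + 1 + k : ℕ) + 1) ^ 2) =
        (4 * (k + 1) * (2 * m + 1 + k + 1)) / (2 * (m + 1 + k : ℕ) + 1) ^ 2 := by
      push_cast; field_simp; ring
    rw [h, ih, h4, show m + 1 + (k + 1) = m + 1 + k + 1 by ring, Finset.prod_range_succ,
      Nat.factorial_succ, show 2 * m + 1 + (k + 1) = 2 * m + 1 + k + 1 by ring, Nat.factorial_succ (2 * m + 1 + k)]
    have := Nat.factorial_pos k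
    have := Nat.factorial_pos (2 * m + 1 + k)
    push_cast
    field_simp

lemma oddWeight_eq_neg_one_pow_mul_abs {N m : ℕ} (h : m < N) :
    oddWeight N m = (-1) ^ m * |oddWeight N m| := by
  obtain ⟨k, rfl⟩ := Nat.exists_eq_add_of_le (Nat.succ_le_of_lt h)
  rw [Nat.succ_eq_add_one, oddWeight_closed, mul_div_assoc, abs_mul, abs_pow, abs_neg, abs_one, one_pow, one_mul,
    abs_of_nonneg (by positivity)]

lemma abs_oddWeight_closed (m k : ℕ) :
    |oddWeight (m + 1 + k) m| = (4 * ∏ j ∈ Finset.range (m + 1 + k), ((2 * j + 1 : ℝ) ^ 2 / 4)) /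
      ((2 * m + 1) * k.factorial * (2 * m + 1 + k).factorial) := by
  rw [oddWeight_closed, mul_div_assoc, abs_mul, abs_pow, abs_neg, abs_one, one_pow, one_mul,
    abs_of_nonneg (by positivity)]

lemma abs_oddWeight_succ_le {N m : ℕ} (h : m + 1 < N) :
    (2 * (m + 1 : ℕ) + 1) * |oddWeight N (m + 1)| ≤ (2 * m + 1) * |oddWeight N m| := by
  obtain ⟨k, rfl⟩ := Nat.exists_eq_add_of_le (Nat.succ_le_of_lt h)
  have e1 := abs_oddWeight_closed (m + 1) k
  have e2 := abs_oddWeight_closed m (k + 1)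
  rw [show m + 1 + (k + 1) = m + 1 + 1 + k by ring] at e2
  rw [Nat.succ_eq_add_one, e1, e2, show 2 * (m + 1) + 1 + k = (2 * m + 1 + (k + 1)) + 1 by ring,
    Nat.factorial_succ k, Nat.factorial_succ (2 * m + 1 + (k + 1))]
  set D := (4 * ∏ j ∈ Finset.range (m + 1 + 1 + k), ((2 * j + 1 : ℝ) ^ 2 / 4))
  have hD : 0 ≤ D := by positivity
  have := Nat.factorial_pos k
  have := Nat.factorial_pos (2 * m + 1 + (k + 1))
  push_cast
  rw [mul_div_assoc', mul_div_assoc', div_le_div_iff₀ (by positivity) (by positivity)]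
  have : 0 ≤ D * (2 * m + 1) * (2 * (m + 1) + 1) * k.factorial * (2 * m + 1 + (k + 1)).factorial := by
    positivity
  nlinarith

lemma abs_oddWeight_zero_mul_wallis (k : ℕ) :
    |oddWeight (k + 1) 0| * Real.Wallis.W k = (2 * k + 1) / (k + 1) := by
  have key : ∀ k : ℕ, (4 * ∏ j ∈ Finset.range (k + 1), ((2 * j + 1 : ℝ) ^ 2 / 4)) /
      (k.factorial * (k + 1).factorial) * Real.Wallis.W k = (2 * k + 1) / (k + 1) := by
    intro k
    induction k with
    | zero => simp [Real.Wallis.W]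
    | succ k ih =>
      rw [Finset.prod_range_succ, Real.Wallis.W_succ, Nat.factorial_succ (k + 1)]
      have e : k.factorial * (k + 1) = (k + 1).factorial := by rw [Nat.factorial_succ]; ring
      have e' : ((k + 1).factorial : ℝ) = k.factorial * (k + 1) := by exact_mod_cast e.symm
      have := Nat.factorial_pos k
      push_cast
      rw [e'] at ih ⊢
      rw [div_mul_eq_mul_div, div_eq_div_iff (by positivity) (by positivity)] at ih
      field_simp at ih ⊢
      linear_combination (2 * (k : ℝ) + 3) * ih
  have := abs_oddWeight_closed 0 k
  rw [show 0 + 1 + k = k + 1 by ring] at this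
  rw [this, ← key k]
  simp

lemma abs_oddWeight_zero_le (k : ℕ) : |oddWeight (k + 1) 0| ≤ 4 / π := by
  have h := abs_oddWeight_zero_mul_wallis k
  have hW := Real.Wallis.le_W k
  have hp := Real.Wallis.W_pos k
  have : |oddWeight (k + 1) 0| = (2 * k + 1) / (k + 1) / Real.Wallis.W k := by
    rw [eq_div_iff hp.ne', h]
  rw [this, div_le_iff₀ hp]
  calc (2 * k + 1 : ℝ) / (k + 1) = 4 / π * ((2 * k + 1) / (2 * k + 2) * (π / 2)) := by
        field_simp; ring
    _ ≤ _ := by gcongr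

lemma abs_oddWeight_le {N m : ℕ} (h : m < N) : |oddWeight N m| ≤ 4 / π / (2 * m + 1) := by
  rw [le_div_iff₀ (by positivity), mul_comm]
  induction m with
  | zero =>
    obtain ⟨k, rfl⟩ := Nat.exists_eq_add_of_le (Nat.succ_le_of_lt h)
    simpa [add_comm] using abs_oddWeight_zero_le k
  | succ m ih => exact (abs_oddWeight_succ_le h).trans (ih (by omega))

lemma abs_oddWeight_antitone {N m : ℕ} (h : m + 1 < N) :
    |oddWeight N (m + 1)| ≤ |oddWeight N m| := by
  have := abs_oddWeight_succ_le h
  push_cast at this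
  have h0 := abs_nonneg (oddWeight N m)
  have h1 := abs_nonneg (oddWeight N (m + 1))
  nlinarith [(Nat.cast_nonneg m : (0 : ℝ) ≤ m)]

/-- The polynomial `∏ (1 + l/(2j+1)² X)` over `j ∈ s`. -/
def oddPoly (l : ℝ) (s : Finset ℕ) : Polynomial ℝ :=
  ∏ j ∈ s, (1 + Polynomial.C (l / (2 * j + 1 : ℝ) ^ 2) * Polynomial.X)

/-- Elementary symmetric sums of `l/(2j+1)²` over `j ∈ s`. -/
def oddE (l : ℝ) (s : Finset ℕ) (n : ℕ) : ℝ := (oddPoly l s).coeff n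

lemma oddE_empty_zero (l : ℝ) : oddE l ∅ 0 = 1 := by simp [oddE, oddPoly]

lemma oddE_empty_succ (l : ℝ) (n : ℕ) : oddE l ∅ (n + 1) = 0 := by
  simp [oddE, oddPoly, Polynomial.coeff_one]

lemma oddE_insert_zero (l : ℝ) {s : Finset ℕ} {a : ℕ} (ha : a ∉ s) :
    oddE l (insert a s) 0 = oddE l s 0 := by
  simp only [oddE, oddPoly]
  rw [Finset.prod_insert ha, Polynomial.mul_coeff_zero]
  simp

lemma oddE_insert_succ (l : ℝ) {s : Finset ℕ} {a : ℕ} (ha : a ∉ s) (n : ℕ) :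
    oddE l (insert a s) (n + 1) = oddE l s (n + 1) + l / (2 * a + 1 : ℝ) ^ 2 * oddE l s n := by
  simp only [oddE, oddPoly]
  rw [Finset.prod_insert ha, add_mul, one_mul, Polynomial.coeff_add, mul_assoc,
    Polynomial.coeff_C_mul, Polynomial.coeff_X_mul]

lemma oddE_zero (l : ℝ) (s : Finset ℕ) : oddE l s 0 = 1 := by
  induction s using Finset.induction_on with
  | empty => exact oddE_empty_zero l
  | insert a s ha ih => rw [oddE_insert_zero l ha, ih]

lemma oddE_nonneg {l : ℝ} (hl : 0 ≤ l) (s : Finset ℕ) (n : ℕ) : 0 ≤ oddE l s n := by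
  induction s using Finset.induction_on generalizing n with
  | empty => cases n <;> simp [oddE_empty_zero, oddE_empty_succ]
  | insert a s ha ih =>
    cases n with
    | zero => rw [oddE_zero]; norm_num
    | succ n =>
      rw [oddE_insert_succ l ha]
      have h1 := ih (n + 1)
      have h2 := ih n
      positivity

lemma oddE_le_pow {l : ℝ} (hl : 0 ≤ l) (s : Finset ℕ) (n : ℕ) :
    oddE l s n ≤ (∑ j ∈ s, l / (2 * j + 1 : ℝ) ^ 2) ^ n := by
  induction s using Finset.induction_on generalizing n with
  | empty => cases n <;> simp [oddE_empty_zero, oddE_empty_succ]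
  | insert a s ha ih =>
    cases n with
    | zero => rw [oddE_zero]; norm_num
    | succ n =>
      rw [oddE_insert_succ l ha, Finset.sum_insert ha]
      have h1 := ih (n + 1)
      have h2 := ih n
      have hS : 0 ≤ ∑ j ∈ s, l / (2 * j + 1 : ℝ) ^ 2 := Finset.sum_nonneg fun j _ => by positivity
      generalize ∑ j ∈ s, l / (2 * j + 1 : ℝ) ^ 2 = S at h1 h2 hS ⊢
      have hc : 0 ≤ l / (2 * a + 1 : ℝ) ^ 2 := by positivity
      generalize l / (2 * a + 1 : ℝ) ^ 2 = c at hc ⊢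
      calc oddE l s (n + 1) + c * oddE l s n ≤ S ^ (n + 1) + c * S ^ n := by gcongr
        _ = (c + S) * S ^ n := by ring
        _ ≤ (c + S) * (c + S) ^ n :=
            mul_le_mul_of_nonneg_left (pow_le_pow_left₀ hS (by linarith) n) (by linarith)
        _ = _ := by ring

lemma oddE_erase_antitone {l : ℝ} (hl : 0 ≤ l) {s : Finset ℕ} {a b : ℕ} (ha : a ∈ s) (hb : b ∈ s)
    (hab : a ≤ b) (n : ℕ) :
    l / (2 * b + 1 : ℝ) ^ 2 * oddE l (s.erase b) n ≤ l / (2 * a + 1 : ℝ) ^ 2 * oddE l (s.erase a) n := by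
  rcases hab.eq_or_lt with rfl | hlt
  · rfl
  have hsa : s.erase a = insert b ((s.erase a).erase b) := by
    rw [Finset.insert_erase]; simp [hb, hlt.ne']
  have hsb : s.erase b = insert a ((s.erase a).erase b) := by
    rw [Finset.erase_right_comm, Finset.insert_erase]; simp [ha, hlt.ne]
  have hna : a ∉ (s.erase a).erase b := by simp
  have hnb : b ∉ (s.erase a).erase b := by simp
  have hc : l / (2 * b + 1 : ℝ) ^ 2 ≤ l / (2 * a + 1 : ℝ) ^ 2 := by
    have : (a : ℝ) ≤ b := by exact_mod_cast hab
    gcongr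
  rw [hsa, hsb]
  cases n with
  | zero => simpa [oddE_zero] using hc
  | succ n =>
    rw [oddE_insert_succ l hna, oddE_insert_succ l hnb]
    have h1 := oddE_nonneg hl ((s.erase a).erase b) (n + 1)
    nlinarith

lemma oddE_eq_erase_add {l : ℝ} {s : Finset ℕ} {a : ℕ} (ha : a ∈ s) (n : ℕ) :
    oddE l s (n + 1) = oddE l (s.erase a) (n + 1) + l / (2 * a + 1 : ℝ) ^ 2 * oddE l (s.erase a) n := by
  conv_lhs => rw [← Finset.insert_erase ha]
  exact oddE_insert_succ l (by simp) n

lemma oddPoly_natDegree_le (l : ℝ) (s : Finset ℕ) : (oddPoly l s).natDegree ≤ s.card := by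
  refine (Polynomial.natDegree_prod_le _ _).trans ?_
  rw [Finset.card_eq_sum_ones]
  refine Finset.sum_le_sum fun j _ => ?_
  refine (Polynomial.natDegree_add_le _ _).trans ?_
  simp only [Polynomial.natDegree_one, zero_le, sup_of_le_right]
  exact (Polynomial.natDegree_C_mul_le _ _).trans Polynomial.natDegree_X_le

lemma sum_oddE_mul_pow (l : ℝ) {N m : ℕ} (h : m < N) (x : ℝ) :
    ∑ n ∈ Finset.range N, oddE l ((Finset.range N).erase m) n * x ^ n =
      ∏ j ∈ (Finset.range N).erase m, (1 + l / (2 * j + 1 : ℝ) ^ 2 * x) := by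
  have hd : (oddPoly l ((Finset.range N).erase m)).natDegree < N := by
    have := oddPoly_natDegree_le l ((Finset.range N).erase m)
    rw [Finset.card_erase_of_mem (by simpa using h), Finset.card_range] at this
    omega
  have := Polynomial.eval_eq_sum_range' hd x
  rw [oddPoly, Polynomial.eval_prod] at this
  simp only [Polynomial.eval_add, Polynomial.eval_one, Polynomial.eval_mul, Polynomial.eval_C,
    Polynomial.eval_X] at this
  rw [this]
  rfl

lemma odd_system_solution {l : ℝ} (hl : 0 < l) {N : ℕ} (b d : ℕ → ℂ)
    (h : ∀ n < N, ∑ k ∈ Finset.range N, b k * ((-((2 * k + 1 : ℝ) ^ 2 / l) : ℝ) : ℂ) ^ n = d n)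
    {m : ℕ} (hm : m < N) :
    b m = ∑ n ∈ Finset.range N,
      ((oddWeight N m * oddE l ((Finset.range N).erase m) n : ℝ) : ℂ) * d n := by
  have e1 : ∑ n ∈ Finset.range N, ((oddE l ((Finset.range N).erase m) n : ℝ) : ℂ) * d n =
      ∑ k ∈ Finset.range N, b k *
        ((∏ j ∈ (Finset.range N).erase m, (1 + l / (2 * j + 1 : ℝ) ^ 2 * (-((2 * k + 1 : ℝ) ^ 2 / l))) : ℝ) : ℂ) := by
    calc _ = ∑ n ∈ Finset.range N, ∑ k ∈ Finset.range N,
          ((oddE l ((Finset.range N).erase m) n : ℝ) : ℂ) * (b k * ((-((2 * k + 1 : ℝ) ^ 2 / l) : ℝ) : ℂ) ^ n) := by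
          refine Finset.sum_congr rfl fun n hn => ?_
          rw [← h n (Finset.mem_range.1 hn), Finset.mul_sum]
      _ = _ := by
          rw [Finset.sum_comm]
          refine Finset.sum_congr rfl fun k _ => ?_
          rw [← sum_oddE_mul_pow l hm]
          push_cast
          rw [Finset.mul_sum]
          refine Finset.sum_congr rfl fun n _ => ?_
          ring
  have e2 : ∑ k ∈ Finset.range N, b k *
        ((∏ j ∈ (Finset.range N).erase m, (1 + l / (2 * j + 1 : ℝ) ^ 2 * (-((2 * k + 1 : ℝ) ^ 2 / l))) : ℝ) : ℂ)
      = b m * (((oddWeight N m)⁻¹ : ℝ) : ℂ) := by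
    rw [Finset.sum_eq_single m]
    · congr 2
      rw [oddWeight, Finset.prod_inv_distrib, inv_inv]
      refine Finset.prod_congr rfl fun j _ => ?_
      have : (2 * j + 1 : ℝ) ≠ 0 := by positivity
      field_simp
      ring
    · intro k hk hkm
      have : ∏ j ∈ (Finset.range N).erase m, (1 + l / (2 * j + 1 : ℝ) ^ 2 * (-((2 * k + 1 : ℝ) ^ 2 / l))) = 0 := by
        refine Finset.prod_eq_zero (i := k) (by simp [hkm, Finset.mem_range.1 hk]) ?_
        have : (2 * k + 1 : ℝ) ≠ 0 := by positivity
        field_simp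
        ring
      rw [this]; simp
    · intro h'; exact absurd (Finset.mem_range.2 hm) h'
  have hne : oddWeight N m ≠ 0 := by
    obtain ⟨k, rfl⟩ := Nat.exists_eq_add_of_le (Nat.succ_le_of_lt hm)
    rw [Nat.succ_eq_add_one, oddWeight_closed]
    have : ∀ j : ℕ, (2 * j + 1 : ℝ) ≠ 0 := fun j => by positivity
    have h2 : ((2 * m + 1 + k).factorial : ℝ) ≠ 0 := by exact_mod_cast (Nat.factorial_pos _).ne'
    have h3 : (k.factorial : ℝ) ≠ 0 := by exact_mod_cast (Nat.factorial_pos _).ne'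
    refine div_ne_zero (mul_ne_zero (by simp) (mul_ne_zero (by norm_num) ?_)) ?_
    · refine Finset.prod_ne_zero_iff.2 fun j _ => ?_
      have := this j
      positivity
    · have := this m
      positivity
  have e3 : ∑ n ∈ Finset.range N,
      ((oddWeight N m * oddE l ((Finset.range N).erase m) n : ℝ) : ℂ) * d n
      = ((oddWeight N m : ℝ) : ℂ) * ∑ n ∈ Finset.range N, ((oddE l ((Finset.range N).erase m) n : ℝ) : ℂ) * d n := by
    rw [Finset.mul_sum]
    refine Finset.sum_congr rfl fun n _ => ?_
    push_cast; ring
  rw [e3, e1, e2]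
  have : ((oddWeight N m : ℝ) : ℂ) ≠ 0 := by exact_mod_cast hne
  push_cast
  field_simp

lemma tendsto_sinh_prod (y : ℝ) :
    Filter.Tendsto (fun n : ℕ => y * ∏ j ∈ Finset.range n, (1 + y ^ 2 / (π ^ 2 * (j + 1 : ℝ) ^ 2)))
      Filter.atTop (nhds (Real.sinh y)) := by
  have h := Complex.tendsto_euler_sin_prod ((y / π : ℝ) * Complex.I)
  have hpi : (π : ℂ) ≠ 0 := by exact_mod_cast Real.pi_ne_zero
  have e1 : (π : ℂ) * ((y / π : ℝ) * Complex.I) = y * Complex.I := by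
    push_cast; field_simp
  rw [e1, Complex.sin_mul_I] at h
  have h2 := (Complex.continuous_im.tendsto _).comp h
  have e2 : (Complex.sinh (y : ℂ) * Complex.I).im = Real.sinh y := by
    rw [← Complex.ofReal_sinh, Complex.mul_I_im, Complex.ofReal_re]
  rw [e2] at h2
  refine h2.congr fun n => ?_
  have e3 : ∏ j ∈ Finset.range n, (1 - (((y / π : ℝ) : ℂ) * Complex.I) ^ 2 / ((j : ℂ) + 1) ^ 2) =
      ((∏ j ∈ Finset.range n, (1 + y ^ 2 / (π ^ 2 * (j + 1 : ℝ) ^ 2)) : ℝ) : ℂ) := by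
    push_cast
    refine Finset.prod_congr rfl fun j _ => ?_
    rw [mul_pow, Complex.I_sq]
    have : (j : ℂ) + 1 ≠ 0 := by exact_mod_cast Nat.succ_ne_zero j
    field_simp
    ring
  simp only [Function.comp]
  rw [e3, mul_right_comm, ← Complex.ofReal_mul, Complex.mul_I_im, Complex.ofReal_re]

lemma odd_prod_le_cosh {y : ℝ} (hy : 0 < y) (N : ℕ) :
    ∏ j ∈ Finset.range N, (1 + (4 * y ^ 2 / π ^ 2) / (2 * j + 1 : ℝ) ^ 2) ≤ Real.cosh y := by
  have hs : Real.sinh y ≠ 0 := (Real.sinh_pos_iff.2 hy).ne'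
  have h1 := tendsto_sinh_prod y
  have h2 := (tendsto_sinh_prod (2 * y)).comp
    (Filter.tendsto_id.const_mul_atTop' (show 0 < 2 by norm_num))
  have h3 := h2.div (h1.const_mul 2) (by simpa using hs)
  have hsplit : ∀ n : ℕ, ∏ j ∈ Finset.range (2 * n), (1 + (2 * y) ^ 2 / (π ^ 2 * (j + 1 : ℝ) ^ 2)) =
      (∏ j ∈ Finset.range n, (1 + (4 * y ^ 2 / π ^ 2) / (2 * j + 1 : ℝ) ^ 2)) *
        ∏ j ∈ Finset.range n, (1 + y ^ 2 / (π ^ 2 * (j + 1 : ℝ) ^ 2)) := by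
    intro n
    induction n with
    | zero => simp
    | succ n ih =>
      rw [show 2 * (n + 1) = 2 * n + 1 + 1 by ring, Finset.prod_range_succ, Finset.prod_range_succ,
        ih, Finset.prod_range_succ, Finset.prod_range_succ]
      have e1 : (1 + (2 * y) ^ 2 / (π ^ 2 * (((2 * n : ℕ) : ℝ) + 1) ^ 2)) =
        (1 + (4 * y ^ 2 / π ^ 2) / (2 * n + 1 : ℝ) ^ 2) := by
        push_cast; field_simp; ring
      have e2 : (1 + (2 * y) ^ 2 / (π ^ 2 * (((2 * n + 1 : ℕ) : ℝ) + 1) ^ 2)) =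
        (1 + y ^ 2 / (π ^ 2 * (n + 1 : ℝ) ^ 2)) := by
        push_cast; rw [show (2 * (n : ℝ) + 1 + 1) = 2 * (n + 1) by ring]; field_simp
      rw [e1, e2]; ring
  have hlim : Real.sinh (2 * y) / (2 * Real.sinh y) = Real.cosh y := by
    rw [Real.sinh_two_mul]; field_simp
  rw [hlim] at h3
  refine ge_of_tendsto h3 ?_
  filter_upwards [Filter.eventually_ge_atTop N] with n hn
  have hp : 0 < ∏ j ∈ Finset.range n, (1 + y ^ 2 / (π ^ 2 * (j + 1 : ℝ) ^ 2)) :=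
    Finset.prod_pos fun j _ => by positivity
  have : (∏ j ∈ Finset.range n, (1 + (4 * y ^ 2 / π ^ 2) / (2 * j + 1 : ℝ) ^ 2)) =
    (2 * y * ∏ j ∈ Finset.range (2 * n), (1 + (2 * y) ^ 2 / (π ^ 2 * (j + 1 : ℝ) ^ 2))) /
    (2 * (y * ∏ j ∈ Finset.range n, (1 + y ^ 2 / (π ^ 2 * (j + 1 : ℝ) ^ 2)))) := by
    rw [hsplit]; field_simp
  simp only [Function.comp, id, Pi.div_apply]
  rw [← this]
  have hmono : Monotone fun n : ℕ =>
      ∏ j ∈ Finset.range n, (1 + (4 * y ^ 2 / π ^ 2) / (2 * j + 1 : ℝ) ^ 2) := by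
    refine monotone_nat_of_le_succ fun n => ?_
    rw [Finset.prod_range_succ]
    refine le_mul_of_one_le_right (Finset.prod_nonneg fun j _ => by positivity) ?_
    have : 0 ≤ (4 * y ^ 2 / π ^ 2) / (2 * n + 1 : ℝ) ^ 2 := by positivity
    linarith
  exact hmono hn

lemma sum_inv_odd_sq_erase_zero_le (N : ℕ) :
    ∑ j ∈ (Finset.range N).erase 0, 1 / (2 * j + 1 : ℝ) ^ 2 ≤ 17 / 72 := by
  have key : ∀ n : ℕ, ∑ j ∈ (Finset.range (n + 2)).erase 0, 1 / (2 * j + 1 : ℝ) ^ 2 ≤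
      (17 / 72 : ℝ) - 1 / (4 * ((n : ℝ) + 2)) := by
    intro n
    induction n with
    | zero =>
      have : (Finset.range (0 + 2)).erase 0 = {1} := by decide
      rw [this]; norm_num
    | succ n ih =>
      have he : (Finset.range (n + 1 + 2)).erase 0 = insert (n + 2) ((Finset.range (n + 2)).erase 0) := by
        ext j; simp; omega
      rw [he, Finset.sum_insert (by simp)]
      have : 1 / (2 * (n + 2 : ℕ) + 1 : ℝ) ^ 2 ≤ 1 / (4 * (n + 2)) - 1 / (4 * ((n + 1 : ℕ) + 2)) := by
        push_cast
        rw [div_sub_div _ _ (by positivity) (by positivity), div_le_div_iff₀ (by positivity) (by positivity)]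
        nlinarith [(Nat.cast_nonneg n : (0 : ℝ) ≤ n)]
      linarith
  have hle : ∑ j ∈ (Finset.range N).erase 0, 1 / (2 * j + 1 : ℝ) ^ 2 ≤
      ∑ j ∈ (Finset.range (N + 2)).erase 0, 1 / (2 * j + 1 : ℝ) ^ 2 := by
    refine Finset.sum_le_sum_of_subset_of_nonneg ?_ fun _ _ _ => by positivity
    exact Finset.erase_subset_erase _ (Finset.range_subset_range.2 (by omega))
  have := key N
  have h0 : (0 : ℝ) ≤ 1 / (4 * (N + 2)) := by positivity
  linarith

lemma sum_inv_odd_sq_le (N : ℕ) : ∑ j ∈ Finset.range N, 1 / (2 * j + 1 : ℝ) ^ 2 ≤ 5 / 4 := by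
  have h1 := sum_inv_odd_sq_erase_zero_le N
  rcases Nat.eq_zero_or_pos N with rfl | hN
  · norm_num
  · rw [← Finset.add_sum_erase _ _ (Finset.mem_range.2 hN)]
    norm_num at h1 ⊢
    linarith

lemma abs_oddWeight_mul_prod_le {y : ℝ} (hy : 0 < y) {N m : ℕ} (hm : m < N) :
    |oddWeight N m| * ∏ j ∈ (Finset.range N).erase m, (1 + (4 * y ^ 2 / π ^ 2) / (2 * j + 1 : ℝ) ^ 2) ≤
      4 / 3 * min (Real.exp y / y) (Real.exp 1 * max 1 y ^ (2 * (N - 1))) := by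
  have hw := abs_oddWeight_le hm
  have hpi := Real.pi_pos
  have hpi3 := Real.pi_gt_three
  rw [mul_min_of_nonneg _ _ (by norm_num)]
  refine le_min ?_ ?_
  · have h1 := odd_prod_le_cosh hy N
    rw [← Finset.mul_prod_erase _ _ (Finset.mem_range.2 hm)] at h1
    have h2 : Real.cosh y ≤ Real.exp y := by
      rw [Real.cosh_eq]
      have : Real.exp (-y) ≤ Real.exp y := Real.exp_le_exp.2 (by linarith)
      linarith
    set P := ∏ j ∈ (Finset.range N).erase m, (1 + (4 * y ^ 2 / π ^ 2) / (2 * j + 1 : ℝ) ^ 2) with hP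
    have hP0 : 0 ≤ P := Finset.prod_nonneg fun j _ => by positivity
    have h3 : y * (4 / π / (2 * m + 1)) ≤ 1 + (4 * y ^ 2 / π ^ 2) / (2 * m + 1 : ℝ) ^ 2 := by
      have : (1 + (4 * y ^ 2 / π ^ 2) / (2 * m + 1 : ℝ) ^ 2) - y * (4 / π / (2 * m + 1)) =
        (1 - 2 * y / π / (2 * m + 1)) ^ 2 := by field_simp; ring
      nlinarith [sq_nonneg (1 - 2 * y / π / (2 * m + 1))]
    rw [mul_div_assoc', le_div_iff₀ hy]
    calc |oddWeight N m| * P * y ≤ 4 / π / (2 * m + 1) * P * y := by gcongr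
      _ = y * (4 / π / (2 * m + 1)) * P := by ring
      _ ≤ (1 + (4 * y ^ 2 / π ^ 2) / (2 * m + 1 : ℝ) ^ 2) * P := by gcongr
      _ ≤ Real.exp y := h1.trans h2
      _ ≤ _ := by linarith [Real.exp_pos y]
  · have hX : 1 ≤ max 1 y := le_max_left _ _
    have hyX : y ≤ max 1 y := le_max_right _ _
    set X := max 1 y
    have h1 : ∏ j ∈ (Finset.range N).erase m, (1 + (4 * y ^ 2 / π ^ 2) / (2 * j + 1 : ℝ) ^ 2) ≤
        ∏ j ∈ (Finset.range N).erase m, (X ^ 2 * Real.exp (1 / 2 * (1 / (2 * j + 1 : ℝ) ^ 2))) := by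
      refine Finset.prod_le_prod (fun j _ => by positivity) fun j _ => ?_
      have e1 : 1 / 2 * (1 / (2 * j + 1 : ℝ) ^ 2) + 1 ≤ Real.exp (1 / 2 * (1 / (2 * j + 1 : ℝ) ^ 2)) :=
        Real.add_one_le_exp _
      have e2 : (4 * y ^ 2 / π ^ 2) / (2 * j + 1 : ℝ) ^ 2 ≤ X ^ 2 * (1 / 2 * (1 / (2 * j + 1 : ℝ) ^ 2)) := by
        have : 4 * y ^ 2 / π ^ 2 ≤ X ^ 2 * (1 / 2) := by
          rw [div_le_iff₀ (by positivity)]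
          have : y ^ 2 ≤ X ^ 2 := by gcongr
          have : (9 : ℝ) ≤ π ^ 2 := by nlinarith
          nlinarith [sq_nonneg X]
        calc _ ≤ X ^ 2 * (1 / 2) / (2 * j + 1 : ℝ) ^ 2 := by gcongr
          _ = _ := by ring
      have e3 : 1 ≤ X ^ 2 := one_le_pow₀ hX
      nlinarith [sq_nonneg X]
    rw [Finset.prod_mul_distrib, Finset.prod_const, Finset.card_erase_of_mem (Finset.mem_range.2 hm),
      Finset.card_range, ← Real.exp_sum, ← Finset.mul_sum, ← pow_mul] at h1
    have h2 : ∑ j ∈ (Finset.range N).erase m, 1 / (2 * j + 1 : ℝ) ^ 2 ≤ 5 / 4 :=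
      (Finset.sum_le_sum_of_subset_of_nonneg (Finset.erase_subset _ _) fun _ _ _ => by positivity).trans
        (sum_inv_odd_sq_le N)
    have h3 : Real.exp (1 / 2 * ∑ j ∈ (Finset.range N).erase m, 1 / (2 * j + 1 : ℝ) ^ 2) ≤ Real.exp 1 :=
      Real.exp_le_exp.2 (by linarith)
    have h4 : |oddWeight N m| ≤ 4 / 3 := by
      refine hw.trans ?_
      rw [div_le_iff₀ (by positivity), div_le_iff₀ hpi]
      nlinarith [(Nat.cast_nonneg m : (0 : ℝ) ≤ m)]
    calc _ ≤ 4 / 3 * (X ^ (2 * (N - 1)) * Real.exp 1) := by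
          refine mul_le_mul h4 (h1.trans ?_) (Finset.prod_nonneg fun j _ => by positivity) (by norm_num)
          gcongr
      _ = _ := by ring

lemma alternating_sum_mem_Icc (K : ℕ) (a : ℕ → ℝ) (ha : ∀ k < K, 0 ≤ a k) (h0 : 0 ≤ a 0)
    (hmono : ∀ k, k + 1 < K → a (k + 1) ≤ a k) :
    ∑ k ∈ Finset.range K, (-1) ^ k * a k ∈ Icc 0 (a 0) := by
  induction K generalizing a with
  | zero => simpa using h0
  | succ K ih =>
    rw [Finset.sum_range_succ']
    rcases Nat.eq_zero_or_pos K with rfl | hK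
    · simpa using h0
    have h := ih (fun k => a (k + 1)) (fun k hk => ha _ (by omega)) (ha _ (by omega))
      (fun k hk => hmono _ (by omega))
    have e : ∑ k ∈ Finset.range K, (-1 : ℝ) ^ (k + 1) * a (k + 1) =
        -∑ k ∈ Finset.range K, (-1) ^ k * a (k + 1) := by
      rw [← Finset.sum_neg_distrib]
      exact Finset.sum_congr rfl fun k _ => by ring
    have h1 := hmono 0 (by omega)
    rw [e]
    simp only [mem_Icc, pow_zero, one_mul] at h ⊢
    constructor <;> linarith [h.1, h.2]

lemma oddE_erase_le {l : ℝ} (hl : 0 ≤ l) {s : Finset ℕ} {a : ℕ} (ha : a ∈ s) (n : ℕ) :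
    oddE l (s.erase a) n ≤ oddE l s n := by
  cases n with
  | zero => simp [oddE_zero]
  | succ n =>
    rw [oddE_eq_erase_add ha]
    have := oddE_nonneg hl (s.erase a) n
    have : 0 ≤ l / (2 * a + 1 : ℝ) ^ 2 * oddE l (s.erase a) n := by positivity
    linarith

lemma weighted_sum_zero_mem {N : ℕ} (hN : 0 < N) (r : ℕ → ℝ) (hr : ∀ k < N, 0 ≤ r k)
    (hmono : ∀ k, k + 1 < N → r (k + 1) ≤ r k) :
    ∑ m ∈ Finset.range N, oddWeight N m * r m ∈ Icc 0 (4 / π * r 0) := by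
  have h := alternating_sum_mem_Icc N (fun m => |oddWeight N m| * r m)
    (fun k hk => mul_nonneg (abs_nonneg _) (hr k hk)) (mul_nonneg (abs_nonneg _) (hr 0 hN))
    (fun k hk => mul_le_mul (abs_oddWeight_antitone hk) (hmono k hk) (hr _ hk) (abs_nonneg _))
  have e : ∑ m ∈ Finset.range N, oddWeight N m * r m =
      ∑ m ∈ Finset.range N, (-1) ^ m * (|oddWeight N m| * r m) :=
    Finset.sum_congr rfl fun m hm => by
      conv_lhs => rw [oddWeight_eq_neg_one_pow_mul_abs (Finset.mem_range.1 hm)]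
      ring
  rw [e]
  refine ⟨h.1, h.2.trans ?_⟩
  have := abs_oddWeight_le hN
  simp only [CharP.cast_eq_zero, mul_zero, zero_add, div_one] at this
  exact mul_le_mul_of_nonneg_right this (hr 0 hN)

lemma abs_weighted_sum_succ_le {l : ℝ} (hl : 0 ≤ l) {N : ℕ} (hN : 0 < N) (r : ℕ → ℝ)
    (hr : ∀ k < N, 0 ≤ r k) (hmono : ∀ k, k + 1 < N → r (k + 1) ≤ r k) (n : ℕ) :
    |∑ m ∈ Finset.range N, oddWeight N m * oddE l ((Finset.range N).erase m) (n + 1) * r m| ≤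
      4 / π * (oddE l ((Finset.range N).erase 0) (n + 1) + oddE l (Finset.range N) (n + 1) / 3) * r 0 := by
  obtain ⟨K, rfl⟩ := Nat.exists_eq_succ_of_ne_zero hN.ne'
  set E := oddE l (Finset.range (K + 1)) (n + 1)
  have hE : 0 ≤ E := oddE_nonneg hl _ _
  have hr0 := hr 0 hN
  have hw0 := abs_oddWeight_le hN
  simp only [CharP.cast_eq_zero, mul_zero, zero_add, div_one] at hw0
  set e0 := oddE l ((Finset.range (K + 1)).erase 0) (n + 1)
  have he0 : 0 ≤ e0 := oddE_nonneg hl _ _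
  rw [Nat.succ_eq_add_one, Finset.sum_range_succ']
  have hfirst : |oddWeight (K + 1) 0 * e0 * r 0| ≤ 4 / π * e0 * r 0 := by
    rw [abs_mul, abs_mul, abs_of_nonneg he0, abs_of_nonneg hr0]
    gcongr
  have htail : |∑ m ∈ Finset.range K, oddWeight (K + 1) (m + 1) *
      oddE l ((Finset.range (K + 1)).erase (m + 1)) (n + 1) * r (m + 1)| ≤ 4 / π * (E / 3) * r 0 := by
    rcases Nat.eq_zero_or_pos K with rfl | hK
    · simp only [Finset.range_zero, Finset.sum_empty, abs_zero]; positivity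
    set g : ℕ → ℝ := fun m => l / (2 * m + 1 : ℝ) ^ 2 * oddE l ((Finset.range (K + 1)).erase m) n with hg
    have hg0 : ∀ m, 0 ≤ g m := fun m => by
      have := oddE_nonneg hl ((Finset.range (K + 1)).erase m) n
      simp only [hg]; positivity
    have hgm : ∀ m, m + 1 < K + 1 → g (m + 1) ≤ g m := fun m hm =>
      oddE_erase_antitone hl (by simp; omega) (by simp; omega) (Nat.le_succ m) n
    have hgE : g 1 ≤ E := by
      have := oddE_eq_erase_add (l := l) (s := Finset.range (K + 1)) (a := 1) (by simp; omega) n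
      have h2 := oddE_nonneg hl ((Finset.range (K + 1)).erase 1) (n + 1)
      simp only [hg, E]
      linarith
    have hw : ∀ k < K, 0 ≤ |oddWeight (K + 1) (k + 1)| * r (k + 1) := fun k hk =>
      mul_nonneg (abs_nonneg _) (hr _ (by omega))
    have hwm : ∀ k, k + 1 < K → |oddWeight (K + 1) (k + 1 + 1)| * r (k + 1 + 1) ≤
        |oddWeight (K + 1) (k + 1)| * r (k + 1) := fun k hk =>
      mul_le_mul (abs_oddWeight_antitone (by omega)) (hmono _ (by omega)) (hr _ (by omega)) (abs_nonneg _)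
    have h1 := alternating_sum_mem_Icc K (fun k => |oddWeight (K + 1) (k + 1)| * r (k + 1) * E)
      (fun k hk => mul_nonneg (hw k hk) hE) (mul_nonneg (hw 0 hK) hE)
      (fun k hk => mul_le_mul_of_nonneg_right (hwm k hk) hE)
    have h2 := alternating_sum_mem_Icc K (fun k => |oddWeight (K + 1) (k + 1)| * r (k + 1) * g (k + 1))
      (fun k hk => mul_nonneg (hw k hk) (hg0 _)) (mul_nonneg (hw 0 hK) (hg0 _))
      (fun k hk => mul_le_mul (hwm k hk) (hgm _ (by omega)) (hg0 _) (hw k (by omega)))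
    have e : ∑ m ∈ Finset.range K, oddWeight (K + 1) (m + 1) *
        oddE l ((Finset.range (K + 1)).erase (m + 1)) (n + 1) * r (m + 1) =
        ∑ k ∈ Finset.range K, (-1) ^ k * (|oddWeight (K + 1) (k + 1)| * r (k + 1) * g (k + 1)) -
        ∑ k ∈ Finset.range K, (-1) ^ k * (|oddWeight (K + 1) (k + 1)| * r (k + 1) * E) := by
      rw [← Finset.sum_sub_distrib]
      refine Finset.sum_congr rfl fun m hm => ?_
      have hm' := Finset.mem_range.1 hm
      have e1 := oddE_eq_erase_add (l := l) (s := Finset.range (K + 1)) (a := m + 1) (by simp; omega) n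
      conv_lhs => rw [oddWeight_eq_neg_one_pow_mul_abs (show m + 1 < K + 1 by omega)]
      have e2 : oddE l ((Finset.range (K + 1)).erase (m + 1)) (n + 1) = E - g (m + 1) := by
        simp only [hg, E]; linarith
      rw [e2]; ring
    have hw1 := abs_oddWeight_le (show 1 < K + 1 by omega)
    have hr1 : r 1 ≤ r 0 := hmono 0 (by omega)
    have hr1' := hr 1 (by omega)
    have hfin : |oddWeight (K + 1) 1| * r 1 * E ≤ 4 / π * (E / 3) * r 0 := by
      calc _ ≤ 4 / π / (2 * (1 : ℕ) + 1) * r 0 * E := by gcongr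
        _ = _ := by push_cast; ring
    have hfin2 : |oddWeight (K + 1) 1| * r 1 * g 1 ≤ |oddWeight (K + 1) 1| * r 1 * E := by gcongr
    rw [e, abs_le]
    simp only [mem_Icc, zero_add] at h1 h2
    constructor <;> linarith [h1.1, h1.2, h2.1, h2.2]
  refine (abs_add_le _ _).trans ?_
  calc _ ≤ 4 / π * (E / 3) * r 0 + 4 / π * e0 * r 0 := add_le_add htail hfirst
    _ = _ := by ring

lemma oddE_erase_zero_succ_le {l : ℝ} (hl : 0 ≤ l) (hl1 : l ≤ 1) (N n : ℕ) :
    oddE l ((Finset.range N).erase 0) (n + 1) ≤ 17 / 72 * l * (17 / 72) ^ n := by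
  have h := oddE_le_pow hl ((Finset.range N).erase 0) (n + 1)
  have h2 : ∑ j ∈ (Finset.range N).erase 0, l / (2 * j + 1 : ℝ) ^ 2 ≤ 17 / 72 * l := by
    have := mul_le_mul_of_nonneg_left (sum_inv_odd_sq_erase_zero_le N) hl
    rw [Finset.mul_sum] at this
    calc _ = ∑ j ∈ (Finset.range N).erase 0, l * (1 / (2 * j + 1 : ℝ) ^ 2) :=
          Finset.sum_congr rfl fun j _ => by ring
      _ ≤ _ := by linarith
  have h0 : 0 ≤ ∑ j ∈ (Finset.range N).erase 0, l / (2 * j + 1 : ℝ) ^ 2 :=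
    Finset.sum_nonneg fun j _ => by positivity
  generalize ∑ j ∈ (Finset.range N).erase 0, l / (2 * j + 1 : ℝ) ^ 2 = S at h h2 h0
  calc _ ≤ S ^ (n + 1) := h
    _ = S * S ^ n := by ring
    _ ≤ 17 / 72 * l * (17 / 72) ^ n := by
        refine mul_le_mul h2 (pow_le_pow_left₀ h0 ?_ n) (by positivity) (by positivity)
        linarith

lemma oddE_erase_zero_le {l : ℝ} (hl : 0 ≤ l) (hl1 : l ≤ 1) (N n : ℕ) :
    oddE l ((Finset.range N).erase 0) n ≤ (17 / 72) ^ n := by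
  cases n with
  | zero => simp [oddE_zero]
  | succ n =>
    refine (oddE_erase_zero_succ_le hl hl1 N n).trans ?_
    rw [pow_succ]
    nlinarith [pow_pos (show (0 : ℝ) < 17 / 72 by norm_num) n]

lemma oddE_range_succ_le {l : ℝ} (hl : 0 ≤ l) (hl1 : l ≤ 1) {N : ℕ} (hN : 0 < N) (n : ℕ) :
    oddE l (Finset.range N) (n + 1) ≤ 89 / 72 * l * (17 / 72) ^ n := by
  rw [oddE_eq_erase_add (Finset.mem_range.2 hN)]
  have h1 := oddE_erase_zero_succ_le hl hl1 N n
  have h2 := mul_le_mul_of_nonneg_left (oddE_erase_zero_le hl hl1 N n) hl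
  simp only [CharP.cast_eq_zero, mul_zero, zero_add, one_pow, div_one]
  linarith

lemma sq_integral_le_mul_integral_sq {a b : ℝ} (hab : a ≤ b) {g : ℝ → ℝ} (hg : Continuous g) :
    (∫ t in a..b, g t) ^ 2 ≤ (b - a) * ∫ t in a..b, g t ^ 2 := by
  rcases hab.eq_or_lt with rfl | hlt
  · simp
  have hL : 0 < b - a := by linarith
  set A := (∫ t in a..b, g t) / (b - a) with hA
  have h0 : 0 ≤ ∫ t in a..b, (g t - A) ^ 2 :=
    intervalIntegral.integral_nonneg hab fun t _ => sq_nonneg _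
  have e : ∫ t in a..b, (g t - A) ^ 2 =
      (∫ t in a..b, g t ^ 2) - 2 * A * (∫ t in a..b, g t) + A ^ 2 * (b - a) := by
    have : ∀ t, (g t - A) ^ 2 = g t ^ 2 - 2 * A * g t + A ^ 2 := fun t => by ring
    simp_rw [this]
    rw [intervalIntegral.integral_add, intervalIntegral.integral_sub,
      intervalIntegral.integral_const_mul, intervalIntegral.integral_const]
    · simp; ring
    all_goals exact Continuous.intervalIntegrable (by fun_prop) _ _
  rw [e] at h0
  have hS : (∫ t in a..b, g t) = A * (b - a) := by rw [hA]; field_simp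
  rw [hS] at h0 ⊢
  nlinarith

lemma sq_norm_integral_le {a b : ℝ} (hab : a ≤ b) {f : ℝ → ℂ} (hf : Continuous f) :
    ‖∫ t in a..b, f t‖ ^ 2 ≤ (b - a) * ∫ t in a..b, ‖f t‖ ^ 2 := by
  have h1 := intervalIntegral.norm_integral_le_integral_norm (f := f) (μ := volume) hab
  have h2 := sq_integral_le_mul_integral_sq hab hf.norm
  exact (pow_le_pow_left₀ (norm_nonneg _) h1 2).trans h2

lemma bessel_affine {a b : ℝ} (hab : a < b) {g : ℝ → ℝ} (hg : Continuous g) :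
    (∫ t in a..b, g t) ^ 2 + 3 * (∫ t in a..b, (2 * (t - a) / (b - a) - 1) * g t) ^ 2 ≤
      (b - a) * ∫ t in a..b, g t ^ 2 := by
  have hL : 0 < b - a := by linarith
  set P := ∫ t in a..b, (2 * (t - a) / (b - a) - 1) * g t with hP
  set A := (∫ t in a..b, g t) / (b - a) with hA
  set B := 3 * P / (b - a) with hB
  have h0 : 0 ≤ ∫ t in a..b, (g t - A - B * (2 * (t - a) / (b - a) - 1)) ^ 2 :=
    intervalIntegral.integral_nonneg hab.le fun t _ => sq_nonneg _
  have hlin : ∫ t in a..b, (2 * (t - a) / (b - a) - 1) = 0 := by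
    have : ∀ t, (2 * (t - a) / (b - a) - 1) = 2 / (b - a) * t - (2 * a / (b - a) + 1) := fun t => by
      field_simp; ring
    simp_rw [this]
    rw [intervalIntegral.integral_sub, intervalIntegral.integral_const_mul, integral_id,
      intervalIntegral.integral_const]
    · simp only [smul_eq_mul]; field_simp; ring
    all_goals exact Continuous.intervalIntegrable (by fun_prop) _ _
  have hquad : ∫ t in a..b, (2 * (t - a) / (b - a) - 1) ^ 2 = (b - a) / 3 := by
    have hd : ∀ t ∈ uIcc a b, HasDerivAt (fun t => (b - a) / 6 * (2 * (t - a) / (b - a) - 1) ^ 3)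
        ((2 * (t - a) / (b - a) - 1) ^ 2) t := by
      intro t _
      have h1 : HasDerivAt (fun t => 2 * (t - a) / (b - a) - 1) (2 / (b - a)) t := by
        have := ((((hasDerivAt_id t).sub_const a).const_mul 2).div_const (b - a)).sub_const 1
        simpa using this
      have := (h1.pow 3).const_mul ((b - a) / 6)
      refine this.congr_deriv ?_
      push_cast
      field_simp
      norm_num
    rw [intervalIntegral.integral_eq_sub_of_hasDerivAt hd (Continuous.intervalIntegrable (by fun_prop) _ _)]
    field_simp
    ring
  have e : ∫ t in a..b, (g t - A - B * (2 * (t - a) / (b - a) - 1)) ^ 2 =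
      (∫ t in a..b, g t ^ 2) - 2 * A * (∫ t in a..b, g t) - 2 * B * P + A ^ 2 * (b - a)
        + B ^ 2 * ((b - a) / 3) := by
    have : ∀ t, (g t - A - B * (2 * (t - a) / (b - a) - 1)) ^ 2 =
        g t ^ 2 - 2 * A * g t - 2 * B * ((2 * (t - a) / (b - a) - 1) * g t) + A ^ 2
        + (2 * A * B) * (2 * (t - a) / (b - a) - 1) + B ^ 2 * (2 * (t - a) / (b - a) - 1) ^ 2 :=
      fun t => by ring
    simp_rw [this]
    rw [intervalIntegral.integral_add, intervalIntegral.integral_add, intervalIntegral.integral_add,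
      intervalIntegral.integral_sub, intervalIntegral.integral_sub,
      intervalIntegral.integral_const_mul, intervalIntegral.integral_const_mul,
      intervalIntegral.integral_const_mul, intervalIntegral.integral_const_mul, hlin, hquad,
      intervalIntegral.integral_const]
    · simp only [smul_eq_mul]; ring
    all_goals exact Continuous.intervalIntegrable (by fun_prop) _ _
  rw [e] at h0
  have hS : (∫ t in a..b, g t) = A * (b - a) := by rw [hA]; field_simp
  have hP' : P = B * (b - a) / 3 := by rw [hB]; field_simp
  rw [hS] at h0 ⊢
  rw [hP'] at h0 ⊢
  nlinarith

/-- The constant of the two-endpoint trace inequality. -/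
def traceMu (z : ℝ) : ℝ := max (1 + z ^ 2 / 8) (3 * z ^ 2 / 8)

lemma traceMu_pos (z : ℝ) : 0 < traceMu z := lt_max_of_lt_left (by positivity)

lemma traceMu_le {z : ℝ} (hz : 0 ≤ z) : traceMu z ≤ 9 / 8 * max 1 z ^ 2 := by
  have h1 : 1 ≤ max 1 z ^ 2 := one_le_pow₀ (le_max_left _ _)
  have h2 : z ^ 2 ≤ max 1 z ^ 2 := pow_le_pow_left₀ hz (le_max_right _ _) 2
  exact max_le (by linarith) (by linarith)

lemma two_endpoint_trace_real {κ : ℝ} (hκ : 0 < κ) {a b : ℝ} (hab : a < b) {g g' : ℝ → ℝ}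
    (hg : ∀ t, HasDerivAt g (g' t) t) (hg' : Continuous g') :
    g a ^ 2 + g b ^ 2 ≤ 2 / (b - a) * traceMu (κ * (b - a)) *
      ((∫ t in a..b, g t ^ 2) + 2 / 3 * (κ ^ 2)⁻¹ * ∫ t in a..b, g' t ^ 2) := by
  have hL : 0 < b - a := by linarith
  have hgc : Continuous g := continuous_iff_continuousAt.2 fun t => (hg t).continuousAt
  have hB := bessel_affine hab hg'
  have hS := sq_integral_le_mul_integral_sq hab.le hgc
  have hD : ∫ t in a..b, g' t = g b - g a :=
    intervalIntegral.integral_eq_sub_of_hasDerivAt (fun t _ => hg t) (hg'.intervalIntegrable _ _)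
  have hP : ∫ t in a..b, (2 * (t - a) / (b - a) - 1) * g' t =
      g b + g a - 2 / (b - a) * ∫ t in a..b, g t := by
    have h1 : ∀ t ∈ uIcc a b, HasDerivAt (fun t => 2 * (t - a) / (b - a) - 1) (2 / (b - a)) t := by
      intro t _
      have := ((((hasDerivAt_id t).sub_const a).const_mul 2).div_const (b - a)).sub_const 1
      simpa using this
    rw [intervalIntegral.integral_mul_deriv_eq_deriv_mul h1 (fun t _ => hg t)
      (by simp) (hg'.intervalIntegrable _ _), intervalIntegral.integral_const_mul]
    field_simp
    ring
  rw [hP, hD] at hB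
  set S := ∫ t in a..b, g t
  set A := ∫ t in a..b, g t ^ 2
  set B := ∫ t in a..b, g' t ^ 2
  set L := b - a
  have hm1 : 1 + (κ * L) ^ 2 / 8 ≤ traceMu (κ * L) := le_max_left _ _
  have hm2 : 3 * (κ * L) ^ 2 / 8 ≤ traceMu (κ * L) := le_max_right _ _
  set μ := traceMu (κ * L)
  set P := g b + g a - 2 / L * S with hPd
  have hsum : g b + g a = 2 / L * S + P := by rw [hPd]; ring
  have e1 : (2 / L * S + P) ^ 2 ≤ (4 / L + κ ^ 2 * L / 2) * (S ^ 2 / L + 2 / (κ ^ 2 * L) * P ^ 2) := by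
    have : (4 / L + κ ^ 2 * L / 2) * (S ^ 2 / L + 2 / (κ ^ 2 * L) * P ^ 2) - (2 / L * S + P) ^ 2 =
      (κ / 2 * S * (2 / 2) * Real.sqrt 2 - 2 * Real.sqrt 2 / (κ * L) * P) ^ 2 := by
      have h2 : Real.sqrt 2 ^ 2 = 2 := Real.sq_sqrt (by norm_num)
      have : (κ / 2 * S * (2 / 2) * Real.sqrt 2 - 2 * Real.sqrt 2 / (κ * L) * P) ^ 2 =
        Real.sqrt 2 ^ 2 * (κ / 2 * S - 2 / (κ * L) * P) ^ 2 := by ring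
      rw [this, h2]
      field_simp
      ring
    nlinarith [sq_nonneg (κ / 2 * S * (2 / 2) * Real.sqrt 2 - 2 * Real.sqrt 2 / (κ * L) * P)]
  have e2 : 4 / L + κ ^ 2 * L / 2 ≤ 4 / L * μ := by
    have : 4 / L + κ ^ 2 * L / 2 = 4 / L * (1 + (κ * L) ^ 2 / 8) := by field_simp; ring
    rw [this]; gcongr
  have e3 : 3 / 2 * κ ^ 2 * L ≤ 4 / L * μ := by
    have : 3 / 2 * κ ^ 2 * L = 4 / L * (3 * (κ * L) ^ 2 / 8) := by field_simp; ring
    rw [this]; gcongr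
  have e4 : S ^ 2 / L ≤ A := by rw [div_le_iff₀ hL]; linarith
  have e5 : 2 / 3 * (κ ^ 2)⁻¹ * ((g b - g a) ^ 2 / L + 3 * P ^ 2 / L) ≤ 2 / 3 * (κ ^ 2)⁻¹ * B := by
    gcongr
    rw [← add_div, div_le_iff₀ hL]; linarith
  have e6 : g a ^ 2 + g b ^ 2 = 1 / 2 * ((2 / L * S + P) ^ 2 + (g b - g a) ^ 2) := by
    rw [← hsum]; ring
  have e7 : (g b - g a) ^ 2 = 3 / 2 * κ ^ 2 * L * (2 / 3 * (κ ^ 2)⁻¹ * ((g b - g a) ^ 2 / L)) := by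
    field_simp
  have e8 : (2 / L * S + P) ^ 2 ≤ 4 / L * μ * (S ^ 2 / L + 2 / (κ ^ 2 * L) * P ^ 2) :=
    e1.trans (by gcongr)
  have e9 : (g b - g a) ^ 2 ≤ 4 / L * μ * (2 / 3 * (κ ^ 2)⁻¹ * ((g b - g a) ^ 2 / L)) := by
    conv_lhs => rw [e7]
    gcongr
  have hμ : 0 ≤ 4 / L * μ := le_trans (by positivity) e3
  have e10 : S ^ 2 / L + 2 / (κ ^ 2 * L) * P ^ 2 + 2 / 3 * (κ ^ 2)⁻¹ * ((g b - g a) ^ 2 / L) ≤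
      A + 2 / 3 * (κ ^ 2)⁻¹ * B := by
    have : 2 / (κ ^ 2 * L) * P ^ 2 = 2 / 3 * (κ ^ 2)⁻¹ * (3 * P ^ 2 / L) := by field_simp
    rw [this]; linarith
  have e11 := mul_le_mul_of_nonneg_left e10 hμ
  rw [e6]
  calc _ ≤ 1 / 2 * (4 / L * μ * (A + 2 / 3 * (κ ^ 2)⁻¹ * B)) := by nlinarith
    _ = _ := by ring

lemma integral_norm_sq_eq {a b : ℝ} {f : ℝ → ℂ} (hf : Continuous f) :
    ∫ t in a..b, ‖f t‖ ^ 2 = (∫ t in a..b, (f t).re ^ 2) + ∫ t in a..b, (f t).im ^ 2 := by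
  rw [← intervalIntegral.integral_add]
  · refine intervalIntegral.integral_congr fun t _ => ?_
    simp only [Complex.sq_norm, Complex.normSq_apply]; ring
  all_goals exact Continuous.intervalIntegrable (by fun_prop) _ _

lemma two_endpoint_trace {κ : ℝ} (hκ : 0 < κ) {a b : ℝ} (hab : a < b) {f f' : ℝ → ℂ}
    (hf : ∀ t, HasDerivAt f (f' t) t) (hf' : Continuous f') :
    ‖f a‖ ^ 2 + ‖f b‖ ^ 2 ≤ 2 / (b - a) * traceMu (κ * (b - a)) *
      ((∫ t in a..b, ‖f t‖ ^ 2) + 2 / 3 * (κ ^ 2)⁻¹ * ∫ t in a..b, ‖f' t‖ ^ 2) := by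
  have hfc : Continuous f := continuous_iff_continuousAt.2 fun t => (hf t).continuousAt
  have hre := two_endpoint_trace_real hκ hab (g := fun t => (f t).re) (g' := fun t => (f' t).re)
    (fun t => Complex.reCLM.hasFDerivAt.comp_hasDerivAt t (hf t))
    (Complex.continuous_re.comp hf')
  have him := two_endpoint_trace_real hκ hab (g := fun t => (f t).im) (g' := fun t => (f' t).im)
    (fun t => Complex.imCLM.hasFDerivAt.comp_hasDerivAt t (hf t))
    (Complex.continuous_im.comp hf')
  rw [integral_norm_sq_eq hfc, integral_norm_sq_eq hf']
  simp only [Complex.sq_norm, Complex.normSq_apply]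
  nlinarith

lemma poincare_left {l : ℝ} (hl : 0 ≤ l) {f f' : ℝ → ℂ} (hf : ∀ t, HasDerivAt f (f' t) t)
    (hf' : Continuous f') (h0 : f 0 = 0) :
    ∫ t in (0 : ℝ)..l, ‖f t‖ ^ 2 ≤ l ^ 2 / 2 * ∫ t in (0 : ℝ)..l, ‖f' t‖ ^ 2 := by
  have hfc : Continuous f := continuous_iff_continuousAt.2 fun t => (hf t).continuousAt
  set B := ∫ t in (0 : ℝ)..l, ‖f' t‖ ^ 2
  have hpt : ∀ t ∈ Icc 0 l, ‖f t‖ ^ 2 ≤ t * B := by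
    intro t ht
    have e : f t = ∫ s in (0 : ℝ)..t, f' s := by
      rw [intervalIntegral.integral_eq_sub_of_hasDerivAt (fun s _ => hf s) (hf'.intervalIntegrable _ _),
        h0, sub_zero]
    rw [e]
    refine (sq_norm_integral_le ht.1 hf').trans ?_
    rw [sub_zero]
    refine mul_le_mul_of_nonneg_left ?_ ht.1
    refine intervalIntegral.integral_mono_interval le_rfl ht.1 ht.2 ?_ ?_
    · exact Filter.Eventually.of_forall fun s => by positivity
    · exact Continuous.intervalIntegrable (by fun_prop) _ _
  calc _ ≤ ∫ t in (0 : ℝ)..l, t * B := by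
        refine intervalIntegral.integral_mono_on hl ?_ ?_ hpt
        all_goals exact Continuous.intervalIntegrable (by fun_prop) _ _
    _ = _ := by rw [intervalIntegral.integral_mul_const, integral_id]; ring

lemma integral_eq_integral_half {a b : ℝ} {F : ℝ → ℝ} (hF : Continuous F) :
    ∫ t in a..b, F t = ∫ t in (0 : ℝ)..((b - a) / 2), (F (a + t) + F (b - t)) := by
  rw [intervalIntegral.integral_add, intervalIntegral.integral_comp_add_left,
    intervalIntegral.integral_comp_sub_left,
    ← intervalIntegral.integral_add_adjacent_intervals (b := (a + b) / 2)]
  · congr 2 <;> ring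
  all_goals exact Continuous.intervalIntegrable (by fun_prop) _ _

lemma norm_sq_parallelogram (z w : ℂ) :
    ‖z + w‖ ^ 2 + ‖w - z‖ ^ 2 = 2 * (‖z‖ ^ 2 + ‖w‖ ^ 2) := by
  simp only [Complex.sq_norm, Complex.normSq_apply, Complex.add_re, Complex.add_im,
    Complex.sub_re, Complex.sub_im]
  ring

lemma poincare_midpoint {a b : ℝ} (hab : a ≤ b) {f f' : ℝ → ℂ}
    (hf : ∀ t, HasDerivAt f (f' t) t) (hf' : Continuous f') :
    ∫ t in a..b, ‖f t - (f a + f b) / 2‖ ^ 2 ≤ (b - a) ^ 2 / 8 * ∫ t in a..b, ‖f' t‖ ^ 2 := by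
  have hfc : Continuous f := continuous_iff_continuousAt.2 fun t => (hf t).continuousAt
  set m := (f a + f b) / 2 with hm
  set l := (b - a) / 2 with hl
  have hl0 : 0 ≤ l := by rw [hl]; linarith
  have hE := poincare_left hl0 (f := fun t => (f (a + t) - m) + (f (b - t) - m))
    (f' := fun t => f' (a + t) - f' (b - t))
    (fun t => by
      have h1 := ((hf (a + t)).comp_const_add a t).sub_const m
      have h2 := ((hf (b - t)).comp_const_sub b t).sub_const m
      exact (h1.add h2).congr_deriv (sub_eq_add_neg _ _).symm)
    (by fun_prop) (by simp [hm]; ring)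
  have hO := poincare_left hl0
    (f := fun t => (f ((a + b) / 2 + t) - m) - (f ((a + b) / 2 - t) - m))
    (f' := fun t => f' ((a + b) / 2 + t) + f' ((a + b) / 2 - t))
    (fun t => by
      have h1 := ((hf ((a + b) / 2 + t)).comp_const_add _ t).sub_const m
      have h2 := ((hf ((a + b) / 2 - t)).comp_const_sub _ t).sub_const m
      exact (h1.sub h2).congr_deriv (sub_neg_eq_add _ _))
    (by fun_prop) (by simp)
  have r1 : ∫ t in (0 : ℝ)..l, ‖(f ((a + b) / 2 + t) - m) - (f ((a + b) / 2 - t) - m)‖ ^ 2 =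
      ∫ t in (0 : ℝ)..l, ‖(f (b - t) - m) - (f (a + t) - m)‖ ^ 2 := by
    have := intervalIntegral.integral_comp_sub_left (a := 0) (b := l)
      (fun t => ‖(f ((a + b) / 2 + t) - m) - (f ((a + b) / 2 - t) - m)‖ ^ 2) l
    rw [sub_self, sub_zero] at this
    rw [← this]
    refine intervalIntegral.integral_congr fun t _ => ?_
    have e1 : (a + b) / 2 + (l - t) = b - t := by rw [hl]; ring
    have e2 : (a + b) / 2 - (l - t) = a + t := by rw [hl]; ring
    simp only [e1, e2]
  have r2 : ∫ t in (0 : ℝ)..l, ‖f' ((a + b) / 2 + t) + f' ((a + b) / 2 - t)‖ ^ 2 =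
      ∫ t in (0 : ℝ)..l, ‖f' (a + t) + f' (b - t)‖ ^ 2 := by
    have := intervalIntegral.integral_comp_sub_left (a := 0) (b := l)
      (fun t => ‖f' ((a + b) / 2 + t) + f' ((a + b) / 2 - t)‖ ^ 2) l
    rw [sub_self, sub_zero] at this
    rw [← this]
    refine intervalIntegral.integral_congr fun t _ => ?_
    have e1 : (a + b) / 2 + (l - t) = b - t := by rw [hl]; ring
    have e2 : (a + b) / 2 - (l - t) = a + t := by rw [hl]; ring
    simp only [e1, e2]; rw [add_comm (f' (b - t))]
  rw [r1, r2] at hO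
  have s1 : (∫ t in (0 : ℝ)..l, ‖(f (a + t) - m) + (f (b - t) - m)‖ ^ 2) +
      ∫ t in (0 : ℝ)..l, ‖(f (b - t) - m) - (f (a + t) - m)‖ ^ 2 =
      2 * ∫ t in a..b, ‖f t - m‖ ^ 2 := by
    rw [integral_eq_integral_half (F := fun t => ‖f t - m‖ ^ 2) (by fun_prop),
      ← intervalIntegral.integral_add, ← intervalIntegral.integral_const_mul]
    · exact intervalIntegral.integral_congr fun t _ => norm_sq_parallelogram _ _
    all_goals exact Continuous.intervalIntegrable (by fun_prop) _ _
  have s2 : (∫ t in (0 : ℝ)..l, ‖f' (a + t) - f' (b - t)‖ ^ 2) +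
      ∫ t in (0 : ℝ)..l, ‖f' (a + t) + f' (b - t)‖ ^ 2 =
      2 * ∫ t in a..b, ‖f' t‖ ^ 2 := by
    rw [integral_eq_integral_half (F := fun t => ‖f' t‖ ^ 2) (by fun_prop),
      ← intervalIntegral.integral_add, ← intervalIntegral.integral_const_mul]
    · refine intervalIntegral.integral_congr fun t _ => ?_
      have := norm_sq_parallelogram (f' (b - t)) (f' (a + t))
      rw [add_comm (f' (a + t)) (f' (b - t))]
      linarith
    all_goals exact Continuous.intervalIntegrable (by fun_prop) _ _
  have hl2 : (b - a) ^ 2 / 8 = l ^ 2 / 2 := by rw [hl]; ring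
  rw [hl2]
  nlinarith

lemma poincare_interp {a b : ℝ} (hab : a < b) {f f' : ℝ → ℂ}
    (hf : ∀ t, HasDerivAt f (f' t) t) (hf' : Continuous f') :
    ∫ t in a..b, ‖f t - (f a + ((t - a) / (b - a) : ℝ) * (f b - f a))‖ ^ 2 ≤
      (b - a) ^ 2 / 8 * ∫ t in a..b, ‖f' t‖ ^ 2 := by
  have hL : 0 < b - a := by linarith
  set D := (f b - f a) / ((b - a : ℝ) : ℂ) with hD
  have hLc : ((b - a : ℝ) : ℂ) ≠ 0 := by exact_mod_cast hL.ne'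
  have hg : ∀ t, HasDerivAt (fun t => f t - (f a + ((t - a) / (b - a) : ℝ) * (f b - f a)))
      (f' t - D) t := by
    intro t
    have h1 : HasDerivAt (fun t : ℝ => (((t - a) / (b - a) : ℝ) : ℂ)) ((1 / (b - a) : ℝ) : ℂ) t :=
      (((hasDerivAt_id t).sub_const a).div_const (b - a)).ofReal_comp
    refine ((hf t).sub ((h1.mul_const (f b - f a)).const_add (f a))).congr_deriv ?_
    rw [hD]; push_cast; ring
  have h := poincare_midpoint hab.le hg (by fun_prop)
  have ea : f a - (f a + ((a - a) / (b - a) : ℝ) * (f b - f a)) = 0 := by simp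
  have eb : f b - (f a + ((b - a) / (b - a) : ℝ) * (f b - f a)) = 0 := by
    rw [div_self hL.ne']; push_cast; ring
  simp only [ea, eb, add_zero, zero_div, sub_zero] at h
  refine h.trans (mul_le_mul_of_nonneg_left ?_ (by positivity))
  have h_int : ∫ t in a..b, f' t = ((b - a : ℝ) : ℂ) * D := by
    rw [intervalIntegral.integral_eq_sub_of_hasDerivAt (fun t _ => hf t)
      (hf'.intervalIntegrable _ _), hD]
    field_simp
  have hre : ∫ t in a..b, (f' t).re = (b - a) * D.re := by
    have := intervalIntegral.intervalIntegral_re (μ := volume) (hf'.intervalIntegrable a b)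
    simp only [RCLike.re_to_complex] at this
    rw [this, h_int, Complex.re_ofReal_mul]
  have him : ∫ t in a..b, (f' t).im = (b - a) * D.im := by
    have := intervalIntegral.intervalIntegral_im (μ := volume) (hf'.intervalIntegrable a b)
    simp only [RCLike.im_to_complex] at this
    rw [this, h_int, Complex.im_ofReal_mul]
  have e : ∀ t, ‖f' t - D‖ ^ 2 = ‖f' t‖ ^ 2 - 2 * D.re * (f' t).re - 2 * D.im * (f' t).im
      + (D.re ^ 2 + D.im ^ 2) := fun t => by
    simp only [Complex.sq_norm, Complex.normSq_apply, Complex.sub_re, Complex.sub_im]; ring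
  simp_rw [e]
  rw [intervalIntegral.integral_add, intervalIntegral.integral_sub, intervalIntegral.integral_sub,
    intervalIntegral.integral_const_mul, intervalIntegral.integral_const_mul, hre, him,
    intervalIntegral.integral_const]
  · simp only [smul_eq_mul]
    nlinarith [mul_nonneg hL.le (sq_nonneg D.re), mul_nonneg hL.le (sq_nonneg D.im)]
  all_goals exact Continuous.intervalIntegrable (by fun_prop) _ _

/-- The squared `L²` norm over an open rectangle. -/
def rectSq (a b c d : ℝ) (F : ℝ × ℝ → ℂ) : ℝ := ∫ x in Ioo a b ×ˢ Ioo c d, ‖F x‖ ^ 2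

lemma rectSq_nonneg (a b c d : ℝ) (F : ℝ × ℝ → ℂ) : 0 ≤ rectSq a b c d F :=
  integral_nonneg fun _ => by positivity

lemma integrableOn_rect {a b c d : ℝ} {g : ℝ × ℝ → ℝ} (hg : Continuous g) :
    IntegrableOn g (Ioo a b ×ˢ Ioo c d) :=
  (hg.continuousOn.integrableOn_compact (isCompact_Icc.prod isCompact_Icc)).mono_set
    (prod_mono Ioo_subset_Icc_self Ioo_subset_Icc_self)

lemma rectSq_eq_iterated {a b c d : ℝ} (hab : a ≤ b) (hcd : c ≤ d) {F : ℝ × ℝ → ℂ}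
    (hF : Continuous F) :
    rectSq a b c d F = ∫ t in a..b, ∫ s in c..d, ‖F (t, s)‖ ^ 2 := by
  have hi := integrableOn_rect (a := a) (b := b) (c := c) (d := d) (g := fun x => ‖F x‖ ^ 2)
    (by fun_prop)
  rw [rectSq, Measure.volume_eq_prod, setIntegral_prod _ hi]
  simp_rw [intervalIntegral.integral_of_le hab, intervalIntegral.integral_of_le hcd,
    integral_Ioc_eq_integral_Ioo]

lemma rectSq_swap {a b c d : ℝ} {F : ℝ × ℝ → ℂ} :
    rectSq a b c d F = rectSq c d a b (fun x => F x.swap) := by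
  have := setIntegral_prod_swap (μ := (volume : Measure ℝ)) (ν := (volume : Measure ℝ))
    (Ioo a b) (Ioo c d) (fun x => ‖F x‖ ^ 2)
  rw [rectSq, rectSq, Measure.volume_eq_prod, ← this]

/-- Traces on the two vertical sides of a rectangle. -/
lemma side_trace_le {κ : ℝ} (hκ : 0 < κ) {a b c d : ℝ} (hab : a < b) (hcd : c < d)
    {v v1 : ℝ × ℝ → ℂ} (hv : Continuous v) (hv1 : Continuous v1)
    (h1 : ∀ t s, HasDerivAt (fun t => v (t, s)) (v1 (t, s)) t) :
    (∫ s in c..d, ‖v (a, s)‖ ^ 2) + ∫ s in c..d, ‖v (b, s)‖ ^ 2 ≤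
      2 / (b - a) * traceMu (κ * (b - a)) *
        (rectSq a b c d v + 2 / 3 * (κ ^ 2)⁻¹ * rectSq a b c d v1) := by
  have hg : ∀ F : ℝ × ℝ → ℂ, Continuous F → Continuous fun s => ∫ t in a..b, ‖F (t, s)‖ ^ 2 :=
    fun F hF => intervalIntegral.continuous_parametric_intervalIntegral_of_continuous'
      (f := fun s t => ‖F (t, s)‖ ^ 2) (by simp only [Function.uncurry_def]; fun_prop) _ _
  have e : ∀ F : ℝ × ℝ → ℂ, Continuous F →
      rectSq a b c d F = ∫ s in c..d, ∫ t in a..b, ‖F (t, s)‖ ^ 2 := fun F hF => by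
    rw [rectSq_swap, rectSq_eq_iterated hcd.le hab.le (by fun_prop)]; rfl
  have hgv := hg v hv
  have hgv1 := hg v1 hv1
  rw [e v hv, e v1 hv1, ← intervalIntegral.integral_add, ← intervalIntegral.integral_const_mul,
    ← intervalIntegral.integral_add, ← intervalIntegral.integral_const_mul]
  · refine intervalIntegral.integral_mono_on hcd.le ?_ ?_ fun s _ =>
      two_endpoint_trace hκ hab (fun t => h1 t s) (by fun_prop)
    all_goals exact Continuous.intervalIntegrable (by fun_prop) _ _
  all_goals exact Continuous.intervalIntegrable (by fun_prop) _ _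

/-- Traces on the two horizontal sides of a rectangle. -/
lemma row_trace_le {κ : ℝ} (hκ : 0 < κ) {a b c d : ℝ} (hab : a < b) (hcd : c < d)
    {v v2 : ℝ × ℝ → ℂ} (hv : Continuous v) (hv2 : Continuous v2)
    (h2 : ∀ t s, HasDerivAt (fun s => v (t, s)) (v2 (t, s)) s) :
    (∫ t in a..b, ‖v (t, c)‖ ^ 2) + ∫ t in a..b, ‖v (t, d)‖ ^ 2 ≤
      2 / (d - c) * traceMu (κ * (d - c)) *
        (rectSq a b c d v + 2 / 3 * (κ ^ 2)⁻¹ * rectSq a b c d v2) := by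
  rw [rectSq_swap, rectSq_swap (F := v2)]
  exact side_trace_le hκ hcd hab (v := fun x => v x.swap) (v1 := fun x => v2 x.swap)
    (by fun_prop) (by fun_prop) fun t s => h2 s t

/-- Corner values of a function on a rectangle. -/
lemma corner_trace_le {κ : ℝ} (hκ : 0 < κ) {a b c d : ℝ} (hab : a < b) (hcd : c < d)
    {v v1 v2 v12 : ℝ × ℝ → ℂ} (hv : Continuous v) (hv1 : Continuous v1) (hv2 : Continuous v2)
    (hv12 : Continuous v12)
    (h1 : ∀ t s, HasDerivAt (fun t => v (t, s)) (v1 (t, s)) t)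
    (h2 : ∀ t s, HasDerivAt (fun s => v (t, s)) (v2 (t, s)) s)
    (h12 : ∀ t s, HasDerivAt (fun s => v1 (t, s)) (v12 (t, s)) s) :
    ‖v (a, c)‖ ^ 2 + ‖v (b, c)‖ ^ 2 + (‖v (a, d)‖ ^ 2 + ‖v (b, d)‖ ^ 2) ≤
      4 / ((b - a) * (d - c)) * traceMu (κ * (b - a)) * traceMu (κ * (d - c)) *
        (rectSq a b c d v + 2 / 3 * (κ ^ 2)⁻¹ * rectSq a b c d v1 +
          2 / 3 * (κ ^ 2)⁻¹ * rectSq a b c d v2 + 4 / 9 * (κ ^ 4)⁻¹ * rectSq a b c d v12) := by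
  have hba : 0 < b - a := by linarith
  have hdc : 0 < d - c := by linarith
  have hc := two_endpoint_trace hκ hab (fun t => h1 t c) (by fun_prop)
  have hd := two_endpoint_trace hκ hab (fun t => h1 t d) (by fun_prop)
  have r0 := row_trace_le hκ hab hcd hv hv2 h2
  have r1 := row_trace_le hκ hab hcd hv1 hv12 h12
  have hm := (traceMu_pos (κ * (b - a))).le
  have hk : 0 ≤ 2 / 3 * (κ ^ 2)⁻¹ := by positivity
  refine (add_le_add hc hd).trans ?_
  rw [← mul_add]
  have hq : 0 ≤ 2 / (b - a) * traceMu (κ * (b - a)) := by positivity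
  have e : 4 / ((b - a) * (d - c)) * traceMu (κ * (b - a)) * traceMu (κ * (d - c)) *
        (rectSq a b c d v + 2 / 3 * (κ ^ 2)⁻¹ * rectSq a b c d v1 +
          2 / 3 * (κ ^ 2)⁻¹ * rectSq a b c d v2 + 4 / 9 * (κ ^ 4)⁻¹ * rectSq a b c d v12) =
      2 / (b - a) * traceMu (κ * (b - a)) * (
        2 / (d - c) * traceMu (κ * (d - c)) *
        (rectSq a b c d v + 2 / 3 * (κ ^ 2)⁻¹ * rectSq a b c d v2) + 2 / 3 * (κ ^ 2)⁻¹ * (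
          2 / (d - c) * traceMu (κ * (d - c)) *
        (rectSq a b c d v1 + 2 / 3 * (κ ^ 2)⁻¹ * rectSq a b c d v12))) := by
    field_simp
    ring
  rw [e]
  refine mul_le_mul_of_nonneg_left ?_ hq
  have := mul_le_mul_of_nonneg_left r1 hk
  linarith

/-! ### Calculus of the mixed partial derivatives -/

lemma pd1_eq_fderiv {f : ℝ × ℝ → ℂ} (hf : Differentiable ℝ f) :
    pd1 f = fun x => fderiv ℝ f x (1, 0) := by
  funext x
  have h : HasDerivAt (fun t : ℝ => (t, x.2)) (1, 0) x.1 :=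
    (hasDerivAt_id _).prodMk (hasDerivAt_const _ _)
  exact ((hf (x.1, x.2)).hasFDerivAt.comp_hasDerivAt x.1 h).deriv

lemma pd2_eq_fderiv {f : ℝ × ℝ → ℂ} (hf : Differentiable ℝ f) :
    pd2 f = fun x => fderiv ℝ f x (0, 1) := by
  funext x
  have h : HasDerivAt (fun t : ℝ => (x.1, t)) (0, 1) x.2 :=
    (hasDerivAt_const _ _).prodMk (hasDerivAt_id _)
  exact ((hf (x.1, x.2)).hasFDerivAt.comp_hasDerivAt x.2 h).deriv

lemma hasDerivAt_pd1 {f : ℝ × ℝ → ℂ} (hf : Differentiable ℝ f) (t s : ℝ) :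
    HasDerivAt (fun t => f (t, s)) (pd1 f (t, s)) t := by
  have h : DifferentiableAt ℝ (fun t => f (t, s)) t := by fun_prop
  exact h.hasDerivAt

lemma hasDerivAt_pd2 {f : ℝ × ℝ → ℂ} (hf : Differentiable ℝ f) (t s : ℝ) :
    HasDerivAt (fun s => f (t, s)) (pd2 f (t, s)) s := by
  have h : DifferentiableAt ℝ (fun s => f (t, s)) s := by fun_prop
  exact h.hasDerivAt

lemma contDiff_pd1 {f : ℝ × ℝ → ℂ} {n : ℕ} (hf : ContDiff ℝ (n + 1 : ℕ) f) :
    ContDiff ℝ n (pd1 f) := by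
  rw [pd1_eq_fderiv (hf.differentiable (by simp))]
  exact (hf.fderiv_right (m := n) (by norm_cast)).clm_apply contDiff_const

lemma contDiff_pd2 {f : ℝ × ℝ → ℂ} {n : ℕ} (hf : ContDiff ℝ (n + 1 : ℕ) f) :
    ContDiff ℝ n (pd2 f) := by
  rw [pd2_eq_fderiv (hf.differentiable (by simp))]
  exact (hf.fderiv_right (m := n) (by norm_cast)).clm_apply contDiff_const

lemma pd1_pd2_comm {f : ℝ × ℝ → ℂ} (hf : ContDiff ℝ 2 f) : pd2 (pd1 f) = pd1 (pd2 f) := by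
  have hd : Differentiable ℝ f := hf.differentiable (by simp)
  have hdd : Differentiable ℝ (fderiv ℝ f) :=
    (hf.fderiv_right (m := 1) (by norm_num)).differentiable (by simp)
  rw [pd1_eq_fderiv hd, pd2_eq_fderiv hd, pd1_eq_fderiv (by fun_prop), pd2_eq_fderiv (by fun_prop)]
  funext x
  rw [fderiv_clm_apply (hdd x) (differentiableAt_const _),
    fderiv_clm_apply (hdd x) (differentiableAt_const _)]
  simpa using (hf.contDiffAt.isSymmSndFDerivAt (by simp)).eq (0, 1) (1, 0)

lemma pdM_succ (i j : ℕ) (f : ℝ × ℝ → ℂ) : pdM (i + 1) j f = pd1 (pdM i j f) :=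
  Function.iterate_succ_apply' _ _ _

lemma pdM_zero_zero (f : ℝ × ℝ → ℂ) : pdM 0 0 f = f := rfl

lemma pdM_zero_one (f : ℝ × ℝ → ℂ) : pdM 0 1 f = pd2 f := rfl

lemma contDiff_pdM_zero {f : ℝ × ℝ → ℂ} (i : ℕ) {n : ℕ} (hf : ContDiff ℝ (n + i : ℕ) f) :
    ContDiff ℝ n (pdM i 0 f) := by
  induction i generalizing n with
  | zero => exact hf
  | succ i ih =>
    rw [pdM_succ]
    exact contDiff_pd1 (ih (by rwa [show n + 1 + i = n + (i + 1) by ring]))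

lemma pd2_pdM_zero {f : ℝ × ℝ → ℂ} (i : ℕ) (hf : ContDiff ℝ (i + 1 : ℕ) f) :
    pd2 (pdM i 0 f) = pdM i 1 f := by
  induction i with
  | zero => rfl
  | succ i ih =>
    have h2 : ContDiff ℝ (2 : ℕ) (pdM i 0 f) :=
      contDiff_pdM_zero i (by rwa [show 2 + i = i + 1 + 1 by ring])
    rw [pdM_succ, pdM_succ, ← ih (hf.of_le (by norm_cast; omega)), pd1_pd2_comm h2]

lemma continuous_pdM_zero {f : ℝ × ℝ → ℂ} {i : ℕ} (hf : ContDiff ℝ (i : ℕ) f) :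
    Continuous (pdM i 0 f) :=
  (contDiff_pdM_zero (n := 0) i (by simpa using hf)).continuous

lemma continuous_pdM_one {f : ℝ × ℝ → ℂ} {i : ℕ} (hf : ContDiff ℝ (i + 1 : ℕ) f) :
    Continuous (pdM i 1 f) := by
  rw [← pd2_pdM_zero i hf]
  exact (contDiff_pd2 (n := 0) (contDiff_pdM_zero i (by rwa [show 0 + 1 + i = i + 1 by ring]))).continuous

lemma hasDerivAt_pdM_fst {f : ℝ × ℝ → ℂ} {i : ℕ} (hf : ContDiff ℝ (i + 1 : ℕ) f) (t s : ℝ) :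
    HasDerivAt (fun t => pdM i 0 f (t, s)) (pdM (i + 1) 0 f (t, s)) t := by
  rw [pdM_succ]
  exact hasDerivAt_pd1 ((contDiff_pdM_zero (n := 1) i
    (by rwa [add_comm] at hf)).differentiable (by simp)) t s

lemma hasDerivAt_pdM_snd {f : ℝ × ℝ → ℂ} {i : ℕ} (hf : ContDiff ℝ (i + 1 : ℕ) f) (t s : ℝ) :
    HasDerivAt (fun s => pdM i 0 f (t, s)) (pdM i 1 f (t, s)) s := by
  rw [← pd2_pdM_zero i hf]
  exact hasDerivAt_pd2 ((contDiff_pdM_zero (n := 1) i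
    (by rwa [add_comm] at hf)).differentiable (by simp)) t s

/-- The squared `L²` norm over a mesh cell of a mixed derivative, weighted by powers of `κ`. -/
def cellTerm (κ h1 h2 : ℝ) (u : ℝ × ℝ → ℂ) (c : ℤ × ℤ) (i j : ℕ) : ℝ :=
  (κ ^ (2 * (i + j)))⁻¹ * rectSq (c.1 * h1) ((c.1 + 1) * h1) (c.2 * h2) ((c.2 + 1) * h2) (pdM i j u)

lemma cellTerm_nonneg {κ : ℝ} (hκ : 0 < κ) (h1 h2 : ℝ) (u : ℝ × ℝ → ℂ) (c : ℤ × ℤ) (i j : ℕ) :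
    0 ≤ cellTerm κ h1 h2 u c i j :=
  mul_nonneg (by positivity) (rectSq_nonneg _ _ _ _ _)

lemma eq_of_mem_Ioo_mul {h x : ℝ} (hh : 0 < h) {m n : ℤ} (hm : x ∈ Ioo (m * h) ((m + 1) * h))
    (hn : x ∈ Ioo (n * h) ((n + 1) * h)) : m = n := by
  have h1 : (m : ℝ) < n + 1 := lt_of_mul_lt_mul_right (hm.1.trans hn.2) hh.le
  have h2 : (n : ℝ) < m + 1 := lt_of_mul_lt_mul_right (hn.1.trans hm.2) hh.le
  have h1' : m < n + 1 := by exact_mod_cast h1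
  have h2' : n < m + 1 := by exact_mod_cast h2
  omega

lemma cellO_disjoint {h1 h2 : ℝ} (hh1 : 0 < h1) (hh2 : 0 < h2) {c c' : ℤ × ℤ} (hne : c ≠ c') :
    Disjoint (cellO h1 h2 c) (cellO h1 h2 c') := by
  refine Set.disjoint_left.2 fun x hx hx' => hne ?_
  exact Prod.ext (eq_of_mem_Ioo_mul hh1 hx.1 hx'.1) (eq_of_mem_Ioo_mul hh2 hx.2 hx'.2)

lemma cellO_subset {h1 h2 : ℝ} {cells : Finset (ℤ × ℤ)} {Ω : Set (ℝ × ℝ)}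
    (hT : IsTessellation h1 h2 cells Ω) {c : ℤ × ℤ} (hc : c ∈ cells) : cellO h1 h2 c ⊆ Ω := by
  rw [hT.2.1]
  refine interior_maximal ?_ (isOpen_Ioo.prod isOpen_Ioo)
  exact (prod_mono Ioo_subset_Icc_self Ioo_subset_Icc_self).trans
    (Set.subset_biUnion_of_mem (u := fun c => cellC h1 h2 c) (Finset.mem_coe.2 hc))

lemma sum_cell_integral_le {h1 h2 : ℝ} (hh1 : 0 < h1) (hh2 : 0 < h2) {cells : Finset (ℤ × ℤ)}
    {Ω : Set (ℝ × ℝ)} (hT : IsTessellation h1 h2 cells Ω) {F : ℝ × ℝ → ℂ}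
    (hF : IntegrableOn (fun x => ‖F x‖ ^ 2) Ω) :
    ∑ c ∈ cells, rectSq (c.1 * h1) ((c.1 + 1) * h1) (c.2 * h2) ((c.2 + 1) * h2) F ≤
      ∫ x in Ω, ‖F x‖ ^ 2 := by
  have hsub : (⋃ c ∈ cells, cellO h1 h2 c) ⊆ Ω := iUnion₂_subset fun c hc => cellO_subset hT hc
  have e := integral_biUnion_finset (μ := volume) (f := fun x => ‖F x‖ ^ 2) cells
    (s := cellO h1 h2) (fun c _ => (isOpen_Ioo.prod isOpen_Ioo).measurableSet)
    (fun c _ c' _ hne => cellO_disjoint hh1 hh2 hne)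
    (fun c hc => hF.mono_set (cellO_subset hT hc))
  calc _ = ∫ x in ⋃ c ∈ cells, cellO h1 h2 c, ‖F x‖ ^ 2 := e.symm
    _ ≤ _ := setIntegral_mono_set hF (Filter.Eventually.of_forall fun _ => by positivity)
      hsub.eventuallyLE

lemma sum_cellTerm_le {κ h1 h2 : ℝ} (hκ : 0 < κ) (hh1 : 0 < h1) (hh2 : 0 < h2)
    {cells : Finset (ℤ × ℤ)} {Ω : Set (ℝ × ℝ)} (hT : IsTessellation h1 h2 cells Ω)
    {u : ℝ × ℝ → ℂ} {K L n : ℕ} (hmem : MemSob L Ω u) (hKL : K ≤ L) (hn : n ≤ K) :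
    ∑ c ∈ cells, ∑ i ∈ Finset.range n, (cellTerm κ h1 h2 u c i 0 + cellTerm κ h1 h2 u c i 1) ≤
      sobNormSq κ K Ω u := by
  have hsub : ∀ L', n ≤ L' → Finset.range n ×ˢ Finset.range 2 ⊆ idxLe L' := by
    intro L' hL' p hp
    simp only [Finset.mem_product, Finset.mem_range] at hp
    simp only [idxLe, Finset.mem_filter, Finset.mem_product, Finset.mem_range]
    omega
  calc _ = ∑ c ∈ cells, ∑ p ∈ Finset.range n ×ˢ Finset.range 2, cellTerm κ h1 h2 u c p.1 p.2 := by
        refine Finset.sum_congr rfl fun c _ => ?_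
        rw [Finset.sum_product]
        exact Finset.sum_congr rfl fun i _ => by simp [Finset.sum_range_succ]
    _ = ∑ p ∈ Finset.range n ×ˢ Finset.range 2, (κ ^ (2 * (p.1 + p.2)))⁻¹ * ∑ c ∈ cells,
          rectSq (c.1 * h1) ((c.1 + 1) * h1) (c.2 * h2) ((c.2 + 1) * h2) (pdM p.1 p.2 u) := by
        rw [Finset.sum_comm]
        exact Finset.sum_congr rfl fun p _ => by rw [Finset.mul_sum]; rfl
    _ ≤ ∑ p ∈ Finset.range n ×ˢ Finset.range 2, (κ ^ (2 * (p.1 + p.2)))⁻¹ *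
          ∫ x in Ω, ‖pdM p.1 p.2 u x‖ ^ 2 :=
        Finset.sum_le_sum fun p hp => mul_le_mul_of_nonneg_left
          (sum_cell_integral_le hh1 hh2 hT (hmem p (hsub L (hn.trans hKL) hp))) (by positivity)
    _ ≤ _ := Finset.sum_le_sum_of_subset_of_nonneg (hsub K hn) fun p _ _ =>
        mul_nonneg (by positivity) (integral_nonneg fun _ => by positivity)

lemma sum_union_image_le {cells : Finset (ℤ × ℤ)} (f : ℤ × ℤ → ℤ × ℤ) (hf : f.Injective)
    {E : ℤ × ℤ → ℝ} (hE : ∀ e, 0 ≤ E e) :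
    ∑ e ∈ cells ∪ cells.image f, E e ≤ ∑ c ∈ cells, (E c + E (f c)) := by
  rw [Finset.sum_add_distrib, ← Finset.sum_image (g := f) (f := E) hf.injOn, ← Finset.sum_union_inter]
  exact le_add_of_nonneg_right (Finset.sum_nonneg fun e _ => hE e)

lemma sum_edges_le (cells : Finset (ℤ × ℤ)) {EH EV : ℤ × ℤ → ℝ} (hH : ∀ e, 0 ≤ EH e)
    (hV : ∀ e, 0 ≤ EV e) :
    ∑ e ∈ hEdges cells, EH e + ∑ e ∈ vEdges cells, EV e ≤
      ∑ c ∈ cells, (EH c + EH (c.1, c.2 + 1) + (EV c + EV (c.1 + 1, c.2))) := by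
  rw [Finset.sum_add_distrib]
  refine add_le_add (sum_union_image_le _ ?_ hH) (sum_union_image_le _ ?_ hV) <;>
  · rintro ⟨a, b⟩ ⟨c, d⟩ h
    simp only [Prod.mk.injEq, add_left_inj] at h
    exact Prod.ext h.1 h.2

/-- Sum of squared values at the four corners of a cell. -/
def cornerSum (h1 h2 : ℝ) (c : ℤ × ℤ) (v : ℝ × ℝ → ℂ) : ℝ :=
  ‖v (nodePt h1 h2 c)‖ ^ 2 + ‖v (nodePt h1 h2 (c.1 + 1, c.2))‖ ^ 2 +
    (‖v (nodePt h1 h2 (c.1, c.2 + 1))‖ ^ 2 + ‖v (nodePt h1 h2 (c.1 + 1, c.2 + 1))‖ ^ 2)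

/-- The weighted combination of cell integrals that controls corner values of `pdM i 0 u`. -/
def cornerBound (κ h1 h2 : ℝ) (u : ℝ × ℝ → ℂ) (c : ℤ × ℤ) (i : ℕ) : ℝ :=
  cellTerm κ h1 h2 u c i 0 + 2 / 3 * cellTerm κ h1 h2 u c (i + 1) 0 +
    2 / 3 * cellTerm κ h1 h2 u c i 1 + 4 / 9 * cellTerm κ h1 h2 u c (i + 1) 1

lemma cornerSum_pdM_le {κ h1 h2 : ℝ} (hκ : 0 < κ) (hh1 : 0 < h1) (hh2 : 0 < h2)
    {u : ℝ × ℝ → ℂ} {i : ℕ} (hu : ContDiff ℝ (i + 2 : ℕ) u) (c : ℤ × ℤ) :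
    (κ ^ (2 * i))⁻¹ * cornerSum h1 h2 c (pdM i 0 u) ≤
      4 / (h1 * h2) * traceMu (κ * h1) * traceMu (κ * h2) * cornerBound κ h1 h2 u c i := by
  have hu1 : ContDiff ℝ (i + 1 : ℕ) u := hu.of_le (by norm_cast; omega)
  have hu0 : ContDiff ℝ (i : ℕ) u := hu.of_le (by norm_cast; omega)
  have h := corner_trace_le hκ (a := c.1 * h1) (b := (c.1 + 1) * h1) (c := c.2 * h2)
    (d := (c.2 + 1) * h2) (by nlinarith) (by nlinarith) (continuous_pdM_zero hu0)
    (continuous_pdM_zero hu1) (continuous_pdM_one hu1) (continuous_pdM_one (i := i + 1) hu)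
    (hasDerivAt_pdM_fst hu1) (hasDerivAt_pdM_snd hu1) (hasDerivAt_pdM_snd (i := i + 1) hu)
  have ea : ((c.1 : ℝ) + 1) * h1 - c.1 * h1 = h1 := by ring
  have eb : ((c.2 : ℝ) + 1) * h2 - c.2 * h2 = h2 := by ring
  rw [ea, eb] at h
  have h' := mul_le_mul_of_nonneg_left h (show 0 ≤ (κ ^ (2 * i))⁻¹ by positivity)
  simp only [cornerSum, nodePt, Int.cast_add, Int.cast_one]
  refine h'.trans_eq ?_
  simp only [cornerBound, cellTerm]
  have p1 : (κ ^ (2 * (i + 0)))⁻¹ = (κ ^ (2 * i))⁻¹ := rfl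
  have p2 : (κ ^ (2 * (i + 1 + 0)))⁻¹ = (κ ^ (2 * i))⁻¹ * (κ ^ 2)⁻¹ := by
    rw [← mul_inv, ← pow_add]; rfl
  have p4 : (κ ^ (2 * (i + 1 + 1)))⁻¹ = (κ ^ (2 * i))⁻¹ * (κ ^ 4)⁻¹ := by
    rw [← mul_inv, ← pow_add]; rfl
  rw [p1, p2, p4]
  ring

lemma cornerBound_le {κ : ℝ} (hκ : 0 < κ) (h1 h2 : ℝ) (u : ℝ × ℝ → ℂ) (c : ℤ × ℤ) {i n : ℕ}
    (hi : i + 2 ≤ n) :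
    cornerBound κ h1 h2 u c i ≤
      ∑ j ∈ Finset.range n, (cellTerm κ h1 h2 u c j 0 + cellTerm κ h1 h2 u c j 1) := by
  have h0 := fun i j => cellTerm_nonneg hκ h1 h2 u c i j
  have : ∑ j ∈ ({i, i + 1} : Finset ℕ), (cellTerm κ h1 h2 u c j 0 + cellTerm κ h1 h2 u c j 1) ≤
      ∑ j ∈ Finset.range n, (cellTerm κ h1 h2 u c j 0 + cellTerm κ h1 h2 u c j 1) :=
    Finset.sum_le_sum_of_subset_of_nonneg
      (fun j hj => by simp only [Finset.mem_insert, Finset.mem_singleton] at hj; simp; omega)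
      fun j _ _ => add_nonneg (h0 _ _) (h0 _ _)
  rw [Finset.sum_pair (by omega)] at this
  unfold cornerBound
  linarith [h0 i 0, h0 (i + 1) 0, h0 i 1, h0 (i + 1) 1]

lemma exists_cell_of_node {cells : Finset (ℤ × ℤ)} {q : ℤ × ℤ} (hq : q ∈ meshNodes cells) :
    ∃ c ∈ cells, q = c ∨ q = (c.1 + 1, c.2) ∨ q = (c.1, c.2 + 1) ∨ q = (c.1 + 1, c.2 + 1) := by
  simp only [meshNodes, Finset.mem_union, Finset.mem_image] at hq
  rcases hq with ((h | ⟨c, hc, rfl⟩) | ⟨c, hc, rfl⟩) | ⟨c, hc, rfl⟩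
  · exact ⟨q, h, by simp⟩
  all_goals exact ⟨c, hc, by simp⟩

lemma node_value_le_cornerSum (h1 h2 : ℝ) {cells : Finset (ℤ × ℤ)} {q : ℤ × ℤ}
    (hq : q ∈ meshNodes cells) :
    ∃ c ∈ cells, ∀ v : ℝ × ℝ → ℂ, ‖v (nodePt h1 h2 q)‖ ^ 2 ≤ cornerSum h1 h2 c v := by
  obtain ⟨c, hc, h⟩ := exists_cell_of_node hq
  refine ⟨c, hc, fun v => ?_⟩
  have p0 := sq_nonneg ‖v (nodePt h1 h2 c)‖
  have p1 := sq_nonneg ‖v (nodePt h1 h2 (c.1 + 1, c.2))‖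
  have p2 := sq_nonneg ‖v (nodePt h1 h2 (c.1, c.2 + 1))‖
  have p3 := sq_nonneg ‖v (nodePt h1 h2 (c.1 + 1, c.2 + 1))‖
  unfold cornerSum
  rcases h with rfl | rfl | rfl | rfl <;> linarith

lemma csqrt_of_nonneg {r : ℝ} (hr : 0 ≤ r) : csqrt r = (Real.sqrt r : ℂ) := by
  rw [csqrt, Real.sqrt_eq_rpow, Complex.ofReal_cpow hr]
  norm_num

lemma csqrt_of_neg {r : ℝ} (hr : r < 0) : csqrt r = Complex.I * (Real.sqrt (-r) : ℂ) := by
  have h1 : (r : ℂ) = -1 * ((-r : ℝ) : ℂ) := by push_cast; ring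
  rw [csqrt, Complex.ofReal_cpow_of_nonpos hr.le, ← Complex.ofReal_neg, ← csqrt, csqrt_of_nonneg (by linarith)]
  rw [show (π * Complex.I * (1 / 2) : ℂ) = π / 2 * Complex.I by ring, Complex.exp_pi_div_two_mul_I, mul_comm]

/-- The vertical profile of a separated Helmholtz mode whose squared vertical wavenumber
is `κ² r`, normalized to be `1` at height `L`. -/
def vertRatio (κ L r s : ℝ) : ℝ :=
  if 0 ≤ r then Real.sin (s * κ * Real.sqrt r) / Real.sin (L * κ * Real.sqrt r)
  else Real.sinh (s * κ * Real.sqrt (-r)) / Real.sinh (L * κ * Real.sqrt (-r))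

lemma vertRatio_zero (κ L r : ℝ) : vertRatio κ L r 0 = 0 := by
  simp [vertRatio]

lemma continuous_vertRatio (κ L r : ℝ) : Continuous (vertRatio κ L r) := by
  unfold vertRatio
  split_ifs <;> fun_prop

lemma sin_csqrt_ratio (κ L r s : ℝ) :
    Complex.sin ((s : ℂ) * (κ : ℂ) * csqrt r) / Complex.sin ((L : ℂ) * (κ : ℂ) * csqrt r) =
      (vertRatio κ L r s : ℂ) := by
  unfold vertRatio
  split_ifs with h
  · rw [csqrt_of_nonneg h]; push_cast; rfl
  · rw [csqrt_of_neg (not_le.1 h)]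
    have e : ∀ z : ℝ, Complex.sin ((z : ℂ) * (κ : ℂ) * (Complex.I * (Real.sqrt (-r) : ℂ))) =
        Complex.sinh ((z * κ * Real.sqrt (-r) : ℝ) : ℂ) * Complex.I := fun z => by
      rw [show (z : ℂ) * (κ : ℂ) * (Complex.I * (Real.sqrt (-r) : ℂ)) =
        ((z * κ * Real.sqrt (-r) : ℝ) : ℂ) * Complex.I by push_cast; ring, Complex.sin_mul_I]
    rw [e, e, mul_div_mul_right _ _ Complex.I_ne_zero]
    push_cast; rfl

lemma phiHat_eq (κ h1 h2 : ℝ) (n : ℕ) (x : ℝ × ℝ) :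
    phiHat κ h1 h2 n x = ((Real.sin (κ * nuHat κ h1 n * x.1) *
      vertRatio κ h2 (1 - nuHat κ h1 n ^ 2) x.2 : ℝ) : ℂ) := by
  have := sin_csqrt_ratio κ h2 (1 - nuHat κ h1 n ^ 2) x.2
  simp only [phiHat]
  rw [mul_div_assoc]
  push_cast
  rw [← this]

lemma kappa_mul_nuHat {κ : ℝ} (hκ : 0 < κ) (h1 : ℝ) (n : ℕ) : κ * nuHat κ h1 n = n * π / h1 := by
  unfold nuHat
  rw [mul_div_assoc', mul_div_mul_left _ _ hκ.ne']

lemma sin_vertical_ne_zero {κ h1 h2 : ℝ} (hκ : 0 < κ) (hh2 : 0 < h2) (hA : A0cond κ h1 h2)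
    (n : ℕ) (hr : 0 ≤ 1 - nuHat κ h1 n ^ 2) :
    Real.sin (h2 * κ * Real.sqrt (1 - nuHat κ h1 n ^ 2)) ≠ 0 := by
  intro h0
  obtain ⟨m, hm⟩ := Real.sin_eq_zero_iff.1 h0
  have hm0 : 0 ≤ (m : ℝ) := by
    have : 0 ≤ (m : ℝ) * π := by rw [hm]; positivity
    exact nonneg_of_mul_nonneg_left this pi_pos
  have hmz : 0 ≤ m := by exact_mod_cast hm0
  lift m to ℕ using hmz
  refine hA n m ?_
  have h3 : (m : ℝ) * π / h2 = κ * Real.sqrt (1 - nuHat κ h1 n ^ 2) := by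
    rw [div_eq_iff hh2.ne']
    have := hm
    push_cast at this
    linarith
  rw [h3, ← kappa_mul_nuHat hκ, mul_pow, mul_pow, Real.sq_sqrt hr]
  ring

lemma vertRatio_self {κ h1 h2 : ℝ} (hκ : 0 < κ) (hh2 : 0 < h2) (hA : A0cond κ h1 h2) (n : ℕ) :
    vertRatio κ h2 (1 - nuHat κ h1 n ^ 2) h2 = 1 := by
  unfold vertRatio
  split_ifs with h
  · exact div_self (sin_vertical_ne_zero hκ hh2 hA n h)
  · refine div_self (Real.sinh_pos_iff.2 ?_).ne'
    have : 0 < Real.sqrt (-(1 - nuHat κ h1 n ^ 2)) := Real.sqrt_pos.2 (by linarith)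
    positivity

lemma A0cond.symm {κ h1 h2 : ℝ} (h : A0cond κ h1 h2) : A0cond κ h2 h1 := fun n m => by
  rw [add_comm]; exact h m n

/-- The horizontal profile of a node basis function along a mesh row. -/
def rowMode (h1 : ℝ) (p : ℤ) (k : ℕ) (t : ℝ) : ℝ :=
  if t ∈ Icc ((p - 1) * h1) ((p + 1) * h1) then
    Real.sin ((2 * k + 1) * π / (2 * h1) * (t - (p - 1) * h1)) else 0

/-- The vertical profile of a node basis function along a mesh column. -/
def colMode (κ h1 h2 : ℝ) (k : ℕ) (s : ℝ) : ℝ :=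
  vertRatio κ h2 (1 - nuHat κ (2 * h1) (2 * k + 1) ^ 2) s

lemma psiNode_succ {κ h1 h2 : ℝ} (hκ : 0 < κ) (p : ℤ × ℤ) (k : ℕ) (x : ℝ × ℝ) :
    psiNode κ h1 h2 p (k + 1) x =
      (((if x.2 ∈ Icc ((p.2 : ℝ) * h2) (((p.2 : ℝ) + 1) * h2) then
          rowMode h1 p.1 k x.1 * colMode κ h1 h2 k (h2 + ((p.2 : ℝ) * h2 - x.2))
        else if x.2 ∈ Icc (((p.2 : ℝ) - 1) * h2) ((p.2 : ℝ) * h2) then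
          rowMode h1 p.1 k x.1 * colMode κ h1 h2 k (h2 - ((p.2 : ℝ) * h2 - x.2))
        else 0) : ℝ) : ℂ) := by
  unfold psiNode
  have hs : 2 * (k + 1) - 1 = 2 * k + 1 := by omega
  rw [hs]
  simp only [phiHat_eq, kappa_mul_nuHat hκ, mem_prod]
  have e : ∀ t : ℝ, ((2 * k + 1 : ℕ) : ℝ) * π / (2 * h1) * (h1 - ((p.1 : ℝ) * h1 - t)) =
      (2 * k + 1) * π / (2 * h1) * (t - (p.1 - 1) * h1) := fun t => by push_cast; ring
  simp only [e, rowMode, colMode]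
  by_cases h1 : x.1 ∈ Icc (((p.1 : ℝ) - 1) * h1) (((p.1 : ℝ) + 1) * h1)
  · simp only [h1, true_and, if_true]
    split_ifs <;> simp
  · simp only [h1, false_and, if_false]
    split_ifs <;> simp

lemma colMode_zero (κ h1 h2 : ℝ) (k : ℕ) : colMode κ h1 h2 k 0 = 0 := vertRatio_zero _ _ _

lemma colMode_self {κ h1 h2 : ℝ} (hκ : 0 < κ) (hh2 : 0 < h2) (hA : A2cond κ h1 h2) (k : ℕ) :
    colMode κ h1 h2 k h2 = 1 := vertRatio_self hκ hh2 hA _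

lemma int_mul_le_iff {h : ℝ} (hh : 0 < h) (m n : ℤ) : (m : ℝ) * h ≤ n * h ↔ m ≤ n := by
  rw [mul_le_mul_iff_left₀ hh]; exact_mod_cast Iff.rfl

lemma psiNode_row {κ h1 h2 : ℝ} (hκ : 0 < κ) (hh2 : 0 < h2) (hA : A2cond κ h1 h2) (p : ℤ × ℤ)
    (k : ℕ) (j : ℤ) (t : ℝ) :
    psiNode κ h1 h2 p (k + 1) (t, (j : ℝ) * h2) =
      if p.2 = j then (rowMode h1 p.1 k t : ℂ) else 0 := by
  rw [psiNode_succ hκ]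
  have i1 := int_mul_le_iff hh2 p.2 j
  have i2 := int_mul_le_iff hh2 j (p.2 + 1)
  have i3 := int_mul_le_iff hh2 (p.2 - 1) j
  have i4 := int_mul_le_iff hh2 j p.2
  push_cast at i2 i3
  simp only [mem_Icc, i1, i2, i3, i4]
  rcases lt_trichotomy j p.2 with h | h | h
  · rw [if_neg (by omega : ¬ (p.2 ≤ j ∧ j ≤ p.2 + 1)), if_neg (by omega : ¬ p.2 = j)]
    by_cases h' : p.2 - 1 ≤ j
    · have hj : (j : ℝ) = p.2 - 1 := by exact_mod_cast (by omega : j = p.2 - 1)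
      rw [hj, show h2 - ((p.2 : ℝ) * h2 - ((p.2 : ℝ) - 1) * h2) = 0 by ring, colMode_zero]
      simp
    · rw [if_neg (by omega)]; simp
  · rw [if_pos (by omega : p.2 ≤ j ∧ j ≤ p.2 + 1), if_pos h.symm, h, sub_self, add_zero,
      colMode_self hκ hh2 hA, mul_one]
  · rw [if_neg (by omega : ¬ p.2 = j), if_neg (by omega : ¬ (p.2 - 1 ≤ j ∧ j ≤ p.2))]
    by_cases h' : j ≤ p.2 + 1
    · have hj : (j : ℝ) = p.2 + 1 := by exact_mod_cast (by omega : j = p.2 + 1)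
      rw [hj, show h2 + ((p.2 : ℝ) * h2 - ((p.2 : ℝ) + 1) * h2) = 0 by ring, colMode_zero]
      simp
    · rw [if_neg (by omega)]; simp

lemma sin_odd_half_pi (k : ℕ) : Real.sin ((2 * k + 1) * π / 2) = (-1) ^ k := by
  rw [show (2 * k + 1) * π / 2 = k * π + π / 2 by ring, Real.sin_add_pi_div_two, Real.cos_nat_mul_pi]

lemma sin_odd_pi (k : ℕ) : Real.sin ((2 * k + 1) * π) = 0 := by
  have := Real.sin_nat_mul_pi (2 * k + 1)
  push_cast at this
  exact this

lemma cos_odd_half_pi (k : ℕ) : Real.cos ((2 * k + 1) * π / 2) = 0 := by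
  rw [show (2 * k + 1) * π / 2 = k * π + π / 2 by ring, Real.cos_add_pi_div_two,
    Real.sin_nat_mul_pi, neg_zero]

lemma rowMode_node {h1 : ℝ} (hh1 : 0 < h1) (p i : ℤ) (k : ℕ) :
    rowMode h1 p k (i * h1) = if p = i then (-1) ^ k else 0 := by
  unfold rowMode
  have i1 := int_mul_le_iff hh1 (p - 1) i
  have i2 := int_mul_le_iff hh1 i (p + 1)
  push_cast at i1 i2
  simp only [mem_Icc, i1, i2]
  by_cases h : p - 1 ≤ i ∧ i ≤ p + 1
  · rw [if_pos h]
    have : i = p - 1 ∨ i = p ∨ i = p + 1 := by omega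
    rcases this with rfl | rfl | rfl
    · rw [if_neg (by omega)]; simp
    · rw [if_pos rfl, ← sin_odd_half_pi]
      congr 1
      field_simp; ring
    · rw [if_neg (by omega), ← sin_odd_pi k]
      congr 1
      push_cast
      field_simp; ring
  · rw [if_neg h, if_neg (by omega)]

lemma deriv_eq_zero_of_kink {f g1 g2 : ℝ → ℂ} {t : ℝ} {D1 D2 : ℂ} (hne : D1 ≠ D2)
    (h1 : HasDerivAt g1 D1 t) (h2 : HasDerivAt g2 D2 t)
    (e1 : f =ᶠ[nhdsWithin t (Iic t)] g1) (e2 : f =ᶠ[nhdsWithin t (Ici t)] g2) :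
    deriv f t = 0 := by
  refine deriv_zero_of_not_differentiableAt fun hd => hne ?_
  have d1 : HasDerivWithinAt f D1 (Iic t) t :=
    h1.hasDerivWithinAt.congr_of_eventuallyEq_of_mem e1 self_mem_Iic
  have d2 : HasDerivWithinAt f D2 (Ici t) t :=
    h2.hasDerivWithinAt.congr_of_eventuallyEq_of_mem e2 self_mem_Ici
  have c1 := (uniqueDiffOn_Iic t t self_mem_Iic).eq_deriv _ d1 hd.hasDerivAt.hasDerivWithinAt
  have c2 := (uniqueDiffOn_Ici t t self_mem_Ici).eq_deriv _ d2 hd.hasDerivAt.hasDerivWithinAt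
  rw [c1, c2]

lemma deriv_eq_zero_of_jump {f g : ℝ → ℂ} {t : ℝ} (l : Filter ℝ) [l.NeBot] (hl : l ≤ nhds t)
    (hg : ContinuousAt g t) (hne : f t ≠ g t) (e : ∀ᶠ s in l, f s = g s) :
    deriv f t = 0 := by
  refine deriv_zero_of_not_differentiableAt fun hd => hne ?_
  have h1 : Filter.Tendsto f l (nhds (f t)) := hd.continuousAt.tendsto.mono_left hl
  have h2 : Filter.Tendsto f l (nhds (g t)) :=
    (Filter.tendsto_congr' e).2 (hg.tendsto.mono_left hl)
  exact tendsto_nhds_unique h1 h2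

/-- A sine arch between two of its zeros, extended by zero, satisfies the oscillator equation
everywhere, because `deriv` vanishes at the kinks. -/
lemma deriv_deriv_sin_arch {a α β : ℝ} (ha : 0 < a) (hαβ : α < β)
    (hs : Real.sin (a * (β - α)) = 0) (t : ℝ) :
    let g : ℝ → ℂ := fun t => ((if t ∈ Icc α β then Real.sin (a * (t - α)) else 0 : ℝ) : ℂ)
    deriv (deriv g) t = ((-a ^ 2 : ℝ) : ℂ) * g t := by
  intro g
  have hc : Real.cos (a * (β - α)) ≠ 0 := fun h => by
    have := Real.sin_sq_add_cos_sq (a * (β - α)); rw [hs, h] at this; norm_num at this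
  have dS : ∀ t, HasDerivAt (fun t => ((Real.sin (a * (t - α)) : ℝ) : ℂ))
      ((a * Real.cos (a * (t - α)) : ℝ) : ℂ) t := fun t => by
    have := ((((hasDerivAt_id t).sub_const α).const_mul a).sin).ofReal_comp
    refine this.congr_deriv ?_
    simp [mul_comm]
  have dC : ∀ t, HasDerivAt (fun t => ((a * Real.cos (a * (t - α)) : ℝ) : ℂ))
      ((-a ^ 2 * Real.sin (a * (t - α)) : ℝ) : ℂ) t := fun t => by
    have := (((((hasDerivAt_id t).sub_const α).const_mul a).cos).const_mul a).ofReal_comp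
    refine this.congr_deriv ?_
    simp; ring
  have d0 : ∀ t, HasDerivAt (fun _ : ℝ => (0 : ℂ)) 0 t := fun t => hasDerivAt_const _ _
  have hgα : g α = 0 := by simp [g]
  have hgβ : g β = 0 := by simp only [g]; split_ifs <;> simp [hs]
  have hout : ∀ s, s ∉ Icc α β → g s = 0 := fun s hs => by simp only [g, if_neg hs]; simp
  have hin : ∀ s ∈ Icc α β, g s = ((Real.sin (a * (s - α)) : ℝ) : ℂ) := fun s hs => by
    simp only [g, if_pos hs]
  have inner : ∀ t ∈ Ioo α β, g =ᶠ[nhds t] fun s => ((Real.sin (a * (s - α)) : ℝ) : ℂ) :=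
    fun t ht => Filter.mem_of_superset (Ioo_mem_nhds ht.1 ht.2) fun s hs => hin s (Ioo_subset_Icc_self hs)
  have outer : ∀ t, t < α ∨ β < t → g =ᶠ[nhds t] fun _ => 0 := by
    rintro t (ht | ht)
    · exact Filter.mem_of_superset (Iio_mem_nhds ht) fun s hs => hout s fun h => absurd h.1 (not_le.2 hs)
    · exact Filter.mem_of_superset (Ioi_mem_nhds ht) fun s hs => hout s fun h => absurd h.2 (not_le.2 hs)
  have D1 : ∀ t ∈ Ioo α β, deriv g t = ((a * Real.cos (a * (t - α)) : ℝ) : ℂ) := fun t ht => by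
    rw [(inner t ht).deriv_eq, (dS t).deriv]
  have D2 : ∀ t, t < α ∨ β < t → deriv g t = 0 := fun t ht => by
    rw [(outer t ht).deriv_eq, (d0 t).deriv]
  have zl : g =ᶠ[nhdsWithin α (Iic α)] fun _ => 0 :=
    Filter.mem_of_superset self_mem_nhdsWithin fun s (hs : s ≤ α) => by
      rcases hs.eq_or_lt with rfl | hlt
      · exact hgα
      · exact hout s fun h => absurd h.1 (not_le.2 hlt)
  have zr : g =ᶠ[nhdsWithin β (Ici β)] fun _ => 0 :=
    Filter.mem_of_superset self_mem_nhdsWithin fun s (hs : β ≤ s) => by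
      rcases hs.eq_or_lt with rfl | hlt
      · exact hgβ
      · exact hout s fun h => absurd h.2 (not_le.2 hlt)
  have Dα : deriv g α = 0 := by
    refine deriv_eq_zero_of_kink ?_ (d0 α) (dS α) zl
      (Filter.mem_of_superset (Icc_mem_nhdsGE hαβ) hin)
    simpa using (Complex.ofReal_ne_zero.2 ha.ne').symm
  have Dβ : deriv g β = 0 := by
    refine deriv_eq_zero_of_kink ?_ (dS β) (d0 β)
      (Filter.mem_of_superset (Icc_mem_nhdsLE hαβ) hin) zr
    exact_mod_cast mul_ne_zero ha.ne' hc
  rcases lt_trichotomy t α with h | rfl | h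
  · have : deriv g =ᶠ[nhds t] fun _ => 0 := Filter.mem_of_superset (Iio_mem_nhds h) fun s hs => D2 s (Or.inl hs)
    rw [this.deriv_eq, (d0 t).deriv, hout t (fun h' => absurd h'.1 (not_le.2 h)), mul_zero]
  · rw [hgα, mul_zero]
    refine deriv_eq_zero_of_jump (nhdsWithin t (Ioi t)) nhdsWithin_le_nhds (dC t).continuousAt ?_
      (Filter.mem_of_superset (Ioo_mem_nhdsGT hαβ) D1)
    rw [Dα]; simpa using (Complex.ofReal_ne_zero.2 ha.ne').symm
  · rcases lt_trichotomy t β with h' | rfl | h'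
    · have : deriv g =ᶠ[nhds t] fun s => ((a * Real.cos (a * (s - α)) : ℝ) : ℂ) :=
        Filter.mem_of_superset (Ioo_mem_nhds h h') D1
      rw [this.deriv_eq, (dC t).deriv, hin t ⟨h.le, h'.le⟩]; push_cast; ring
    · rw [hgβ, mul_zero]
      refine deriv_eq_zero_of_jump (nhdsWithin t (Iio t)) nhdsWithin_le_nhds (dC t).continuousAt ?_
        (Filter.mem_of_superset (Ioo_mem_nhdsLT hαβ) D1)
      rw [Dβ]
      exact_mod_cast (mul_ne_zero ha.ne' hc).symm
    · have : deriv g =ᶠ[nhds t] fun _ => 0 := Filter.mem_of_superset (Ioi_mem_nhds h') fun s hs => D2 s (Or.inr hs)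
      rw [this.deriv_eq, (d0 t).deriv, hout t (fun h'' => absurd h''.2 (not_le.2 h')), mul_zero]

lemma pdM_zero_apply (i : ℕ) (f : ℝ × ℝ → ℂ) (t s : ℝ) :
    pdM i 0 f (t, s) = deriv^[i] (fun t => f (t, s)) t := by
  induction i generalizing t with
  | zero => rfl
  | succ i ih =>
    rw [pdM_succ, Function.iterate_succ_apply']
    exact congrArg (fun g => deriv g t) (funext ih)

lemma iterate_deriv_rowMode {h1 : ℝ} (hh1 : 0 < h1) (p : ℤ) (k n : ℕ) :
    deriv^[2 * n] (fun t => (rowMode h1 p k t : ℂ)) = fun t =>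
      ((-((2 * k + 1) * π / (2 * h1)) ^ 2 : ℝ) : ℂ) ^ n * rowMode h1 p k t := by
  induction n with
  | zero => simp
  | succ n ih =>
    rw [show 2 * (n + 1) = 2 * n + 1 + 1 by ring, Function.iterate_succ_apply',
      Function.iterate_succ_apply', ih]
    funext t
    have e1 : deriv (fun t => ((-((2 * k + 1) * π / (2 * h1)) ^ 2 : ℝ) : ℂ) ^ n *
        rowMode h1 p k t) = fun t => ((-((2 * k + 1) * π / (2 * h1)) ^ 2 : ℝ) : ℂ) ^ n *
        deriv (fun t => (rowMode h1 p k t : ℂ)) t := funext fun t => deriv_const_mul_field _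
    rw [e1, deriv_const_mul_field,
      pow_succ (((-((2 * k + 1) * π / (2 * h1)) ^ 2 : ℝ)) : ℂ) n, mul_assoc]
    congr 1
    refine deriv_deriv_sin_arch (a := (2 * k + 1) * π / (2 * h1)) (α := (p - 1) * h1)
      (β := (p + 1) * h1) (by positivity) (by nlinarith) ?_ t
    rw [← sin_odd_pi k]
    congr 1
    field_simp
    ring

lemma pdM_psiNode_node {κ h1 h2 : ℝ} (hκ : 0 < κ) (hh1 : 0 < h1) (hh2 : 0 < h2)
    (hA : A2cond κ h1 h2) (p q : ℤ × ℤ) (k n : ℕ) :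
    pdM (2 * n) 0 (psiNode κ h1 h2 p (k + 1)) (nodePt h1 h2 q) =
      if p = q then ((-((2 * k + 1) * π / (2 * h1)) ^ 2 : ℝ) : ℂ) ^ n * (-1) ^ k else 0 := by
  rw [nodePt, pdM_zero_apply]
  simp only [psiNode_row hκ hh2 hA]
  by_cases h2 : p.2 = q.2
  · simp only [h2, if_true]
    rw [iterate_deriv_rowMode hh1]
    simp only [rowMode_node hh1]
    by_cases h1 : p.1 = q.1
    · rw [if_pos h1, if_pos (Prod.ext h1 h2)]; push_cast; rfl
    · rw [if_neg h1, if_neg (fun h => h1 (congrArg Prod.fst h))]; simp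
  · rw [if_neg (fun h => h2 (congrArg Prod.snd h))]
    simp only [h2, if_false]
    have : ∀ i, deriv^[i] (fun _ : ℝ => (0 : ℂ)) = fun _ => 0 := fun i => by
      induction i with
      | zero => rfl
      | succ i ih => rw [Function.iterate_succ_apply', ih]; funext t; exact deriv_const _ _
    rw [this]

/-- Coefficients of the nodal interpolant, with the alternating sign absorbed and extended by zero
to all nodes and modes. -/
def nodeCoef {cells : Finset (ℤ × ℤ)} {N : ℕ} (β : {p : ℤ × ℤ // p ∈ meshNodes cells} × Fin N → ℂ)
    (q : ℤ × ℤ) (m : ℕ) : ℂ :=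
  if h : q ∈ meshNodes cells ∧ m < N then (-1) ^ m * β (⟨q, h.1⟩, ⟨m, h.2⟩) else 0

lemma nodeCoef_eq {cells : Finset (ℤ × ℤ)} {N : ℕ}
    (β : {p : ℤ × ℤ // p ∈ meshNodes cells} × Fin N → ℂ) (p : {p : ℤ × ℤ // p ∈ meshNodes cells})
    (m : Fin N) : nodeCoef β p.1 m = (-1) ^ (m : ℕ) * β (p, m) := by
  rw [nodeCoef, dif_pos ⟨p.2, m.2⟩]

lemma norm_nodeCoef {cells : Finset (ℤ × ℤ)} {N : ℕ}
    (β : {p : ℤ × ℤ // p ∈ meshNodes cells} × Fin N → ℂ) (p : {p : ℤ × ℤ // p ∈ meshNodes cells})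
    (m : Fin N) : ‖nodeCoef β p.1 m‖ = ‖β (p, m)‖ := by
  rw [nodeCoef_eq, norm_mul, norm_pow, norm_neg, norm_one, one_pow, one_mul]

/-- The scaled even derivatives of the datum at a node. -/
def nodeDatum (κ h1 h2 : ℝ) (u : ℝ × ℝ → ℂ) (q : ℤ × ℤ) (n : ℕ) : ℂ :=
  ((κ : ℂ)⁻¹) ^ (2 * n) * pdM (2 * n) 0 u (nodePt h1 h2 q)

lemma nodeCoef_system {κ h1 h2 : ℝ} (hκ : 0 < κ) (hh1 : 0 < h1) (hh2 : 0 < h2)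
    (hA : A2cond κ h1 h2) {cells : Finset (ℤ × ℤ)} {N : ℕ} {u : ℝ × ℝ → ℂ}
    {β : {p : ℤ × ℤ // p ∈ meshNodes cells} × Fin N → ℂ}
    (hβ : CollocationSystem κ h1 h2 cells N u β) {q : ℤ × ℤ} (hq : q ∈ meshNodes cells)
    {n : ℕ} (hn : n < N) :
    ∑ k ∈ Finset.range N, nodeCoef β q k *
      ((-((2 * k + 1 : ℝ) ^ 2 / (4 * (κ * h1) ^ 2 / π ^ 2)) : ℝ) : ℂ) ^ n =
      nodeDatum κ h1 h2 u q n := by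
  rw [nodeDatum, ← hβ n (by omega) q hq]
  have inner : ∀ p ∈ (meshNodes cells).attach, p ≠ ⟨q, hq⟩ → (∑ m : Fin N, β (p, m) *
      (((κ : ℂ)⁻¹) ^ (2 * n) * pdM (2 * n) 0 (psiNode κ h1 h2 p.1 ((m : ℕ) + 1))
        (nodePt h1 h2 q))) = 0 := fun p _ hp => by
    refine Finset.sum_eq_zero fun m _ => ?_
    rw [pdM_psiNode_node hκ hh1 hh2 hA, if_neg (fun h => hp (Subtype.ext h))]
    simp
  rw [Finset.sum_eq_single_of_mem (⟨q, hq⟩ : {p : ℤ × ℤ // p ∈ meshNodes cells})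
    (Finset.mem_attach _ _) inner, Finset.sum_range]
  refine Finset.sum_congr rfl fun m _ => ?_
  rw [pdM_psiNode_node hκ hh1 hh2 hA, if_pos rfl]
  have := nodeCoef_eq β ⟨q, hq⟩ m
  rw [this]
  have e : ((-((2 * (m : ℕ) + 1 : ℝ) ^ 2 / (4 * (κ * h1) ^ 2 / π ^ 2)) : ℝ) : ℂ) ^ n =
      ((κ : ℂ)⁻¹) ^ (2 * n) * ((-((2 * (m : ℕ) + 1) * π / (2 * h1)) ^ 2 : ℝ) : ℂ) ^ n := by
    rw [pow_mul, ← mul_pow]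
    congr 1
    rw [← Complex.ofReal_inv, ← Complex.ofReal_pow, ← Complex.ofReal_mul]
    congr 1
    field_simp
    norm_num
  rw [e]
  ring

lemma nodeCoef_eq_sum {κ h1 h2 : ℝ} (hκ : 0 < κ) (hh1 : 0 < h1) (hh2 : 0 < h2)
    (hA : A2cond κ h1 h2) {cells : Finset (ℤ × ℤ)} {N : ℕ} {u : ℝ × ℝ → ℂ}
    {β : {p : ℤ × ℤ // p ∈ meshNodes cells} × Fin N → ℂ}
    (hβ : CollocationSystem κ h1 h2 cells N u β) {q : ℤ × ℤ} (hq : q ∈ meshNodes cells)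
    {m : ℕ} (hm : m < N) :
    nodeCoef β q m = ∑ n ∈ Finset.range N, ((oddWeight N m *
      oddE (4 * (κ * h1) ^ 2 / π ^ 2) ((Finset.range N).erase m) n : ℝ) : ℂ) *
        nodeDatum κ h1 h2 u q n :=
  odd_system_solution (by positivity) _ _
    (fun _ hn => nodeCoef_system hκ hh1 hh2 hA hβ hq hn) hm

lemma integral_cos_int_mul {h : ℝ} (hh : 0 < h) {k : ℤ} (hk : k ≠ 0) :
    ∫ t in (0 : ℝ)..h, Real.cos (k * π / h * t) = 0 := by
  have hk' : (k : ℝ) ≠ 0 := by exact_mod_cast hk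
  have hc : (k : ℝ) * π / h ≠ 0 := div_ne_zero (mul_ne_zero hk' pi_ne_zero) hh.ne'
  rw [intervalIntegral.integral_comp_mul_left (fun t => Real.cos t) hc, integral_cos, mul_zero,
    Real.sin_zero, div_mul_cancel₀ _ hh.ne', Real.sin_int_mul_pi]
  simp

lemma integral_sin_mul_sin {h : ℝ} (hh : 0 < h) (i j : ℕ) :
    ∫ t in (0 : ℝ)..h, Real.sin ((i + 1 : ℕ) * π / h * t) * Real.sin ((j + 1 : ℕ) * π / h * t) =
      if i = j then h / 2 else 0 := by
  have e : ∀ t : ℝ, Real.sin ((i + 1 : ℕ) * π / h * t) * Real.sin ((j + 1 : ℕ) * π / h * t) =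
      (1 / 2) * Real.cos (((i : ℤ) - j : ℤ) * π / h * t) -
        (1 / 2) * Real.cos (((i : ℤ) + j + 2 : ℤ) * π / h * t) := fun t => by
    rw [show (((i : ℤ) - j : ℤ) : ℝ) * π / h * t = (i + 1 : ℕ) * π / h * t - (j + 1 : ℕ) * π / h * t by
        push_cast; ring,
      show (((i : ℤ) + j + 2 : ℤ) : ℝ) * π / h * t = (i + 1 : ℕ) * π / h * t + (j + 1 : ℕ) * π / h * t by
        push_cast; ring, Real.cos_sub, Real.cos_add]
    ring
  have ic : ∀ c : ℝ, IntervalIntegrable (fun t => (1 / 2) * Real.cos (c * t)) volume 0 h := fun c =>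
    (by fun_prop : Continuous fun t : ℝ => (1 / 2) * Real.cos (c * t)).intervalIntegrable _ _
  simp_rw [e]
  rw [intervalIntegral.integral_sub (ic _) (ic _), intervalIntegral.integral_const_mul,
    intervalIntegral.integral_const_mul, integral_cos_int_mul hh (by omega : (i : ℤ) + j + 2 ≠ 0)]
  split_ifs with hij
  · simp [hij]; ring
  · rw [integral_cos_int_mul hh (by omega : (i : ℤ) - j ≠ 0)]; simp

lemma integral_cos_mul_cos {h : ℝ} (hh : 0 < h) (i j : ℕ) :
    ∫ t in (0 : ℝ)..h, Real.cos ((2 * i + 1) * π / (2 * h) * t) *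
        Real.cos ((2 * j + 1) * π / (2 * h) * t) = if i = j then h / 2 else 0 := by
  have e : ∀ t : ℝ, Real.cos ((2 * i + 1) * π / (2 * h) * t) *
        Real.cos ((2 * j + 1) * π / (2 * h) * t) =
      (1 / 2) * Real.cos (((i : ℤ) - j : ℤ) * π / h * t) +
        (1 / 2) * Real.cos (((i : ℤ) + j + 1 : ℤ) * π / h * t) := fun t => by
    rw [show (((i : ℤ) - j : ℤ) : ℝ) * π / h * t =
        (2 * i + 1) * π / (2 * h) * t - (2 * j + 1) * π / (2 * h) * t by
        push_cast; field_simp; ring,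
      show (((i : ℤ) + j + 1 : ℤ) : ℝ) * π / h * t =
        (2 * i + 1) * π / (2 * h) * t + (2 * j + 1) * π / (2 * h) * t by
        push_cast; field_simp; ring, Real.cos_sub, Real.cos_add]
    ring
  have ic : ∀ c : ℝ, IntervalIntegrable (fun t => (1 / 2) * Real.cos (c * t)) volume 0 h := fun c =>
    (by fun_prop : Continuous fun t : ℝ => (1 / 2) * Real.cos (c * t)).intervalIntegrable _ _
  simp_rw [e]
  rw [intervalIntegral.integral_add (ic _) (ic _), intervalIntegral.integral_const_mul,
    intervalIntegral.integral_const_mul, integral_cos_int_mul hh (by omega : (i : ℤ) + j + 1 ≠ 0)]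
  split_ifs with hij
  · simp [hij]; ring
  · rw [integral_cos_int_mul hh (by omega : (i : ℤ) - j ≠ 0)]; simp

lemma integral_sum_sq_of_orthogonal {a b c : ℝ} {f : ℕ → ℝ → ℝ} (hf : ∀ n, Continuous (f n))
    (ho : ∀ i j, ∫ t in a..b, f i t * f j t = if i = j then c else 0) (N : ℕ) (w : ℕ → ℝ) :
    ∫ t in a..b, (∑ n ∈ Finset.range N, w n * f n t) ^ 2 = c * ∑ n ∈ Finset.range N, w n ^ 2 := by
  have e : ∀ t, (∑ n ∈ Finset.range N, w n * f n t) ^ 2 =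
      ∑ i ∈ Finset.range N, ∑ j ∈ Finset.range N, (w i * w j) * (f i t * f j t) := fun t => by
    rw [sq, Finset.sum_mul_sum]
    exact Finset.sum_congr rfl fun _ _ => Finset.sum_congr rfl fun _ _ => by ring
  simp_rw [e]
  rw [intervalIntegral.integral_finsetSum fun i _ =>
    (by fun_prop : Continuous _).intervalIntegrable _ _, Finset.mul_sum]
  refine Finset.sum_congr rfl fun i hi => ?_
  rw [intervalIntegral.integral_finsetSum fun i _ =>
    (by fun_prop : Continuous _).intervalIntegrable _ _, Finset.sum_eq_single_of_mem i hi]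
  · rw [intervalIntegral.integral_const_mul, ho, if_pos rfl]; ring
  · intro j _ hj
    rw [intervalIntegral.integral_const_mul, ho, if_neg hj.symm, mul_zero]

lemma bessel_real {a b c : ℝ} (hab : a ≤ b) (hc : 0 < c) {f : ℕ → ℝ → ℝ}
    (hf : ∀ n, Continuous (f n))
    (ho : ∀ i j, ∫ t in a..b, f i t * f j t = if i = j then c else 0) {g : ℝ → ℝ}
    (hg : Continuous g) (N : ℕ) :
    ∑ n ∈ Finset.range N, (∫ t in a..b, g t * f n t) ^ 2 ≤ c * ∫ t in a..b, g t ^ 2 := by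
  set A : ℕ → ℝ := fun n => ∫ t in a..b, g t * f n t with hA
  have h0 : 0 ≤ ∫ t in a..b, (g t - c⁻¹ * ∑ n ∈ Finset.range N, A n * f n t) ^ 2 :=
    intervalIntegral.integral_nonneg hab fun _ _ => sq_nonneg _
  have e : ∀ t, (g t - c⁻¹ * ∑ n ∈ Finset.range N, A n * f n t) ^ 2 =
      g t ^ 2 - 2 * c⁻¹ * (∑ n ∈ Finset.range N, A n * (g t * f n t)) +
        c⁻¹ ^ 2 * (∑ n ∈ Finset.range N, A n * f n t) ^ 2 := fun t => by
    have : ∑ n ∈ Finset.range N, A n * (g t * f n t) =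
        g t * ∑ n ∈ Finset.range N, A n * f n t := by
      rw [Finset.mul_sum]; exact Finset.sum_congr rfl fun _ _ => by ring
    rw [this]; ring
  simp_rw [e] at h0
  rw [intervalIntegral.integral_add ((by fun_prop : Continuous _).intervalIntegrable _ _)
      ((by fun_prop : Continuous _).intervalIntegrable _ _),
    intervalIntegral.integral_sub ((by fun_prop : Continuous _).intervalIntegrable _ _)
      ((by fun_prop : Continuous _).intervalIntegrable _ _),
    intervalIntegral.integral_const_mul, intervalIntegral.integral_const_mul,
    integral_sum_sq_of_orthogonal hf ho,
    intervalIntegral.integral_finsetSum fun i _ =>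
      (by fun_prop : Continuous _).intervalIntegrable _ _] at h0
  simp_rw [intervalIntegral.integral_const_mul] at h0
  have e2 : ∑ n ∈ Finset.range N, A n * (∫ t in a..b, g t * f n t) =
      ∑ n ∈ Finset.range N, A n ^ 2 := Finset.sum_congr rfl fun n _ => by rw [sq]
  rw [e2] at h0
  have e3 : c⁻¹ ^ 2 * (c * ∑ n ∈ Finset.range N, A n ^ 2) =
      c⁻¹ * ∑ n ∈ Finset.range N, A n ^ 2 := by field_simp
  rw [e3] at h0
  have h4 : c⁻¹ * ∑ n ∈ Finset.range N, A n ^ 2 ≤ ∫ t in a..b, g t ^ 2 := by linarith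
  rwa [inv_mul_le_iff₀ hc] at h4

lemma bessel_complex {a b c : ℝ} (hab : a ≤ b) (hc : 0 < c) {f : ℕ → ℝ → ℝ}
    (hf : ∀ n, Continuous (f n))
    (ho : ∀ i j, ∫ t in a..b, f i t * f j t = if i = j then c else 0) {g : ℝ → ℂ}
    (hg : Continuous g) (N : ℕ) :
    ∑ n ∈ Finset.range N, ‖∫ t in a..b, g t * f n t‖ ^ 2 ≤ c * ∫ t in a..b, ‖g t‖ ^ 2 := by
  have hi : ∀ n, IntervalIntegrable (fun t => g t * f n t) volume a b := fun n =>
    (by have := hf n; fun_prop : Continuous fun t => g t * f n t).intervalIntegrable _ _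
  have hre : ∀ n, (∫ t in a..b, g t * f n t).re = ∫ t in a..b, (g t).re * f n t := fun n => by
    have := Complex.reCLM.intervalIntegral_comp_comm (hi n)
    simp only [Complex.reCLM_apply, Complex.re_mul_ofReal] at this
    exact this.symm
  have him : ∀ n, (∫ t in a..b, g t * f n t).im = ∫ t in a..b, (g t).im * f n t := fun n => by
    have := Complex.imCLM.intervalIntegral_comp_comm (hi n)
    simp only [Complex.imCLM_apply, Complex.im_mul_ofReal] at this
    exact this.symm
  have e : ∀ z : ℂ, ‖z‖ ^ 2 = z.re ^ 2 + z.im ^ 2 := fun z => by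
    rw [← Complex.normSq_eq_norm_sq, Complex.normSq_apply]; ring
  simp_rw [e, hre, him]
  rw [Finset.sum_add_distrib, intervalIntegral.integral_add
    ((by fun_prop : Continuous _).intervalIntegrable _ _)
    ((by fun_prop : Continuous _).intervalIntegrable _ _), mul_add]
  exact add_le_add (bessel_real hab hc hf ho (by fun_prop) N)
    (bessel_real hab hc hf ho (by fun_prop) N)

/-- Bessel's inequality for the sine coefficients on an interval `(a, a + h)`, with the function
known on the open interval only. -/
lemma sine_coeff_sq_sum_le {a b h : ℝ} (hh : 0 < h) (hb : b = a + h) {w : ℝ → ℂ} {φ : ℕ → ℝ → ℂ}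
    {g : ℝ → ℂ}
    (hφ : ∀ n, ∀ t ∈ Ioo 0 h, φ n (a + t) = ((Real.sin ((n + 1 : ℕ) * π / h * t) : ℝ) : ℂ))
    (hw : ∀ t ∈ Ioo 0 h, w (a + t) = g t) (hg : Continuous g) (N : ℕ) :
    ∑ n : Fin N, ‖(∫ t in a..b, w t * (starRingEnd ℂ) (φ n t)) /
      ((∫ t in a..b, ‖φ n t‖ ^ 2 : ℝ) : ℂ)‖ ^ 2 ≤ 2 / h * ∫ t in (0 : ℝ)..h, ‖g t‖ ^ 2 := by
  subst hb
  have shift : ∀ {E : Type} [NormedAddCommGroup E] [NormedSpace ℝ E] (F : ℝ → E),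
      ∫ t in a..(a + h), F t = ∫ t in (0 : ℝ)..h, F (a + t) := fun F => by
    rw [intervalIntegral.integral_comp_add_left, add_zero]
  have e : ∀ n : ℕ, (∫ t in a..(a + h), w t * (starRingEnd ℂ) (φ n t)) /
      ((∫ t in a..(a + h), ‖φ n t‖ ^ 2 : ℝ) : ℂ) =
      (2 / h : ℝ) * ∫ t in (0 : ℝ)..h, g t * (Real.sin ((n + 1 : ℕ) * π / h * t) : ℝ) := fun n => by
    rw [shift, shift]
    have e1 : ∫ t in (0 : ℝ)..h, w (a + t) * (starRingEnd ℂ) (φ n (a + t)) =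
        ∫ t in (0 : ℝ)..h, g t * (Real.sin ((n + 1 : ℕ) * π / h * t) : ℝ) :=
      intervalIntegral.integral_congr_Ioo_of_le hh.le fun t ht => by
        simp only [hφ n t ht, hw t ht, Complex.conj_ofReal]
    have e2 : ∫ t in (0 : ℝ)..h, ‖φ n (a + t)‖ ^ 2 = h / 2 := by
      have := integral_sin_mul_sin hh n n
      rw [if_pos rfl] at this
      rw [← this]
      exact intervalIntegral.integral_congr_Ioo_of_le hh.le fun t ht => by
        simp only [hφ n t ht, Complex.norm_real, Real.norm_eq_abs, sq_abs]; rw [sq]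
    rw [e1, e2]
    push_cast
    field_simp
  simp_rw [e]
  rw [Fin.sum_univ_eq_sum_range fun n => ‖((2 / h : ℝ) : ℂ) *
    ∫ t in (0 : ℝ)..h, g t * (Real.sin ((n + 1 : ℕ) * π / h * t) : ℝ)‖ ^ 2]
  simp_rw [norm_mul, mul_pow, Complex.norm_real, Real.norm_eq_abs, sq_abs]
  rw [← Finset.mul_sum]
  have := bessel_complex hh.le (half_pos hh) (fun n => by fun_prop)
    (fun i j => integral_sin_mul_sin hh i j) hg N
  calc (2 / h) ^ 2 * _ ≤ (2 / h) ^ 2 * (h / 2 * ∫ t in (0 : ℝ)..h, ‖g t‖ ^ 2) := by gcongr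
    _ = _ := by field_simp

lemma nodeInterp_eq {κ h1 h2 : ℝ} {cells : Finset (ℤ × ℤ)} {N : ℕ}
    (β : {p : ℤ × ℤ // p ∈ meshNodes cells} × Fin N → ℂ) (x : ℝ × ℝ) :
    nodeInterp κ h1 h2 cells N β x = ∑ q ∈ meshNodes cells, ∑ m ∈ Finset.range N,
      nodeCoef β q m * ((-1) ^ m * psiNode κ h1 h2 q (m + 1) x) := by
  rw [nodeInterp, ← Finset.sum_attach (meshNodes cells)]
  refine Finset.sum_congr rfl fun p _ => ?_
  rw [Finset.sum_range]
  refine Finset.sum_congr rfl fun m _ => ?_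
  rw [nodeCoef_eq]
  have : ((-1 : ℂ) ^ (m : ℕ)) * (-1) ^ (m : ℕ) = 1 := by rw [← mul_pow]; simp
  linear_combination (-β (p, m) * psiNode κ h1 h2 p.1 (m + 1) x) * this

lemma nodeCoef_of_notMem {cells : Finset (ℤ × ℤ)} {N : ℕ}
    (β : {p : ℤ × ℤ // p ∈ meshNodes cells} × Fin N → ℂ) {q : ℤ × ℤ} (hq : q ∉ meshNodes cells)
    (m : ℕ) : nodeCoef β q m = 0 := dif_neg fun h => hq h.1

lemma sum_eq_pair {ι : Type*} {S : Finset ι} {G : ι → ℂ} {a b : ι} (hab : a ≠ b)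
    (h1 : ∀ q, q ≠ a → q ≠ b → G q = 0) (h2 : ∀ q, q ∉ S → G q = 0) :
    ∑ q ∈ S, G q = G a + G b := by
  rw [← Finset.sum_pair hab, Finset.sum_subset (Finset.subset_union_left (s₂ := {a, b})) fun q _ hq => h2 q hq]
  refine (Finset.sum_subset Finset.subset_union_right fun q _ hq => ?_).symm
  simp only [Finset.mem_insert, Finset.mem_singleton, not_or] at hq
  exact h1 q hq.1 hq.2

lemma int_eq_or_of_mem {h t : ℝ} (hh : 0 < h) {i p : ℤ} (ht : t ∈ Ioo 0 h)
    (h1 : (p - 1) * h ≤ i * h + t) (h2 : i * h + t ≤ (p + 1) * h) : p = i ∨ p = i + 1 := by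
  have a1 : (p : ℝ) < i + 2 := by
    have : ((p : ℝ) - 1) * h < (i + 1) * h := by linarith [ht.2]
    have := lt_of_mul_lt_mul_right this hh.le
    linarith
  have a2 : (i : ℝ) - 1 < p := by
    have : (i : ℝ) * h < (p + 1) * h := by linarith [ht.1]
    have := lt_of_mul_lt_mul_right this hh.le
    linarith
  have b1 : p < i + 2 := by exact_mod_cast a1
  have b2 : i - 1 < p := by exact_mod_cast a2
  omega

/-- The trace of the nodal interpolant on a horizontal edge. -/
lemma nodeInterp_row {κ h1 h2 : ℝ} (hκ : 0 < κ) (hh1 : 0 < h1) (hh2 : 0 < h2)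
    (hA : A2cond κ h1 h2) {cells : Finset (ℤ × ℤ)} {N : ℕ}
    (β : {p : ℤ × ℤ // p ∈ meshNodes cells} × Fin N → ℂ) (i j : ℤ) {t : ℝ} (ht : t ∈ Ioo 0 h1) :
    nodeInterp κ h1 h2 cells N β (i * h1 + t, j * h2) =
      (∑ m ∈ Finset.range N, nodeCoef β (i, j) m * (Real.cos ((2 * m + 1) * π / (2 * h1) * t) : ℝ)) +
      ∑ m ∈ Finset.range N, nodeCoef β (i + 1, j) m *
        (Real.cos ((2 * m + 1) * π / (2 * h1) * (h1 - t)) : ℝ) := by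
  have sgn : ∀ m : ℕ, ((-1 : ℝ) ^ m) * (-1) ^ m = 1 := fun m => by rw [← mul_pow]; simp
  have split : ∀ m : ℕ, (2 * m + 1) * π / (2 * h1) * h1 = (2 * m + 1) * π / 2 := fun m => by
    field_simp
  rw [nodeInterp_eq, sum_eq_pair (a := (i, j)) (b := (i + 1, j)) (by simp)]
  · congr 1
    · refine Finset.sum_congr rfl fun m _ => ?_
      rw [psiNode_row hκ hh2 hA, if_pos rfl, rowMode, if_pos]
      · have e : (2 * m + 1) * π / (2 * h1) * (i * h1 + t - (i - 1) * h1) =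
          (2 * m + 1) * π / (2 * h1) * t + (2 * m + 1) * π / 2 := by rw [← split]; ring
        dsimp only
        rw [e, Real.sin_add, cos_odd_half_pi, sin_odd_half_pi]
        have := congrArg (fun r : ℝ => (r : ℂ)) (sgn m)
        push_cast at this ⊢
        linear_combination (nodeCoef β (i, j) m * Complex.cos ((2 * m + 1) * π / (2 * h1) * t)) * this
      · constructor <;> dsimp only <;> nlinarith [ht.1, ht.2]
    · refine Finset.sum_congr rfl fun m _ => ?_
      rw [psiNode_row hκ hh2 hA, if_pos rfl, rowMode, if_pos]
      · have e : (2 * m + 1) * π / (2 * h1) * (h1 - t) =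
          (2 * m + 1) * π / 2 - (2 * m + 1) * π / (2 * h1) * t := by rw [← split]; ring
        have e2 : (2 * m + 1) * π / (2 * h1) * (i * h1 + t - ((i + 1 : ℤ) - 1) * h1) =
          (2 * m + 1) * π / (2 * h1) * t := by push_cast; ring
        dsimp only
        rw [e, e2, Real.cos_sub, cos_odd_half_pi, sin_odd_half_pi]
        push_cast
        ring
      · push_cast
        constructor <;> nlinarith [ht.1, ht.2]
  · rintro ⟨p1, p2⟩ ha hb
    refine Finset.sum_eq_zero fun m _ => ?_
    rw [psiNode_row hκ hh2 hA]
    split_ifs with h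
    · rw [rowMode, if_neg]
      · simp
      · rintro ⟨l1, l2⟩
        dsimp only at h l1 l2
        subst h
        rcases int_eq_or_of_mem hh1 ht l1 l2 with rfl | rfl
        · exact ha rfl
        · exact hb rfl
    · simp
  · intro q hq
    exact Finset.sum_eq_zero fun m _ => by rw [nodeCoef_of_notMem β hq, zero_mul]

/-- The trace of the nodal interpolant on a vertical edge. -/
lemma nodeInterp_col {κ h1 h2 : ℝ} (hκ : 0 < κ) (hh1 : 0 < h1) (hh2 : 0 < h2)
    {cells : Finset (ℤ × ℤ)} {N : ℕ}
    (β : {p : ℤ × ℤ // p ∈ meshNodes cells} × Fin N → ℂ) (i j : ℤ) {s : ℝ} (hs : s ∈ Ioo 0 h2) :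
    nodeInterp κ h1 h2 cells N β (i * h1, j * h2 + s) =
      (∑ m ∈ Finset.range N, nodeCoef β (i, j) m * (colMode κ h1 h2 m (h2 - s) : ℝ)) +
      ∑ m ∈ Finset.range N, nodeCoef β (i, j + 1) m * (colMode κ h1 h2 m s : ℝ) := by
  have sgn : ∀ m : ℕ, ((-1 : ℂ) ^ m) * (-1) ^ m = 1 := fun m => by rw [← mul_pow]; simp
  rw [nodeInterp_eq, sum_eq_pair (a := (i, j)) (b := (i, j + 1)) (by simp)]
  · congr 1
    · refine Finset.sum_congr rfl fun m _ => ?_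
      rw [psiNode_succ hκ]
      dsimp only
      rw [rowMode_node hh1, if_pos rfl, if_pos (by constructor <;> nlinarith [hs.1, hs.2]),
        show h2 + (j * h2 - (j * h2 + s)) = h2 - s by ring]
      push_cast
      linear_combination (nodeCoef β (i, j) m * (colMode κ h1 h2 m (h2 - s) : ℝ)) * sgn m
    · refine Finset.sum_congr rfl fun m _ => ?_
      rw [psiNode_succ hκ]
      dsimp only
      push_cast
      rw [rowMode_node hh1, if_pos rfl, if_neg (by rintro ⟨l, -⟩; nlinarith [hs.1, hs.2]),
        if_pos (by constructor <;> nlinarith [hs.1, hs.2]),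
        show h2 - ((j + 1) * h2 - (j * h2 + s)) = s by ring]
      push_cast
      linear_combination (nodeCoef β (i, j + 1) m * (colMode κ h1 h2 m s : ℝ)) * sgn m
  · rintro ⟨p1, p2⟩ ha hb
    refine Finset.sum_eq_zero fun m _ => ?_
    rw [psiNode_succ hκ]
    dsimp only
    rw [rowMode_node hh1]
    by_cases h : p1 = i
    · subst h
      have key : ¬ ((p2 - 1) * h2 ≤ j * h2 + s ∧ j * h2 + s ≤ (p2 + 1) * h2) := by
        rintro ⟨l1, l2⟩
        rcases int_eq_or_of_mem hh2 hs l1 l2 with rfl | rfl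
        · exact ha rfl
        · exact hb rfl
      rw [if_neg (fun l => key ⟨by nlinarith [l.1], l.2⟩), if_neg (fun l => key ⟨l.1, by nlinarith [l.2]⟩)]
      simp
    · simp [h]
  · intro q hq
    exact Finset.sum_eq_zero fun m _ => by rw [nodeCoef_of_notMem β hq, zero_mul]

lemma phiEdgeH_self {κ h1 h2 : ℝ} (hκ : 0 < κ) (hh2 : 0 < h2) (hA : A0cond κ h1 h2)
    {cells : Finset (ℤ × ℤ)} {e : ℤ × ℤ} (he : e ∈ hEdges cells) (n : ℕ) {t : ℝ}
    (ht : t ∈ Ioo 0 h1) :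
    phiEdgeH κ h1 h2 cells e n (e.1 * h1 + t, e.2 * h2) =
      ((Real.sin (n * π / h1 * t) : ℝ) : ℂ) := by
  have val : phiHat κ h1 h2 n (e.1 * h1 + t - e.1 * h1, h2) =
      ((Real.sin (n * π / h1 * t) : ℝ) : ℂ) := by
    rw [phiHat_eq]
    dsimp only
    rw [vertRatio_self hκ hh2 hA, kappa_mul_nuHat hκ, mul_one, add_sub_cancel_left]
  unfold phiEdgeH
  dsimp only
  rw [sub_self, add_zero, sub_zero, val]
  by_cases hc : e ∈ cells
  · rw [if_pos ⟨hc, ⟨by dsimp only; linarith [ht.1], by dsimp only; linarith [ht.2]⟩,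
      ⟨by dsimp only; linarith, by dsimp only; linarith⟩⟩]
  · rw [if_neg (fun h => hc h.1), if_pos]
    refine ⟨?_, ⟨by dsimp only; linarith [ht.1], by dsimp only; linarith [ht.2]⟩,
      ⟨by push_cast; linarith, by push_cast; linarith⟩⟩
    simp only [hEdges, Finset.mem_union, Finset.mem_image] at he
    obtain h | ⟨c, hc', rfl⟩ := he
    · exact absurd h hc
    · simpa using hc'

lemma phiEdgeV_self {κ h1 h2 : ℝ} (hκ : 0 < κ) (hh1 : 0 < h1) (hA : A0cond κ h1 h2)
    {cells : Finset (ℤ × ℤ)} {e : ℤ × ℤ} (he : e ∈ vEdges cells) (n : ℕ) {s : ℝ}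
    (hs : s ∈ Ioo 0 h2) :
    phiEdgeV κ h1 h2 cells e n (e.1 * h1, e.2 * h2 + s) =
      ((Real.sin (n * π / h2 * s) : ℝ) : ℂ) := by
  have val : phiHat κ h2 h1 n (e.2 * h2 + s - e.2 * h2, h1) =
      ((Real.sin (n * π / h2 * s) : ℝ) : ℂ) := by
    rw [phiHat_eq]
    dsimp only
    rw [vertRatio_self hκ hh1 hA.symm, kappa_mul_nuHat hκ, mul_one, add_sub_cancel_left]
  unfold phiEdgeV
  dsimp only
  rw [sub_self, add_zero, sub_zero, val]
  by_cases hc : e ∈ cells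
  · rw [if_pos ⟨hc, ⟨by dsimp only; linarith, by dsimp only; linarith⟩,
      ⟨by dsimp only; linarith [hs.1], by dsimp only; linarith [hs.2]⟩⟩]
  · rw [if_neg (fun h => hc h.1), if_pos]
    refine ⟨?_, ⟨by push_cast; linarith, by push_cast; linarith⟩,
      ⟨by dsimp only; linarith [hs.1], by dsimp only; linarith [hs.2]⟩⟩
    simp only [vEdges, Finset.mem_union, Finset.mem_image] at he
    obtain h | ⟨c, hc', rfl⟩ := he
    · exact absurd h hc
    · simpa using hc'

/-- The remainder `u - 𝒱u` on a horizontal edge, as a continuous function of arc length. -/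
def rowRem {cells : Finset (ℤ × ℤ)} {N : ℕ} (h1 h2 : ℝ) (u : ℝ × ℝ → ℂ)
    (β : {p : ℤ × ℤ // p ∈ meshNodes cells} × Fin N → ℂ) (e : ℤ × ℤ) (t : ℝ) : ℂ :=
  u (e.1 * h1 + t, e.2 * h2) -
    ((∑ m ∈ Finset.range N, nodeCoef β e m * (Real.cos ((2 * m + 1) * π / (2 * h1) * t) : ℝ)) +
      ∑ m ∈ Finset.range N, nodeCoef β (e.1 + 1, e.2) m *
        (Real.cos ((2 * m + 1) * π / (2 * h1) * (h1 - t)) : ℝ))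

/-- The remainder `u - 𝒱u` on a vertical edge, as a continuous function of arc length. -/
def colRem {cells : Finset (ℤ × ℤ)} {N : ℕ} (κ h1 h2 : ℝ) (u : ℝ × ℝ → ℂ)
    (β : {p : ℤ × ℤ // p ∈ meshNodes cells} × Fin N → ℂ) (e : ℤ × ℤ) (s : ℝ) : ℂ :=
  u (e.1 * h1, e.2 * h2 + s) -
    ((∑ m ∈ Finset.range N, nodeCoef β e m * (colMode κ h1 h2 m (h2 - s) : ℝ)) +
      ∑ m ∈ Finset.range N, nodeCoef β (e.1, e.2 + 1) m * (colMode κ h1 h2 m s : ℝ))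

lemma continuous_colMode (κ h1 h2 : ℝ) (k : ℕ) : Continuous (colMode κ h1 h2 k) :=
  continuous_vertRatio _ _ _

lemma continuous_rowRem {cells : Finset (ℤ × ℤ)} {N : ℕ} (h1 h2 : ℝ) {u : ℝ × ℝ → ℂ}
    (hu : Continuous u) (β : {p : ℤ × ℤ // p ∈ meshNodes cells} × Fin N → ℂ) (e : ℤ × ℤ) :
    Continuous (rowRem h1 h2 u β e) := by
  unfold rowRem
  fun_prop

lemma continuous_colRem {cells : Finset (ℤ × ℤ)} {N : ℕ} (κ h1 h2 : ℝ) {u : ℝ × ℝ → ℂ}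
    (hu : Continuous u) (β : {p : ℤ × ℤ // p ∈ meshNodes cells} × Fin N → ℂ) (e : ℤ × ℤ) :
    Continuous (colRem κ h1 h2 u β e) := by
  have := fun k => continuous_colMode κ h1 h2 k
  unfold colRem
  fun_prop

lemma sum_alphaH_sq_le {κ h1 h2 : ℝ} (hκ : 0 < κ) (hh1 : 0 < h1) (hh2 : 0 < h2)
    (hA1 : A0cond κ h1 h2) (hA2 : A2cond κ h1 h2) {cells : Finset (ℤ × ℤ)} {N : ℕ}
    {u : ℝ × ℝ → ℂ} (hu : Continuous u) (β : {p : ℤ × ℤ // p ∈ meshNodes cells} × Fin N → ℂ)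
    {e : ℤ × ℤ} (he : e ∈ hEdges cells) (Ne : ℕ) :
    ∑ n : Fin Ne, ‖alphaH κ h1 h2 cells (u - nodeInterp κ h1 h2 cells N β) e ((n : ℕ) + 1)‖ ^ 2 ≤
      2 / h1 * ∫ t in (0 : ℝ)..h1, ‖rowRem h1 h2 u β e t‖ ^ 2 := by
  refine sine_coeff_sq_sum_le (φ := fun n t => phiEdgeH κ h1 h2 cells e (n + 1) (t, (e.2 : ℝ) * h2))
    (w := fun t => (u - nodeInterp κ h1 h2 cells N β) (t, (e.2 : ℝ) * h2)) hh1 (by ring)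
    (fun n t ht => phiEdgeH_self hκ hh2 hA1 he (n + 1) ht) (fun t ht => ?_)
    (continuous_rowRem h1 h2 hu β e) Ne
  simp only [Pi.sub_apply]
  rw [nodeInterp_row hκ hh1 hh2 hA2 β e.1 e.2 ht]
  rfl

lemma sum_alphaV_sq_le {κ h1 h2 : ℝ} (hκ : 0 < κ) (hh1 : 0 < h1) (hh2 : 0 < h2)
    (hA1 : A0cond κ h1 h2) {cells : Finset (ℤ × ℤ)} {N : ℕ}
    {u : ℝ × ℝ → ℂ} (hu : Continuous u) (β : {p : ℤ × ℤ // p ∈ meshNodes cells} × Fin N → ℂ)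
    {e : ℤ × ℤ} (he : e ∈ vEdges cells) (Ne : ℕ) :
    ∑ n : Fin Ne, ‖alphaV κ h1 h2 cells (u - nodeInterp κ h1 h2 cells N β) e ((n : ℕ) + 1)‖ ^ 2 ≤
      2 / h2 * ∫ s in (0 : ℝ)..h2, ‖colRem κ h1 h2 u β e s‖ ^ 2 := by
  refine sine_coeff_sq_sum_le (φ := fun n s => phiEdgeV κ h1 h2 cells e (n + 1) ((e.1 : ℝ) * h1, s))
    (w := fun s => (u - nodeInterp κ h1 h2 cells N β) ((e.1 : ℝ) * h1, s)) hh2 (by ring)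
    (fun n s hs => phiEdgeV_self hκ hh1 hA1 he (n + 1) hs) (fun s hs => ?_)
    (continuous_colRem κ h1 h2 hu β e) Ne
  simp only [Pi.sub_apply]
  rw [nodeInterp_col hκ hh1 hh2 β e.1 e.2 hs]
  rfl

lemma meshH_pos {h1 h2 : ℝ} (hh1 : 0 < h1) : 0 < meshH h1 h2 := lt_max_of_lt_left hh1

lemma one_le_meshRho {h1 h2 : ℝ} (hh1 : 0 < h1) (hh2 : 0 < h2) : 1 ≤ meshRho h1 h2 := by
  rw [meshRho, one_le_div (lt_min hh1 hh2)]
  exact min_le_max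

lemma meshRho_div_sq {h1 h2 : ℝ} (hh1 : 0 < h1) (hh2 : 0 < h2) :
    meshRho h1 h2 / meshH h1 h2 ^ 2 = 1 / (h1 * h2) := by
  have h3 : 0 < max h1 h2 := lt_max_of_lt_left hh1
  have h4 : 0 < min h1 h2 := lt_min hh1 hh2
  rw [meshRho, meshH, ← max_mul_min h1 h2]
  field_simp

lemma one_div_le_meshRho_div {h1 h2 : ℝ} (hh1 : 0 < h1) (hh2 : 0 < h2) :
    1 / h1 ≤ meshRho h1 h2 / meshH h1 h2 ∧ 1 / h2 ≤ meshRho h1 h2 / meshH h1 h2 := by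
  have h3 : 0 < max h1 h2 := lt_max_of_lt_left hh1
  have h4 : 0 < min h1 h2 := lt_min hh1 hh2
  have e : meshRho h1 h2 / meshH h1 h2 = 1 / min h1 h2 := by
    rw [meshRho, meshH]; field_simp
  rw [e]
  exact ⟨one_div_le_one_div_of_le h4 (min_le_left _ _), one_div_le_one_div_of_le h4 (min_le_right _ _)⟩

lemma traceMu_mul_le {κ a h : ℝ} (hκ : 0 < κ) (ha : 0 < a) (hah : a ≤ h) :
    traceMu (κ * a) ≤ 9 / 8 * max 1 (κ * h) ^ 2 := by
  refine (traceMu_le (by positivity)).trans ?_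
  gcongr

lemma min_growth_le_chiN {κ h1 h2 : ℝ} (hκ : 0 < κ) (hh1 : 0 < h1) (hh2 : 0 < h2) (N : ℕ) :
    min (Real.exp (κ * h1) / (κ * h1)) (Real.exp 1 * max 1 (κ * h1) ^ (2 * (N - 1))) ≤
      chiN (meshRho h1 h2) (κ * meshH h1 h2) N := by
  have hle : κ * h1 ≤ κ * meshH h1 h2 := mul_le_mul_of_nonneg_left (le_max_left _ _) hκ.le
  have hm := meshH_pos (h2 := h2) hh1
  refine min_le_min ?_ ?_
  · have e : meshRho h1 h2 * Real.exp (κ * meshH h1 h2) / (κ * meshH h1 h2) =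
        Real.exp (κ * meshH h1 h2) / κ * (meshRho h1 h2 / meshH h1 h2) := by field_simp
    rw [e, show Real.exp (κ * h1) / (κ * h1) = Real.exp (κ * h1) / κ * (1 / h1) by field_simp]
    have := (one_div_le_meshRho_div hh1 hh2).1
    gcongr
  · gcongr

lemma sum_cell_le {κ h1 h2 : ℝ} (hκ : 0 < κ) (hh1 : 0 < h1) (hh2 : 0 < h2)
    {cells : Finset (ℤ × ℤ)} {Ω : Set (ℝ × ℝ)} (hT : IsTessellation h1 h2 cells Ω)
    {L K n : ℕ} {u : ℝ × ℝ → ℂ} (hmem : MemSob L Ω u) (hKL : K ≤ L) (hn : n ≤ K)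
    {c : ℤ × ℤ} (hc : c ∈ cells) :
    ∑ i ∈ Finset.range n, (cellTerm κ h1 h2 u c i 0 + cellTerm κ h1 h2 u c i 1) ≤
      sobNormSq κ K Ω u :=
  (Finset.single_le_sum (f := fun c => ∑ i ∈ Finset.range n,
    (cellTerm κ h1 h2 u c i 0 + cellTerm κ h1 h2 u c i 1)) (fun _ _ => Finset.sum_nonneg fun _ _ =>
      add_nonneg (cellTerm_nonneg hκ _ _ _ _ _ _) (cellTerm_nonneg hκ _ _ _ _ _ _)) hc).trans
    (sum_cellTerm_le hκ hh1 hh2 hT hmem hKL hn)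

lemma norm_nodeDatum_sq_le_cornerSum {κ h1 h2 : ℝ} (hκ : 0 < κ) (u : ℝ × ℝ → ℂ) (q : ℤ × ℤ)
    (n : ℕ) : ‖nodeDatum κ h1 h2 u q n‖ ^ 2 =
      (κ ^ (2 * (2 * n)))⁻¹ * ‖pdM (2 * n) 0 u (nodePt h1 h2 q)‖ ^ 2 := by
  rw [nodeDatum, norm_mul, mul_pow, norm_pow, norm_inv, Complex.norm_real, Real.norm_eq_abs,
    abs_of_pos hκ, ← pow_mul, inv_pow, mul_comm (2 * n) 2]

lemma norm_nodeDatum_le {κ h1 h2 : ℝ} (hκ : 0 < κ) (hh1 : 0 < h1) (hh2 : 0 < h2)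
    {cells : Finset (ℤ × ℤ)} {Ω : Set (ℝ × ℝ)} (hT : IsTessellation h1 h2 cells Ω)
    {L K : ℕ} {u : ℝ × ℝ → ℂ} (hreg : ContDiff ℝ (L : ℕ) u) (hmem : MemSob L Ω u) (hKL : K ≤ L)
    {q : ℤ × ℤ} (hq : q ∈ meshNodes cells) {n : ℕ} (hn : 2 * n + 2 ≤ K) :
    ‖nodeDatum κ h1 h2 u q n‖ ≤
      9 / 4 * max 1 (κ * meshH h1 h2) ^ 2 * meshRho h1 h2 / meshH h1 h2 * sobNorm κ K Ω u := by
  obtain ⟨c, hc, hcq⟩ := node_value_le_cornerSum h1 h2 hq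
  have hu : ContDiff ℝ (2 * n + 2 : ℕ) u := hreg.of_le (by exact_mod_cast hn.trans hKL)
  have hS : 0 ≤ sobNormSq κ K Ω u := (Finset.sum_nonneg fun i _ =>
      add_nonneg (cellTerm_nonneg hκ _ _ _ _ _ _) (cellTerm_nonneg hκ _ _ _ _ _ _)).trans
    (sum_cell_le hκ hh1 hh2 hT hmem hKL le_rfl hc)
  have hρ := one_le_meshRho hh1 hh2
  have hh := meshH_pos (h2 := h2) hh1
  have m1 := traceMu_mul_le hκ hh1 (le_max_left h1 h2)
  have m2 := traceMu_mul_le hκ hh2 (le_max_right h1 h2)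
  have key : ‖nodeDatum κ h1 h2 u q n‖ ^ 2 ≤
      (9 / 4 * max 1 (κ * meshH h1 h2) ^ 2 * meshRho h1 h2 / meshH h1 h2 * sobNorm κ K Ω u) ^ 2 := by
    calc ‖nodeDatum κ h1 h2 u q n‖ ^ 2
        ≤ (κ ^ (2 * (2 * n)))⁻¹ * cornerSum h1 h2 c (pdM (2 * n) 0 u) := by
          rw [norm_nodeDatum_sq_le_cornerSum hκ]
          exact mul_le_mul_of_nonneg_left (hcq _) (by positivity)
      _ ≤ 4 / (h1 * h2) * traceMu (κ * h1) * traceMu (κ * h2) * cornerBound κ h1 h2 u c (2 * n) :=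
          cornerSum_pdM_le hκ hh1 hh2 hu c
      _ ≤ 4 / (h1 * h2) * traceMu (κ * h1) * traceMu (κ * h2) * sobNormSq κ K Ω u := by
          have := (traceMu_pos (κ * h1)).le
          have := (traceMu_pos (κ * h2)).le
          have := (cornerBound_le hκ (h1 := h1) (h2 := h2) (u := u) (c := c) hn).trans
            (sum_cell_le hκ hh1 hh2 hT hmem hKL le_rfl hc)
          gcongr
      _ ≤ 4 * (meshRho h1 h2 / meshH h1 h2 ^ 2) * (9 / 8 * max 1 (κ * meshH h1 h2) ^ 2) *
            (9 / 8 * max 1 (κ * meshH h1 h2) ^ 2) * sobNormSq κ K Ω u := by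
          have := (traceMu_pos (κ * h2)).le
          rw [meshRho_div_sq hh1 hh2, mul_one_div]
          exact mul_le_mul_of_nonneg_right (mul_le_mul (mul_le_mul_of_nonneg_left m1 (by positivity))
            m2 this (by positivity)) hS
      _ = 1 * (meshRho h1 h2 * ((81 / 16) * max 1 (κ * meshH h1 h2) ^ 4 / meshH h1 h2 ^ 2 *
            sobNormSq κ K Ω u)) := by field_simp; ring
      _ ≤ meshRho h1 h2 * (meshRho h1 h2 * ((81 / 16) * max 1 (κ * meshH h1 h2) ^ 4 / meshH h1 h2 ^ 2 *
            sobNormSq κ K Ω u)) := by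
          exact mul_le_mul_of_nonneg_right hρ (by positivity)
      _ = _ := by
          rw [mul_pow _ (sobNorm κ K Ω u), sobNorm, Real.sq_sqrt hS]
          ring
  exact (pow_le_pow_iff_left₀ (norm_nonneg _) (by rw [sobNorm]; positivity) two_ne_zero).1 key

lemma norm_nodeCoef_le {κ h1 h2 : ℝ} (hκ : 0 < κ) (hh1 : 0 < h1) (hh2 : 0 < h2)
    (hA : A2cond κ h1 h2) {cells : Finset (ℤ × ℤ)} {Ω : Set (ℝ × ℝ)}
    (hT : IsTessellation h1 h2 cells Ω) {L K N : ℕ} {u : ℝ × ℝ → ℂ}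
    (hreg : ContDiff ℝ (L : ℕ) u) (hmem : MemSob L Ω u) (hKL : K ≤ L) (hNK : 2 * N ≤ K)
    {β : {p : ℤ × ℤ // p ∈ meshNodes cells} × Fin N → ℂ}
    (hβ : CollocationSystem κ h1 h2 cells N u β) (q : ℤ × ℤ) (m : ℕ) :
    ‖nodeCoef β q m‖ ≤ 3 * meshRho h1 h2 * max 1 (κ * meshH h1 h2) ^ 2 / meshH h1 h2 *
      chiN (meshRho h1 h2) (κ * meshH h1 h2) N * sobNorm κ K Ω u := by
  have hρ := one_le_meshRho hh1 hh2
  have hh := meshH_pos (h2 := h2) hh1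
  have hn : 0 ≤ sobNorm κ K Ω u := Real.sqrt_nonneg _
  have hχ := min_growth_le_chiN hκ hh1 hh2 N
  have hχ0 : 0 ≤ chiN (meshRho h1 h2) (κ * meshH h1 h2) N := by rw [chiN]; positivity
  by_cases hqm : q ∈ meshNodes cells ∧ m < N
  swap
  · rw [nodeCoef, dif_neg hqm, norm_zero]; positivity
  obtain ⟨hq, hm⟩ := hqm
  rw [nodeCoef_eq_sum hκ hh1 hh2 hA hβ hq hm]
  set l := 4 * (κ * h1) ^ 2 / π ^ 2 with hl
  have hl0 : 0 ≤ l := by positivity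
  set D := 9 / 4 * max 1 (κ * meshH h1 h2) ^ 2 * meshRho h1 h2 / meshH h1 h2 * sobNorm κ K Ω u with hD
  have hD0 : 0 ≤ D := by positivity
  calc ‖∑ n ∈ Finset.range N, ((oddWeight N m * oddE l ((Finset.range N).erase m) n : ℝ) : ℂ) *
        nodeDatum κ h1 h2 u q n‖
      ≤ ∑ n ∈ Finset.range N, |oddWeight N m| * (oddE l ((Finset.range N).erase m) n * 1 ^ n) * D := by
        refine (norm_sum_le _ _).trans (Finset.sum_le_sum fun n hn' => ?_)
        rw [norm_mul, Complex.norm_real, Real.norm_eq_abs, abs_mul, abs_of_nonneg (oddE_nonneg hl0 _ _),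
          one_pow, mul_one]
        have := oddE_nonneg hl0 ((Finset.range N).erase m) n
        exact mul_le_mul_of_nonneg_left (norm_nodeDatum_le hκ hh1 hh2 hT hreg hmem hKL hq
          (by have := Finset.mem_range.1 hn'; omega)) (by positivity)
    _ = (|oddWeight N m| * ∏ j ∈ (Finset.range N).erase m, (1 + l / (2 * j + 1) ^ 2)) * D := by
        rw [← Finset.sum_mul, ← Finset.mul_sum, sum_oddE_mul_pow l hm]
        simp only [mul_one]
    _ ≤ 4 / 3 * chiN (meshRho h1 h2) (κ * meshH h1 h2) N * D := by
        have := abs_oddWeight_mul_prod_le (mul_pos hκ hh1) hm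
        rw [← hl] at this
        exact mul_le_mul_of_nonneg_right (this.trans (by linarith)) hD0
    _ = _ := by rw [hD]; ring

lemma sqrt_sum_norm_sq_le {cells : Finset (ℤ × ℤ)} {N : ℕ}
    (β : {p : ℤ × ℤ // p ∈ meshNodes cells} × Fin N → ℂ) {B : ℝ}
    (hB : ∀ q m, ‖nodeCoef β q m‖ ≤ B) :
    Real.sqrt (∑ i : {p : ℤ × ℤ // p ∈ meshNodes cells} × Fin N, ‖β i‖ ^ 2) ≤
      B * Real.sqrt (((meshNodes cells).card : ℝ) * (N : ℝ)) := by
  have hB0 : 0 ≤ B := (norm_nonneg _).trans (hB (0, 0) 0)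
  have h1 : ∑ i : {p : ℤ × ℤ // p ∈ meshNodes cells} × Fin N, ‖β i‖ ^ 2 ≤
      B ^ 2 * (((meshNodes cells).card : ℝ) * (N : ℝ)) := by
    calc _ ≤ ∑ _i : {p : ℤ × ℤ // p ∈ meshNodes cells} × Fin N, B ^ 2 := by
          refine Finset.sum_le_sum fun i _ => ?_
          have := hB i.1.1 i.2
          rw [norm_nodeCoef β i.1 i.2] at this
          gcongr
      _ = _ := by
          rw [Finset.sum_const, Finset.card_univ, nsmul_eq_mul]
          simp [Fintype.card_prod]
          ring
  calc _ ≤ Real.sqrt (B ^ 2 * (((meshNodes cells).card : ℝ) * (N : ℝ))) := Real.sqrt_le_sqrt h1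
    _ = _ := by rw [Real.sqrt_mul (by positivity), Real.sqrt_sq hB0]

lemma integral_shift {E : Type*} [NormedAddCommGroup E] [NormedSpace ℝ E] (a h : ℝ) (F : ℝ → E) :
    ∫ t in (0 : ℝ)..h, F (a + t) = ∫ t in a..(a + h), F t := by
  rw [intervalIntegral.integral_comp_add_left, add_zero]

lemma cell_row_le {κ h1 h2 : ℝ} (hκ : 0 < κ) (hh1 : 0 < h1) (hh2 : 0 < h2) (c : ℤ × ℤ)
    {v v2 : ℝ × ℝ → ℂ} (hv : Continuous v) (hv2 : Continuous v2)
    (hd : ∀ t s, HasDerivAt (fun s => v (t, s)) (v2 (t, s)) s) :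
    (∫ t in (0 : ℝ)..h1, ‖v (c.1 * h1 + t, c.2 * h2)‖ ^ 2) +
        ∫ t in (0 : ℝ)..h1, ‖v (c.1 * h1 + t, (c.2 + 1 : ℤ) * h2)‖ ^ 2 ≤
      2 / h2 * traceMu (κ * h2) *
        (rectSq (c.1 * h1) ((c.1 + 1) * h1) (c.2 * h2) ((c.2 + 1) * h2) v +
          2 / 3 * (κ ^ 2)⁻¹ * rectSq (c.1 * h1) ((c.1 + 1) * h1) (c.2 * h2) ((c.2 + 1) * h2) v2) := by
  have h := row_trace_le hκ (a := c.1 * h1) (b := (c.1 + 1) * h1) (c := c.2 * h2)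
    (d := (c.2 + 1) * h2) (by nlinarith) (by nlinarith) hv hv2 hd
  rw [show ((c.2 : ℝ) + 1) * h2 - c.2 * h2 = h2 by ring] at h
  rw [integral_shift (c.1 * h1) h1 fun t => ‖v (t, c.2 * h2)‖ ^ 2,
    integral_shift (c.1 * h1) h1 fun t => ‖v (t, (c.2 + 1 : ℤ) * h2)‖ ^ 2,
    show (c.1 : ℝ) * h1 + h1 = (c.1 + 1) * h1 by ring]
  push_cast
  exact h

lemma cell_col_le {κ h1 h2 : ℝ} (hκ : 0 < κ) (hh1 : 0 < h1) (hh2 : 0 < h2) (c : ℤ × ℤ)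
    {v v1 : ℝ × ℝ → ℂ} (hv : Continuous v) (hv1 : Continuous v1)
    (hd : ∀ t s, HasDerivAt (fun t => v (t, s)) (v1 (t, s)) t) :
    (∫ s in (0 : ℝ)..h2, ‖v (c.1 * h1, c.2 * h2 + s)‖ ^ 2) +
        ∫ s in (0 : ℝ)..h2, ‖v ((c.1 + 1 : ℤ) * h1, c.2 * h2 + s)‖ ^ 2 ≤
      2 / h1 * traceMu (κ * h1) *
        (rectSq (c.1 * h1) ((c.1 + 1) * h1) (c.2 * h2) ((c.2 + 1) * h2) v +
          2 / 3 * (κ ^ 2)⁻¹ * rectSq (c.1 * h1) ((c.1 + 1) * h1) (c.2 * h2) ((c.2 + 1) * h2) v1) := by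
  have h := side_trace_le hκ (a := c.1 * h1) (b := (c.1 + 1) * h1) (c := c.2 * h2)
    (d := (c.2 + 1) * h2) (by nlinarith) (by nlinarith) hv hv1 hd
  rw [show ((c.1 : ℝ) + 1) * h1 - c.1 * h1 = h1 by ring] at h
  rw [integral_shift (c.2 * h2) h2 fun s => ‖v (c.1 * h1, s)‖ ^ 2,
    integral_shift (c.2 * h2) h2 fun s => ‖v ((c.1 + 1 : ℤ) * h1, s)‖ ^ 2,
    show (c.2 : ℝ) * h2 + h2 = (c.2 + 1) * h2 by ring]
  push_cast
  exact h

lemma cell_row_pdM_le {κ h1 h2 : ℝ} (hκ : 0 < κ) (hh1 : 0 < h1) (hh2 : 0 < h2) (c : ℤ × ℤ)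
    {u : ℝ × ℝ → ℂ} {i : ℕ} (hu : ContDiff ℝ (i + 1 : ℕ) u) :
    (κ ^ (2 * i))⁻¹ * ((∫ t in (0 : ℝ)..h1, ‖pdM i 0 u (c.1 * h1 + t, c.2 * h2)‖ ^ 2) +
        ∫ t in (0 : ℝ)..h1, ‖pdM i 0 u (c.1 * h1 + t, (c.2 + 1 : ℤ) * h2)‖ ^ 2) ≤
      2 / h2 * traceMu (κ * h2) *
        (cellTerm κ h1 h2 u c i 0 + 2 / 3 * cellTerm κ h1 h2 u c i 1) := by
  have hu0 : ContDiff ℝ (i : ℕ) u := hu.of_le (by norm_cast; omega)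
  have h := mul_le_mul_of_nonneg_left (cell_row_le hκ hh1 hh2 c (continuous_pdM_zero hu0)
    (continuous_pdM_one hu) (hasDerivAt_pdM_snd hu)) (show 0 ≤ (κ ^ (2 * i))⁻¹ by positivity)
  refine h.trans_eq ?_
  simp only [cellTerm]
  rw [show (κ ^ (2 * (i + 1)))⁻¹ = (κ ^ (2 * i))⁻¹ * (κ ^ 2)⁻¹ by rw [← mul_inv, ← pow_add]; rfl,
    add_zero]
  ring

lemma cell_col_pdM_le {κ h1 h2 : ℝ} (hκ : 0 < κ) (hh1 : 0 < h1) (hh2 : 0 < h2) (c : ℤ × ℤ)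
    {u : ℝ × ℝ → ℂ} (hu : ContDiff ℝ (1 : ℕ) u) :
    (∫ s in (0 : ℝ)..h2, ‖u (c.1 * h1, c.2 * h2 + s)‖ ^ 2) +
        ∫ s in (0 : ℝ)..h2, ‖u ((c.1 + 1 : ℤ) * h1, c.2 * h2 + s)‖ ^ 2 ≤
      2 / h1 * traceMu (κ * h1) *
        (cellTerm κ h1 h2 u c 0 0 + 2 / 3 * cellTerm κ h1 h2 u c 1 0) := by
  have h := cell_col_le hκ hh1 hh2 c hu.continuous (continuous_pdM_zero (i := 1) hu)
    (hasDerivAt_pdM_fst (i := 0) hu)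
  refine h.trans_eq ?_
  simp only [cellTerm, pdM_zero_zero, mul_zero, add_zero, pow_zero, inv_one, mul_one,
    one_mul]
  ring

lemma cell_col_pdM_one_le {κ h1 h2 : ℝ} (hκ : 0 < κ) (hh1 : 0 < h1) (hh2 : 0 < h2) (c : ℤ × ℤ)
    {u : ℝ × ℝ → ℂ} (hu : ContDiff ℝ (2 : ℕ) u) :
    (κ ^ 2)⁻¹ * ((∫ s in (0 : ℝ)..h2, ‖pdM 0 1 u (c.1 * h1, c.2 * h2 + s)‖ ^ 2) +
        ∫ s in (0 : ℝ)..h2, ‖pdM 0 1 u ((c.1 + 1 : ℤ) * h1, c.2 * h2 + s)‖ ^ 2) ≤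
      2 / h1 * traceMu (κ * h1) *
        (cellTerm κ h1 h2 u c 0 1 + 2 / 3 * cellTerm κ h1 h2 u c 1 1) := by
  have hu1 : ContDiff ℝ (1 : ℕ) u := hu.of_le (by norm_cast)
  have hd : ∀ t s, HasDerivAt (fun t => pdM 0 1 u (t, s)) (pdM 1 1 u (t, s)) t := by
    have : Differentiable ℝ (pd2 u) := (contDiff_pd2 (n := 1) hu).differentiable (by simp)
    exact hasDerivAt_pd1 this
  have h := mul_le_mul_of_nonneg_left (cell_col_le hκ hh1 hh2 c (continuous_pdM_one (i := 0) hu1)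
    (continuous_pdM_one (i := 1) hu) hd) (show 0 ≤ (κ ^ 2)⁻¹ by positivity)
  refine h.trans_eq ?_
  simp only [cellTerm]
  rw [show (κ ^ (2 * (1 + 1)))⁻¹ = (κ ^ 2)⁻¹ * (κ ^ 2)⁻¹ by rw [← mul_inv, ← pow_add]]
  norm_num
  ring

/-- The scaled trace of `u` over all edges is controlled by its Sobolev norm. -/
lemma sum_edge_trace_le {κ h1 h2 : ℝ} (hκ : 0 < κ) (hh1 : 0 < h1) (hh2 : 0 < h2)
    {cells : Finset (ℤ × ℤ)} {Ω : Set (ℝ × ℝ)} (hT : IsTessellation h1 h2 cells Ω)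
    {L K : ℕ} {u : ℝ × ℝ → ℂ} (hreg : ContDiff ℝ (L : ℕ) u) (hmem : MemSob L Ω u) (hKL : K ≤ L)
    (hK : 2 ≤ K) :
    ∑ e ∈ hEdges cells, (2 / h1 * ∫ t in (0 : ℝ)..h1, ‖u (e.1 * h1 + t, e.2 * h2)‖ ^ 2) +
      ∑ e ∈ vEdges cells, (2 / h2 * ∫ s in (0 : ℝ)..h2, ‖u (e.1 * h1, e.2 * h2 + s)‖ ^ 2) ≤
      (4 * meshRho h1 h2 * max 1 (κ * meshH h1 h2) / meshH h1 h2 * sobNorm κ K Ω u) ^ 2 := by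
  have hu1 : ContDiff ℝ (1 : ℕ) u := hreg.of_le (by exact_mod_cast by omega)
  have hρ := one_le_meshRho hh1 hh2
  have hh := meshH_pos (h2 := h2) hh1
  have m1 := traceMu_mul_le hκ hh1 (le_max_left h1 h2)
  have m2 := traceMu_mul_le hκ hh2 (le_max_right h1 h2)
  have hS := sum_cellTerm_le hκ hh1 hh2 hT hmem hKL hK
  have hS0 : 0 ≤ sobNormSq κ K Ω u := (Finset.sum_nonneg fun c _ => Finset.sum_nonneg fun i _ =>
      add_nonneg (cellTerm_nonneg hκ _ _ _ _ _ _) (cellTerm_nonneg hκ _ _ _ _ _ _)).trans hS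
  have h_int : ∀ {b : ℝ} (F : ℝ → ℂ), 0 ≤ b → 0 ≤ ∫ t in (0 : ℝ)..b, ‖F t‖ ^ 2 := fun F hb =>
    intervalIntegral.integral_nonneg hb fun _ _ => by positivity
  refine (sum_edges_le cells
    (EH := fun e => 2 / h1 * ∫ t in (0 : ℝ)..h1, ‖u (e.1 * h1 + t, e.2 * h2)‖ ^ 2)
    (EV := fun e => 2 / h2 * ∫ s in (0 : ℝ)..h2, ‖u (e.1 * h1, e.2 * h2 + s)‖ ^ 2)
    (fun e => mul_nonneg (by positivity) (h_int _ hh1.le))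
    (fun e => mul_nonneg (by positivity) (h_int _ hh2.le))).trans ?_
  calc _ ≤ ∑ c ∈ cells, 16 * (max 1 (κ * meshH h1 h2) ^ 2 / (h1 * h2)) *
        ∑ i ∈ Finset.range 2, (cellTerm κ h1 h2 u c i 0 + cellTerm κ h1 h2 u c i 1) := by
        refine Finset.sum_le_sum fun c _ => ?_
        have r := cell_row_pdM_le hκ hh1 hh2 c (i := 0) hu1
        have s := cell_col_pdM_le hκ hh1 hh2 c hu1
        simp only [pdM_zero_zero, mul_zero, pow_zero, inv_one, one_mul] at r
        have t0 := fun i j => cellTerm_nonneg hκ h1 h2 u c i j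
        rw [Finset.sum_range_succ, Finset.sum_range_one]
        have r' := mul_le_mul_of_nonneg_left r (show 0 ≤ 2 / h1 by positivity)
        have s' := mul_le_mul_of_nonneg_left s (show 0 ≤ 2 / h2 by positivity)
        have q2 : 2 / h1 * (2 / h2 * traceMu (κ * h2) * (cellTerm κ h1 h2 u c 0 0 +
            2 / 3 * cellTerm κ h1 h2 u c 0 1)) ≤ 4 / (h1 * h2) * (9 / 8 * max 1 (κ * meshH h1 h2) ^ 2) *
            (cellTerm κ h1 h2 u c 0 0 + 2 / 3 * cellTerm κ h1 h2 u c 0 1) := by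
          have := mul_le_mul_of_nonneg_right (mul_le_mul_of_nonneg_left m2
            (show 0 ≤ 4 / (h1 * h2) by positivity)) (show 0 ≤ cellTerm κ h1 h2 u c 0 0 +
              2 / 3 * cellTerm κ h1 h2 u c 0 1 by linarith [t0 0 0, t0 0 1])
          refine le_trans (le_of_eq ?_) this
          field_simp; ring
        have q1 : 2 / h2 * (2 / h1 * traceMu (κ * h1) * (cellTerm κ h1 h2 u c 0 0 +
            2 / 3 * cellTerm κ h1 h2 u c 1 0)) ≤ 4 / (h1 * h2) * (9 / 8 * max 1 (κ * meshH h1 h2) ^ 2) *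
            (cellTerm κ h1 h2 u c 0 0 + 2 / 3 * cellTerm κ h1 h2 u c 1 0) := by
          have := mul_le_mul_of_nonneg_right (mul_le_mul_of_nonneg_left m1
            (show 0 ≤ 4 / (h1 * h2) by positivity)) (show 0 ≤ cellTerm κ h1 h2 u c 0 0 +
              2 / 3 * cellTerm κ h1 h2 u c 1 0 by linarith [t0 0 0, t0 1 0])
          refine le_trans (le_of_eq ?_) this
          field_simp; ring
        rw [mul_add] at r' s'
        refine (add_le_add (r'.trans q2) (s'.trans q1)).trans ?_
        have e : ∀ z : ℝ, 4 / (h1 * h2) * (9 / 8 * max 1 (κ * meshH h1 h2) ^ 2) * z =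
            max 1 (κ * meshH h1 h2) ^ 2 / (h1 * h2) * (9 / 2 * z) := fun z => by ring
        rw [e, e, ← mul_add, mul_comm (16 : ℝ), mul_assoc]
        refine mul_le_mul_of_nonneg_left ?_ (by positivity)
        linarith [t0 0 0, t0 0 1, t0 1 0, t0 1 1]
    _ ≤ 16 * (max 1 (κ * meshH h1 h2) ^ 2 / (h1 * h2)) * sobNormSq κ K Ω u := by
        rw [← Finset.mul_sum]
        exact mul_le_mul_of_nonneg_left hS (by positivity)
    _ = 1 * (16 * (max 1 (κ * meshH h1 h2) ^ 2 * (meshRho h1 h2 / meshH h1 h2 ^ 2)) *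
        sobNormSq κ K Ω u) := by
        rw [meshRho_div_sq hh1 hh2]; ring
    _ ≤ meshRho h1 h2 * (16 * (max 1 (κ * meshH h1 h2) ^ 2 * (meshRho h1 h2 / meshH h1 h2 ^ 2)) *
        sobNormSq κ K Ω u) := mul_le_mul_of_nonneg_right hρ (by positivity)
    _ = _ := by
        rw [mul_pow _ (sobNorm κ K Ω u), sobNorm, Real.sq_sqrt hS0]; ring

lemma nuHat_odd_eq_nuTil (κ h1 : ℝ) (k : ℕ) :
    nuHat κ (2 * h1) (2 * k + 1) = nuTil κ h1 (k + 1) := by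
  unfold nuHat nuTil
  push_cast
  rw [show κ * (2 * h1) = 2 * (κ * h1) by ring, show 2 * ((k : ℝ) + 1) - 1 = 2 * k + 1 by ring]

lemma dTil_le {κ h1 h2 : ℝ} {k : ℕ} (hk : nuTil κ h1 (k + 1) < 1) (m : ℕ) :
    dTil κ h1 h2 ≤ |Real.sqrt (1 - nuTil κ h1 (k + 1) ^ 2) - m * π / (κ * h2)| :=
  csInf_le ⟨0, by rintro d ⟨n, -, -, m, rfl⟩; exact abs_nonneg _⟩
    ⟨k + 1, by omega, hk, m, rfl⟩

lemma nuTil_pos {κ h1 : ℝ} (hκ : 0 < κ) (hh1 : 0 < h1) (k : ℕ) : 0 < nuTil κ h1 (k + 1) := by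
  rw [nuTil]
  push_cast
  rw [show 2 * ((k : ℝ) + 1) - 1 = 2 * k + 1 by ring]
  positivity

lemma abs_sin_sub_nat_mul_pi (z : ℝ) (m : ℕ) : |Real.sin (z - m * π)| = |Real.sin z| := by
  rw [Real.sin_sub_nat_mul_pi, abs_mul, abs_pow, abs_neg, abs_one, one_pow, one_mul]

lemma exists_pos_forall_lt_le (f : ℕ → ℝ) (P : ℕ → Prop) (hf : ∀ k, P k → 0 < f k) (K : ℕ) :
    ∃ ε, 0 < ε ∧ ∀ k < K, P k → ε ≤ f k := by
  induction K with
  | zero => exact ⟨1, one_pos, by simp⟩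
  | succ K ih =>
    obtain ⟨ε, h0, h⟩ := ih
    by_cases hK : P K
    · refine ⟨min ε (f K), lt_min h0 (hf K hK), fun k hk hP => ?_⟩
      rcases Nat.lt_succ_iff_lt_or_eq.1 hk with h' | rfl
      · exact (min_le_left _ _).trans (h k h' hP)
      · exact min_le_right _ _
    · refine ⟨ε, h0, fun k hk hP => ?_⟩
      rcases Nat.lt_succ_iff_lt_or_eq.1 hk with h' | rfl
      · exact h k h' hP
      · exact absurd hP hK

/-- If some node mode propagates, the resonance distance is positive. -/
lemma dTil_pos {κ h1 h2 : ℝ} (hκ : 0 < κ) (hh1 : 0 < h1) (hh2 : 0 < h2) (hA : A2cond κ h1 h2)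
    (hν : nuTil κ h1 1 < 1) : 0 < dTil κ h1 h2 := by
  set x := κ * h2 with hx
  have hx0 : 0 < x := by positivity
  set θ : ℕ → ℝ := fun k => Real.sqrt (1 - nuTil κ h1 (k + 1) ^ 2) with hθ
  obtain ⟨ε, hε, h⟩ := exists_pos_forall_lt_le (fun k => |Real.sin (x * θ k)|)
    (fun k => nuTil κ h1 (k + 1) < 1) (fun k hk => by
      have h1 := sin_vertical_ne_zero hκ hh2 hA (2 * k + 1) (by
        rw [nuHat_odd_eq_nuTil]
        nlinarith [nuTil_pos hκ hh1 k])
      rw [nuHat_odd_eq_nuTil] at h1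
      rw [hx, mul_comm κ h2]
      exact abs_pos.2 h1) (⌈κ * h1⌉₊)
  have hle : ε / x ≤ dTil κ h1 h2 := by
    refine le_csInf ⟨_, 1, le_rfl, hν, 0, rfl⟩ ?_
    rintro d ⟨n, hn, hn1, m, rfl⟩
    obtain ⟨k, rfl⟩ : ∃ k, n = k + 1 := ⟨n - 1, by omega⟩
    have hk : k < ⌈κ * h1⌉₊ := by
      rw [Nat.lt_ceil]
      rw [nuTil, div_lt_one (by positivity)] at hn1
      push_cast at hn1
      nlinarith [pi_gt_three]
    have h3 := (h k hk hn1).trans_eq (abs_sin_sub_nat_mul_pi (x * θ k) m).symm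
    rw [div_le_iff₀ hx0]
    refine h3.trans ((Real.abs_sin_le_abs).trans_eq ?_)
    rw [← abs_of_pos hx0, ← abs_mul, abs_of_pos hx0, sub_mul, div_mul_cancel₀ _ hx0.ne', mul_comm x]
  exact lt_of_lt_of_le (by positivity) hle

lemma le_abs_sin_vertical {κ h1 h2 : ℝ} (hκ : 0 < κ) (hh2 : 0 < h2) {k : ℕ}
    (hk : nuTil κ h1 (k + 1) < 1) :
    2 / π * (κ * h2 * dTil κ h1 h2) ≤
      |Real.sin (h2 * κ * Real.sqrt (1 - nuTil κ h1 (k + 1) ^ 2))| := by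
  set θ := Real.sqrt (1 - nuTil κ h1 (k + 1) ^ 2) with hθ
  have hθ0 : 0 ≤ θ := Real.sqrt_nonneg _
  set m := ⌊h2 * κ * θ / π + 1 / 2⌋₊ with hm
  have h1' : (m : ℝ) ≤ h2 * κ * θ / π + 1 / 2 := Nat.floor_le (by positivity)
  have h2' : h2 * κ * θ / π + 1 / 2 < m + 1 := Nat.lt_floor_add_one _
  have e : h2 * κ * θ / π * π = h2 * κ * θ := by field_simp
  have hb : |h2 * κ * θ - m * π| ≤ π / 2 := by
    rw [abs_le]
    constructor <;> nlinarith [pi_pos]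
  rw [← abs_sin_sub_nat_mul_pi _ m]
  refine le_trans ?_ (Real.mul_abs_le_abs_sin hb)
  refine mul_le_mul_of_nonneg_left ?_ (by positivity)
  have h4 := mul_le_mul_of_nonneg_left (dTil_le (h2 := h2) hk m) (show 0 ≤ κ * h2 by positivity)
  refine h4.trans_eq ?_
  rw [← abs_of_pos (show 0 < κ * h2 by positivity), ← abs_mul,
    abs_of_pos (show 0 < κ * h2 by positivity)]
  congr 1
  field_simp
  rfl

lemma one_le_colMode_bound {κ h1 h2 : ℝ} (hκ : 0 < κ) (hh1 : 0 < h1) (hh2 : 0 < h2)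
    (hA : A2cond κ h1 h2) (hν : nuTil κ h1 1 < 1) : 1 ≤ π / (2 * (κ * h2 * dTil κ h1 h2)) := by
  have hd := dTil_pos hκ hh1 hh2 hA hν
  rw [le_div_iff₀ (by positivity), one_mul]
  have h := (le_abs_sin_vertical (k := 0) hκ hh2 hν).trans (Real.abs_sin_le_one _)
  rw [div_mul_eq_mul_div, div_le_one pi_pos] at h
  exact h

lemma abs_colMode_le {κ h1 h2 : ℝ} (hκ : 0 < κ) (hh1 : 0 < h1) (hh2 : 0 < h2)
    (hA : A2cond κ h1 h2) (hν : nuTil κ h1 1 < 1) (k : ℕ) {s : ℝ} (hs : s ∈ Icc 0 h2) :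
    |colMode κ h1 h2 k s| ≤ π / (2 * (κ * h2 * dTil κ h1 h2)) := by
  have hd := dTil_pos hκ hh1 hh2 hA hν
  have h0 := nuTil_pos hκ hh1 k
  rw [colMode, vertRatio, nuHat_odd_eq_nuTil]
  split_ifs with hr
  · have hne := sin_vertical_ne_zero hκ hh2 hA (2 * k + 1) (by rwa [nuHat_odd_eq_nuTil])
    rw [nuHat_odd_eq_nuTil] at hne
    have hk : nuTil κ h1 (k + 1) < 1 := by
      refine lt_of_le_of_ne (by nlinarith) fun h => hne ?_
      rw [h]; norm_num
    have hl := le_abs_sin_vertical (h2 := h2) hκ hh2 hk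
    rw [abs_div]
    calc _ ≤ 1 / (2 / π * (κ * h2 * dTil κ h1 h2)) :=
          div_le_div₀ zero_le_one (Real.abs_sin_le_one _) (by positivity) hl
      _ = _ := by field_simp
  · refine le_trans ?_ (one_le_colMode_bound hκ hh1 hh2 hA hν)
    have hq : 0 < Real.sqrt (-(1 - nuTil κ h1 (k + 1) ^ 2)) := Real.sqrt_pos.2 (by linarith)
    have hp : 0 < Real.sinh (h2 * κ * Real.sqrt (-(1 - nuTil κ h1 (k + 1) ^ 2))) :=
      Real.sinh_pos_iff.2 (by positivity)
    have hs0 := hs.1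
    rw [abs_div, abs_of_pos hp, div_le_one hp, abs_of_nonneg (Real.sinh_nonneg_iff.2 (by positivity)),
      Real.sinh_le_sinh]
    have := hs.2
    gcongr

lemma norm_pair_sum_le {cells : Finset (ℤ × ℤ)} {N : ℕ}
    (β : {p : ℤ × ℤ // p ∈ meshNodes cells} × Fin N → ℂ) {B C : ℝ}
    (hB : ∀ q m, ‖nodeCoef β q m‖ ≤ B) (p q : ℤ × ℤ) {f g : ℕ → ℝ}
    (hf : ∀ m, |f m| ≤ C) (hg : ∀ m, |g m| ≤ C) :
    ‖(∑ m ∈ Finset.range N, nodeCoef β p m * (f m : ℂ)) +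
      ∑ m ∈ Finset.range N, nodeCoef β q m * (g m : ℂ)‖ ≤ 2 * N * B * C := by
  have hB0 : 0 ≤ B := (norm_nonneg _).trans (hB (0, 0) 0)
  have key : ∀ (p : ℤ × ℤ) (f : ℕ → ℝ), (∀ m, |f m| ≤ C) →
      ‖∑ m ∈ Finset.range N, nodeCoef β p m * (f m : ℂ)‖ ≤ N * (B * C) := fun p f hf => by
    calc _ ≤ ∑ _m ∈ Finset.range N, B * C := norm_sum_le_of_le _ fun m _ => by
          rw [norm_mul, Complex.norm_real]
          exact mul_le_mul (hB p m) (hf m) (norm_nonneg _) hB0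
      _ = N * (B * C) := by simp
  refine (norm_add_le _ _).trans ?_
  linarith [key p f hf, key q g hg]

lemma norm_sub_sq_le_young {a b : ℂ} {η D : ℝ} (hη : 0 < η) (hb : ‖b‖ ≤ D) :
    ‖a - b‖ ^ 2 ≤ (1 + η) * ‖a‖ ^ 2 + (1 + 1 / η) * D ^ 2 := by
  have h1 : ‖a - b‖ ^ 2 ≤ (‖a‖ + D) ^ 2 :=
    pow_le_pow_left₀ (norm_nonneg _) ((norm_sub_le _ _).trans (by linarith)) 2
  have h2 : 0 ≤ 1 / η * (η * ‖a‖ - D) ^ 2 := by positivity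
  have h3 : 1 / η * (η * ‖a‖ - D) ^ 2 = η * ‖a‖ ^ 2 - 2 * ‖a‖ * D + 1 / η * D ^ 2 := by
    field_simp; ring
  nlinarith

lemma scaled_integral_norm_sub_sq_le {h η D : ℝ} (hh : 0 < h) (hη : 0 < η) {f g : ℝ → ℂ}
    (hf : Continuous f) (hg : Continuous g) (hD : ∀ t ∈ Icc 0 h, ‖g t‖ ≤ D) :
    2 / h * ∫ t in (0 : ℝ)..h, ‖f t - g t‖ ^ 2 ≤
      (1 + η) * (2 / h * ∫ t in (0 : ℝ)..h, ‖f t‖ ^ 2) + (1 + 1 / η) * (2 * D ^ 2) := by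
  have h1 : ∫ t in (0 : ℝ)..h, ‖f t - g t‖ ^ 2 ≤
      ∫ t in (0 : ℝ)..h, ((1 + η) * ‖f t‖ ^ 2 + (1 + 1 / η) * D ^ 2) :=
    intervalIntegral.integral_mono_on hh.le
      ((by fun_prop : Continuous fun t => ‖f t - g t‖ ^ 2).intervalIntegrable _ _)
      ((by fun_prop : Continuous fun t =>
        (1 + η) * ‖f t‖ ^ 2 + (1 + 1 / η) * D ^ 2).intervalIntegrable _ _)
      fun t ht => norm_sub_sq_le_young hη (hD t ht)
  rw [intervalIntegral.integral_add ((by fun_prop : Continuous fun t => (1 + η) * ‖f t‖ ^ 2).intervalIntegrable _ _)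
    (by simp), intervalIntegral.integral_const_mul, intervalIntegral.integral_const, sub_zero,
    smul_eq_mul] at h1
  refine (mul_le_mul_of_nonneg_left h1 (show 0 ≤ 2 / h by positivity)).trans_eq ?_
  field_simp

lemma sqrt_le_add_of_young {T a b : ℝ} (ha : 0 ≤ a) (hb : 0 ≤ b)
    (h : ∀ η : ℝ, 0 < η → T ≤ (1 + η) * a ^ 2 + (1 + 1 / η) * b ^ 2) : Real.sqrt T ≤ a + b := by
  refine le_of_forall_pos_le_add fun ε hε => Real.sqrt_le_iff.2 ⟨by positivity, ?_⟩
  have ha' : 0 < a + ε / 2 := by positivity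
  have hb' : 0 < b + ε / 2 := by positivity
  have hη : 0 < (b + ε / 2) / (a + ε / 2) := by positivity
  have h1 := h _ hη
  calc T ≤ (1 + (b + ε / 2) / (a + ε / 2)) * (a + ε / 2) ^ 2 +
        (1 + 1 / ((b + ε / 2) / (a + ε / 2))) * (b + ε / 2) ^ 2 := by
        refine h1.trans (add_le_add ?_ ?_) <;> gcongr <;> linarith
    _ = (a + b + ε) ^ 2 := by field_simp; ring

lemma card_hEdges_le (cells : Finset (ℤ × ℤ)) : (hEdges cells).card ≤ (meshNodes cells).card :=
  Finset.card_le_card fun x hx => by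
    simp only [hEdges, meshNodes, Finset.mem_union] at hx ⊢; tauto

lemma card_vEdges_le (cells : Finset (ℤ × ℤ)) : (vEdges cells).card ≤ (meshNodes cells).card :=
  Finset.card_le_card fun x hx => by
    simp only [vEdges, meshNodes, Finset.mem_union] at hx ⊢; tauto

/-- Bound for the edge remainders when some node mode propagates. -/
lemma sqrt_sum_edge_remainders_le {κ h1 h2 : ℝ} (hκ : 0 < κ) (hh1 : 0 < h1) (hh2 : 0 < h2)
    (hA2 : A2cond κ h1 h2) (hν : nuTil κ h1 1 < 1) {cells : Finset (ℤ × ℤ)} {N : ℕ}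
    {u : ℝ × ℝ → ℂ} (hu : Continuous u) (β : {p : ℤ × ℤ // p ∈ meshNodes cells} × Fin N → ℂ)
    {A B : ℝ} (hA0 : 0 ≤ A) (hB : ∀ q m, ‖nodeCoef β q m‖ ≤ B)
    (hA : ∑ e ∈ hEdges cells, (2 / h1 * ∫ t in (0 : ℝ)..h1, ‖u (e.1 * h1 + t, e.2 * h2)‖ ^ 2) +
      ∑ e ∈ vEdges cells, (2 / h2 * ∫ s in (0 : ℝ)..h2, ‖u (e.1 * h1, e.2 * h2 + s)‖ ^ 2) ≤ A ^ 2) :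
    Real.sqrt (∑ e ∈ hEdges cells, (2 / h1 * ∫ t in (0 : ℝ)..h1, ‖rowRem h1 h2 u β e t‖ ^ 2) +
      ∑ e ∈ vEdges cells, (2 / h2 * ∫ s in (0 : ℝ)..h2, ‖colRem κ h1 h2 u β e s‖ ^ 2)) ≤
      A + 2 * Real.sqrt (meshNodes cells).card *
        (2 * N * B * (π / (2 * (κ * h2 * dTil κ h1 h2)))) := by
  have hB0 : 0 ≤ B := (norm_nonneg _).trans (hB (0, 0) 0)
  have hC1 := one_le_colMode_bound hκ hh1 hh2 hA2 hν
  set C := π / (2 * (κ * h2 * dTil κ h1 h2)) with hC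
  set D := 2 * N * B * C with hD
  have hD0 : 0 ≤ D := by positivity
  refine sqrt_le_add_of_young hA0 (by positivity) fun η hη => ?_
  have hc := fun k => continuous_colMode κ h1 h2 k
  have row : ∀ e : ℤ × ℤ, 2 / h1 * ∫ t in (0 : ℝ)..h1, ‖rowRem h1 h2 u β e t‖ ^ 2 ≤
      (1 + η) * (2 / h1 * ∫ t in (0 : ℝ)..h1, ‖u (e.1 * h1 + t, e.2 * h2)‖ ^ 2) +
        (1 + 1 / η) * (2 * D ^ 2) := fun e => by
    refine scaled_integral_norm_sub_sq_le hh1 hη (by fun_prop) (by fun_prop) fun t _ => ?_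
    exact norm_pair_sum_le β hB _ _ (fun m => (Real.abs_cos_le_one _).trans hC1)
      (fun m => (Real.abs_cos_le_one _).trans hC1)
  have col : ∀ e : ℤ × ℤ, 2 / h2 * ∫ s in (0 : ℝ)..h2, ‖colRem κ h1 h2 u β e s‖ ^ 2 ≤
      (1 + η) * (2 / h2 * ∫ s in (0 : ℝ)..h2, ‖u (e.1 * h1, e.2 * h2 + s)‖ ^ 2) +
        (1 + 1 / η) * (2 * D ^ 2) := fun e => by
    refine scaled_integral_norm_sub_sq_le hh2 hη (by fun_prop) (by fun_prop) fun s hs => ?_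
    exact norm_pair_sum_le β hB _ _
      (fun m => abs_colMode_le hκ hh1 hh2 hA2 hν m ⟨by linarith [hs.2], by linarith [hs.1]⟩)
      (fun m => abs_colMode_le hκ hh1 hh2 hA2 hν m hs)
  have s1 := (Finset.sum_le_sum fun e (_ : e ∈ hEdges cells) => row e).trans_eq
    (by rw [Finset.sum_add_distrib, ← Finset.mul_sum, Finset.sum_const, nsmul_eq_mul])
  have s2 := (Finset.sum_le_sum fun e (_ : e ∈ vEdges cells) => col e).trans_eq
    (by rw [Finset.sum_add_distrib, ← Finset.mul_sum, Finset.sum_const, nsmul_eq_mul])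
  have c1 : ((hEdges cells).card : ℝ) ≤ (meshNodes cells).card := by exact_mod_cast card_hEdges_le _
  have c2 : ((vEdges cells).card : ℝ) ≤ (meshNodes cells).card := by exact_mod_cast card_vEdges_le _
  have hE : 0 ≤ (1 + 1 / η) * (2 * D ^ 2) := by positivity
  have t1 := mul_le_mul_of_nonneg_right c1 hE
  have t2 := mul_le_mul_of_nonneg_right c2 hE
  have t3 := mul_le_mul_of_nonneg_left hA (show 0 ≤ 1 + η by positivity)
  rw [mul_add] at t3
  have e : (1 + 1 / η) * (2 * Real.sqrt (meshNodes cells).card * D) ^ 2 =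
      2 * ((meshNodes cells).card * ((1 + 1 / η) * (2 * D ^ 2))) := by
    rw [mul_pow, mul_pow, Real.sq_sqrt (Nat.cast_nonneg _)]; ring
  rw [e]
  linarith

/-- The contribution of the data `d 1, d 2, …` to the `m`-th solution of the odd system. -/
def hiCoef (l : ℝ) (N : ℕ) (d : ℕ → ℂ) (m : ℕ) : ℂ :=
  ∑ n ∈ Finset.range (N - 1),
    ((oddWeight N m * oddE l ((Finset.range N).erase m) (n + 1) : ℝ) : ℂ) * d (n + 1)

lemma sum_oddWeight_mul_eq_add_hiCoef (l : ℝ) {N : ℕ} (hN : 0 < N) (d : ℕ → ℂ) (m : ℕ) :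
    ∑ n ∈ Finset.range N,
      ((oddWeight N m * oddE l ((Finset.range N).erase m) n : ℝ) : ℂ) * d n =
      ((oddWeight N m : ℝ) : ℂ) * d 0 + hiCoef l N d m := by
  obtain ⟨k, rfl⟩ : ∃ k, N = k + 1 := ⟨N - 1, by omega⟩
  rw [hiCoef, Finset.sum_range_succ', add_comm, oddE_zero, mul_one, Nat.add_sub_cancel]

lemma norm_sum_ofReal_mul_sq_le (k : ℕ) (c : ℕ → ℝ) (d : ℕ → ℂ) :
    ‖∑ n ∈ Finset.range k, (c n : ℂ) * d n‖ ^ 2 ≤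
      (∑ n ∈ Finset.range k, c n ^ 2) * ∑ n ∈ Finset.range k, ‖d n‖ ^ 2 := by
  have h1 : ‖∑ n ∈ Finset.range k, (c n : ℂ) * d n‖ ≤
      ∑ n ∈ Finset.range k, |c n| * ‖d n‖ :=
    (norm_sum_le _ _).trans (Finset.sum_le_sum fun n _ => by
      rw [norm_mul, Complex.norm_real, Real.norm_eq_abs])
  refine (pow_le_pow_left₀ (norm_nonneg _) h1 2).trans ?_
  refine (Finset.sum_mul_sq_le_sq_mul_sq _ _ _).trans (le_of_eq ?_)
  simp only [sq_abs]

lemma sum_sq_le_of_le_geom (k : ℕ) (c : ℕ → ℝ) {a : ℝ}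
    (hc : ∀ n, |c n| ≤ a * (17 / 72) ^ n) :
    ∑ n ∈ Finset.range k, c n ^ 2 ≤ 5184 / 4895 * a ^ 2 := by
  have h1 : ∑ n ∈ Finset.range k, c n ^ 2 ≤
      ∑ n ∈ Finset.range k, a ^ 2 * ((17 / 72 : ℝ) ^ 2) ^ n :=
    Finset.sum_le_sum fun n _ => by
      calc c n ^ 2 = |c n| ^ 2 := (sq_abs _).symm
        _ ≤ (a * (17 / 72) ^ n) ^ 2 := pow_le_pow_left₀ (abs_nonneg _) (hc n) 2
        _ = a ^ 2 * ((17 / 72 : ℝ) ^ 2) ^ n := by rw [mul_pow, ← pow_mul, ← pow_mul, mul_comm n]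
  refine h1.trans ?_
  rw [← Finset.mul_sum, geom_sum_eq (by norm_num)]
  have h2 : (0 : ℝ) ≤ ((17 / 72 : ℝ) ^ 2) ^ k := by positivity
  have h3 : (((17 / 72 : ℝ) ^ 2) ^ k - 1) / ((17 / 72 : ℝ) ^ 2 - 1) ≤ 5184 / 4895 := by
    rw [div_le_iff_of_neg (by norm_num)]
    nlinarith
  nlinarith [sq_nonneg a, mul_le_mul_of_nonneg_left h3 (sq_nonneg a)]

lemma four_div_pi_sq_le : (4 / π) ^ 2 ≤ (1.6213 : ℝ) := by
  rw [div_pow, div_le_iff₀ (by positivity)]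
  nlinarith [Real.pi_gt_d4, Real.pi_pos]

lemma norm_hiCoef_sq_le {l : ℝ} {N m : ℕ} (hm : m < N) {a : ℝ}
    (ha : ∀ n, |oddE l ((Finset.range N).erase m) (n + 1)| ≤ a * (17 / 72) ^ n) (d : ℕ → ℂ) :
    ‖hiCoef l N d m‖ ^ 2 ≤ 1.6213 * (1 / (2 * m + 1) ^ 2) * (5184 / 4895 * a ^ 2) *
      ∑ n ∈ Finset.range (N - 1), ‖d (n + 1)‖ ^ 2 := by
  have hs : (0 : ℝ) ≤ 4 / π / (2 * m + 1) := by positivity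
  have h1 := norm_sum_ofReal_mul_sq_le (N - 1)
    (fun n => oddWeight N m * oddE l ((Finset.range N).erase m) (n + 1)) (fun n => d (n + 1))
  have h2 : ∑ n ∈ Finset.range (N - 1),
      (oddWeight N m * oddE l ((Finset.range N).erase m) (n + 1)) ^ 2 ≤
      1.6213 * (1 / (2 * m + 1) ^ 2) * (5184 / 4895 * a ^ 2) := by
    refine (sum_sq_le_of_le_geom _ _ (a := 4 / π / (2 * m + 1) * a) fun n => ?_).trans ?_
    · rw [abs_mul, mul_assoc]
      exact mul_le_mul (abs_oddWeight_le hm) (ha n) (abs_nonneg _) hs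
    · have h3 : (4 / π / (2 * m + 1) * a) ^ 2 = (4 / π) ^ 2 * ((1 / (2 * m + 1) ^ 2) * a ^ 2) := by
        field_simp
      rw [h3]
      have := mul_le_mul_of_nonneg_right four_div_pi_sq_le
        (show (0 : ℝ) ≤ (1 / (2 * (m : ℝ) + 1) ^ 2) * a ^ 2 by positivity)
      nlinarith
  exact h1.trans (mul_le_mul_of_nonneg_right h2 (Finset.sum_nonneg fun n _ => sq_nonneg _))

lemma sum_norm_hiCoef_sq_le {l : ℝ} (hl : 0 ≤ l) (hl1 : l ≤ 1) {N : ℕ} (hN : 0 < N) (d : ℕ → ℂ) :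
    ∑ m ∈ Finset.range N, ‖hiCoef l N d m‖ ^ 2 ≤
      0.7152 * l ^ 2 * ∑ n ∈ Finset.range (N - 1), ‖d (n + 1)‖ ^ 2 := by
  set D := ∑ n ∈ Finset.range (N - 1), ‖d (n + 1)‖ ^ 2 with hD
  have hD0 : 0 ≤ D := Finset.sum_nonneg fun n _ => sq_nonneg _
  have h0 := norm_hiCoef_sq_le hN (a := 17 / 72 * l) (fun n => by
    rw [abs_of_nonneg (oddE_nonneg hl _ _)]
    exact oddE_erase_zero_succ_le hl hl1 N n) d
  have hm : ∀ m ∈ (Finset.range N).erase 0, ‖hiCoef l N d m‖ ^ 2 ≤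
      1 / (2 * m + 1 : ℝ) ^ 2 * (1.6213 * (5184 / 4895 * (89 / 72 * l) ^ 2) * D) := by
    intro m hm
    have hm' := Finset.mem_of_mem_erase hm
    refine (norm_hiCoef_sq_le (Finset.mem_range.1 hm') (a := 89 / 72 * l) (fun n => ?_) d).trans
      (le_of_eq (by ring))
    rw [abs_of_nonneg (oddE_nonneg hl _ _)]
    exact (oddE_erase_le hl hm' _).trans (oddE_range_succ_le hl hl1 hN n)
  have h1 := (Finset.sum_le_sum hm).trans_eq (Finset.sum_mul _ _ _).symm
  have h2 := mul_le_mul_of_nonneg_right (sum_inv_odd_sq_erase_zero_le N)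
    (show 0 ≤ 1.6213 * (5184 / 4895 * (89 / 72 * l) ^ 2) * D by positivity)
  rw [← Finset.add_sum_erase _ _ (Finset.mem_range.2 hN)]
  have h3 : 0 ≤ l ^ 2 * D := by positivity
  simp only [Nat.cast_zero] at h0
  nlinarith

lemma norm_sum_hiCoef_mul_sq_le {l : ℝ} (hl : 0 ≤ l) (hl1 : l ≤ 1) {N : ℕ} (hN : 0 < N)
    (r : ℕ → ℝ) (hr : ∀ k < N, 0 ≤ r k) (hmono : ∀ k, k + 1 < N → r (k + 1) ≤ r k) (d : ℕ → ℂ) :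
    ‖∑ m ∈ Finset.range N, hiCoef l N d m * (r m : ℂ)‖ ^ 2 ≤
      0.7214 * l ^ 2 * r 0 ^ 2 * ∑ n ∈ Finset.range (N - 1), ‖d (n + 1)‖ ^ 2 := by
  set D := ∑ n ∈ Finset.range (N - 1), ‖d (n + 1)‖ ^ 2 with hD
  have hD0 : 0 ≤ D := Finset.sum_nonneg fun n _ => sq_nonneg _
  have hswap : ∑ m ∈ Finset.range N, hiCoef l N d m * (r m : ℂ) =
      ∑ n ∈ Finset.range (N - 1), ((∑ m ∈ Finset.range N,
        oddWeight N m * oddE l ((Finset.range N).erase m) (n + 1) * r m : ℝ) : ℂ) * d (n + 1) := by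
    simp only [hiCoef, Finset.sum_mul]
    rw [Finset.sum_comm]
    refine Finset.sum_congr rfl fun n _ => ?_
    push_cast
    rw [Finset.sum_mul]
    exact Finset.sum_congr rfl fun m _ => by ring
  rw [hswap]
  refine (norm_sum_ofReal_mul_sq_le _ _ _).trans (mul_le_mul_of_nonneg_right ?_ hD0)
  have hr0 : 0 ≤ r 0 := hr 0 hN
  refine (sum_sq_le_of_le_geom _ _ (a := 4 / π * (140 / 216 * l) * r 0) fun n => ?_).trans ?_
  · refine (abs_weighted_sum_succ_le hl hN r hr hmono n).trans ?_
    have h1 := oddE_erase_zero_succ_le hl hl1 N n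
    have h2 := oddE_range_succ_le hl hl1 hN n
    have h3 : oddE l ((Finset.range N).erase 0) (n + 1) + oddE l (Finset.range N) (n + 1) / 3 ≤
        140 / 216 * l * (17 / 72) ^ n := by linarith
    have h4 := mul_le_mul_of_nonneg_left h3 (show 0 ≤ 4 / π * r 0 by positivity)
    linarith
  · have h3 : (4 / π * (140 / 216 * l) * r 0) ^ 2 =
        (4 / π) ^ 2 * ((140 / 216) ^ 2 * (l ^ 2 * r 0 ^ 2)) := by ring
    rw [h3]
    have h4 := mul_le_mul_of_nonneg_right four_div_pi_sq_le
        (show (0 : ℝ) ≤ (140 / 216) ^ 2 * (l ^ 2 * r 0 ^ 2) by positivity)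
    have h5 : 0 ≤ l ^ 2 * r 0 ^ 2 := by positivity
    nlinarith

lemma norm_sub_sq_le_weighted {θ : ℝ} (hθ : 0 < θ) (a b : ℂ) :
    ‖a - b‖ ^ 2 ≤ (1 + θ) * ‖a‖ ^ 2 + (1 + 1 / θ) * ‖b‖ ^ 2 :=
  norm_sub_sq_le_young hθ le_rfl

lemma integral_norm_add_sub_sq_le {h θ : ℝ} (hh : 0 < h) (hθ : 0 < θ) {A B G : ℝ → ℂ}
    (hA : Continuous A) (hB : Continuous B) (hG : Continuous G) :
    ∫ t in (0 : ℝ)..h, ‖A t - B t - G t‖ ^ 2 ≤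
      (1 + θ) * (13 / 3 * (∫ t in (0 : ℝ)..h, ‖A t‖ ^ 2) +
        13 / 10 * ∫ t in (0 : ℝ)..h, ‖B t‖ ^ 2) +
      (1 + 1 / θ) * ∫ t in (0 : ℝ)..h, ‖G t‖ ^ 2 := by
  have h1 : ∫ t in (0 : ℝ)..h, ‖A t - B t - G t‖ ^ 2 ≤
      ∫ t in (0 : ℝ)..h, ((1 + θ) * (13 / 3 * ‖A t‖ ^ 2 + 13 / 10 * ‖B t‖ ^ 2) +
        (1 + 1 / θ) * ‖G t‖ ^ 2) :=
    intervalIntegral.integral_mono_on hh.le ((by fun_prop : Continuous _).intervalIntegrable _ _)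
      ((by fun_prop : Continuous _).intervalIntegrable _ _) fun t _ => by
        have e1 := norm_sub_sq_le_weighted hθ (A t - B t) (G t)
        have e2 := norm_sub_sq_le_weighted (show (0 : ℝ) < 10 / 3 by norm_num) (A t) (B t)
        have e3 := mul_le_mul_of_nonneg_left e2 (show 0 ≤ 1 + θ by positivity)
        norm_num at e3
        linarith
  refine h1.trans_eq ?_
  have iA : IntervalIntegrable (fun t => ‖A t‖ ^ 2) volume 0 h :=
    (by fun_prop : Continuous _).intervalIntegrable _ _
  have iB : IntervalIntegrable (fun t => ‖B t‖ ^ 2) volume 0 h :=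
    (by fun_prop : Continuous _).intervalIntegrable _ _
  have iG : IntervalIntegrable (fun t => ‖G t‖ ^ 2) volume 0 h :=
    (by fun_prop : Continuous _).intervalIntegrable _ _
  rw [intervalIntegral.integral_add (((iA.const_mul _).add (iB.const_mul _)).const_mul _)
    (iG.const_mul _), intervalIntegral.integral_const_mul,
    intervalIntegral.integral_add (iA.const_mul _) (iB.const_mul _)]
  simp only [intervalIntegral.integral_const_mul]

lemma integral_norm_add_sq_le {h : ℝ} (hh : 0 < h) {A B : ℝ → ℂ}
    (hA : Continuous A) (hB : Continuous B) :
    ∫ t in (0 : ℝ)..h, ‖A t + B t‖ ^ 2 ≤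
      2 * ((∫ t in (0 : ℝ)..h, ‖A t‖ ^ 2) + ∫ t in (0 : ℝ)..h, ‖B t‖ ^ 2) := by
  have h1 : ∫ t in (0 : ℝ)..h, ‖A t + B t‖ ^ 2 ≤
      ∫ t in (0 : ℝ)..h, 2 * (‖A t‖ ^ 2 + ‖B t‖ ^ 2) :=
    intervalIntegral.integral_mono_on hh.le ((by fun_prop : Continuous _).intervalIntegrable _ _)
      ((by fun_prop : Continuous _).intervalIntegrable _ _) fun t _ =>
        (pow_le_pow_left₀ (norm_nonneg _) (norm_add_le _ _) 2).trans
          (by nlinarith [sq_nonneg (‖A t‖ - ‖B t‖)])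
  refine h1.trans_eq ?_
  rw [intervalIntegral.integral_const_mul, intervalIntegral.integral_add] <;>
    exact (by fun_prop : Continuous _).intervalIntegrable _ _

/-- The odd quarter-wave cosine of frequency `(2m+1)π/(2h)`. -/
def oddCos (h : ℝ) (m : ℕ) (t : ℝ) : ℝ := Real.cos ((2 * m + 1) * π / (2 * h) * t)

lemma continuous_oddCos (h : ℝ) (m : ℕ) : Continuous (oddCos h m) := by
  unfold oddCos; fun_prop

lemma integral_norm_sum_oddCos_sq {h : ℝ} (hh : 0 < h) (N : ℕ) (c : ℕ → ℂ) :
    ∫ t in (0 : ℝ)..h, ‖∑ m ∈ Finset.range N, c m * (oddCos h m t : ℂ)‖ ^ 2 =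
      h / 2 * ∑ m ∈ Finset.range N, ‖c m‖ ^ 2 := by
  have hc := continuous_oddCos h
  have e : ∀ t, ‖∑ m ∈ Finset.range N, c m * (oddCos h m t : ℂ)‖ ^ 2 =
      (∑ m ∈ Finset.range N, (c m).re * oddCos h m t) ^ 2 +
        (∑ m ∈ Finset.range N, (c m).im * oddCos h m t) ^ 2 := fun t => by
    rw [← Complex.normSq_eq_norm_sq, Complex.normSq_apply]
    simp only [Complex.re_sum, Complex.im_sum, Complex.re_mul_ofReal, Complex.im_mul_ofReal]
    ring
  simp_rw [e]
  rw [intervalIntegral.integral_add ((by fun_prop : Continuous _).intervalIntegrable _ _)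
    ((by fun_prop : Continuous _).intervalIntegrable _ _),
    integral_sum_sq_of_orthogonal hc (integral_cos_mul_cos hh),
    integral_sum_sq_of_orthogonal hc (integral_cos_mul_cos hh), ← mul_add,
    ← Finset.sum_add_distrib]
  congr 1
  refine Finset.sum_congr rfl fun m _ => ?_
  rw [← Complex.normSq_eq_norm_sq, Complex.normSq_apply]
  ring

lemma integral_oddCos {h : ℝ} (hh : 0 < h) (m : ℕ) :
    ∫ t in (0 : ℝ)..h, oddCos h m t = (-1) ^ m * (2 * h / ((2 * m + 1) * π)) := by
  have hc : (2 * m + 1) * π / (2 * h) ≠ 0 := by positivity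
  unfold oddCos
  rw [intervalIntegral.integral_comp_mul_left (fun x => Real.cos x) hc, integral_cos, mul_zero,
    Real.sin_zero, sub_zero, smul_eq_mul,
    show (2 * m + 1) * π / (2 * h) * h = (2 * m + 1) * π / 2 by field_simp, sin_odd_half_pi]
  field_simp

lemma integral_half_sub_oddCos_sq_le {h : ℝ} (hh : 0 < h) (N : ℕ) :
    ∫ t in (0 : ℝ)..h, (1 / 2 - ∑ m ∈ Finset.range N, oddWeight N m * oddCos h m t) ^ 2 ≤
      h / 4 := by
  have hc := continuous_oddCos h
  have e : ∀ t, (1 / 2 - ∑ m ∈ Finset.range N, oddWeight N m * oddCos h m t) ^ 2 =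
      1 / 4 - (∑ m ∈ Finset.range N, oddWeight N m * oddCos h m t) +
        (∑ m ∈ Finset.range N, oddWeight N m * oddCos h m t) ^ 2 := fun t => by ring
  simp_rw [e]
  have i2 : IntervalIntegrable (fun t => ∑ m ∈ Finset.range N, oddWeight N m * oddCos h m t)
    volume 0 h := (by fun_prop : Continuous _).intervalIntegrable _ _
  rw [intervalIntegral.integral_add ((by fun_prop : Continuous _).intervalIntegrable _ _)
    ((by fun_prop : Continuous _).intervalIntegrable _ _),
    intervalIntegral.integral_sub (by simp) i2,
    integral_sum_sq_of_orthogonal hc (integral_cos_mul_cos hh),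
    intervalIntegral.integral_finsetSum fun m _ =>
      (by fun_prop : Continuous _).intervalIntegrable _ _, Finset.mul_sum]
  have hle : ∀ m ∈ Finset.range N, h / 2 * oddWeight N m ^ 2 ≤
      ∫ t in (0 : ℝ)..h, oddWeight N m * oddCos h m t := fun m hm => by
    rw [Finset.mem_range] at hm
    rw [intervalIntegral.integral_const_mul, integral_oddCos hh]
    have h1 := abs_oddWeight_le hm
    have h2 : oddWeight N m * ((-1) ^ m * (2 * h / ((2 * m + 1) * π))) =
        h / 2 * (|oddWeight N m| * (4 / π / (2 * m + 1))) := by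
      conv_lhs => rw [oddWeight_eq_neg_one_pow_mul_abs hm]
      have : ((-1 : ℝ) ^ m) * (-1) ^ m = 1 := by rw [← mul_pow]; norm_num
      calc _ = ((-1 : ℝ) ^ m * (-1) ^ m) * |oddWeight N m| * (2 * h / ((2 * m + 1) * π)) := by ring
        _ = _ := by rw [this]; field_simp; norm_num
    rw [h2, ← sq_abs, sq]
    exact mul_le_mul_of_nonneg_left (mul_le_mul_of_nonneg_left h1 (abs_nonneg _)) (by positivity)
  have := Finset.sum_le_sum hle
  rw [intervalIntegral.integral_const, smul_eq_mul, sub_zero]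
  linarith

lemma integral_reflect (h : ℝ) (F : ℝ → ℝ) :
    ∫ t in (0 : ℝ)..h, F (h - t) = ∫ t in (0 : ℝ)..h, F t := by
  rw [intervalIntegral.integral_comp_sub_left, sub_self, sub_zero]

/-- Bound for the remainder on an edge carrying cosine traces. -/
lemma cos_edge_remainder_le {h l θ : ℝ} (hh : 0 < h) (hl : 0 ≤ l) (hl1 : l ≤ 1) (hθ : 0 < θ)
    {N : ℕ} (hN : 0 < N) {f f' : ℝ → ℂ} (hf : ∀ t, HasDerivAt f (f' t) t) (hf' : Continuous f')
    (d0 d1 : ℕ → ℂ) (h0 : d0 0 = f 0) (h1 : d1 0 = f h) :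
    2 / h * ∫ t in (0 : ℝ)..h, ‖f t -
      ((∑ m ∈ Finset.range N, ((oddWeight N m : ℝ) * d0 0 + hiCoef l N d0 m) * (oddCos h m t : ℂ)) +
      ∑ m ∈ Finset.range N, ((oddWeight N m : ℝ) * d1 0 + hiCoef l N d1 m) *
        (oddCos h m (h - t) : ℂ))‖ ^ 2 ≤
      (1 + θ) * (13 / 12 * h * (∫ t in (0 : ℝ)..h, ‖f' t‖ ^ 2) +
        13 / 10 * (‖d0 0‖ ^ 2 + ‖d1 0‖ ^ 2)) +
      (1 + 1 / θ) * (1.4304 * l ^ 2 * ((∑ n ∈ Finset.range (N - 1), ‖d0 (n + 1)‖ ^ 2) +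
        ∑ n ∈ Finset.range (N - 1), ‖d1 (n + 1)‖ ^ 2)) := by
  have hc := continuous_oddCos h
  have hfc : Continuous f := continuous_iff_continuousAt.2 fun t => (hf t).continuousAt
  set p : ℝ → ℝ := fun t => ∑ m ∈ Finset.range N, oddWeight N m * oddCos h m t with hp
  have hpc : Continuous p := by fun_prop
  set G : (ℕ → ℂ) → ℝ → ℂ := fun d t =>
    ∑ m ∈ Finset.range N, hiCoef l N d m * (oddCos h m t : ℂ) with hG
  have hGc : ∀ d, Continuous (G d) := fun d => by fun_prop
  have split : ∀ (d : ℕ → ℂ) (t : ℝ), ∑ m ∈ Finset.range N,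
      ((oddWeight N m : ℝ) * d 0 + hiCoef l N d m) * (oddCos h m t : ℂ) =
      d 0 * (p t : ℂ) + G d t := fun d t => by
    simp only [hp, hG, Complex.ofReal_sum, Complex.ofReal_mul, Finset.mul_sum,
      ← Finset.sum_add_distrib]
    exact Finset.sum_congr rfl fun m _ => by ring
  have e : ∀ t, f t - ((∑ m ∈ Finset.range N,
      ((oddWeight N m : ℝ) * d0 0 + hiCoef l N d0 m) * (oddCos h m t : ℂ)) +
      ∑ m ∈ Finset.range N, ((oddWeight N m : ℝ) * d1 0 + hiCoef l N d1 m) *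
        (oddCos h m (h - t) : ℂ)) =
      (f t - (f 0 + f h) / 2) -
        (-d0 0 * ((1 / 2 - p t : ℝ) : ℂ) + -d1 0 * ((1 / 2 - p (h - t) : ℝ) : ℂ)) -
        (G d0 t + G d1 (h - t)) := fun t => by
    rw [split, split, h0, h1]; push_cast; ring
  simp_rw [e]
  have key := integral_norm_add_sub_sq_le hh hθ (A := fun t => f t - (f 0 + f h) / 2)
    (B := fun t => -d0 0 * ((1 / 2 - p t : ℝ) : ℂ) + -d1 0 * ((1 / 2 - p (h - t) : ℝ) : ℂ))
    (G := fun t => G d0 t + G d1 (h - t)) (by fun_prop) (by fun_prop) (by fun_prop)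
  have kA := poincare_midpoint hh.le hf hf'
  rw [sub_zero] at kA
  have kP := integral_half_sub_oddCos_sq_le hh N
  have kP0 : ∀ d : ℂ, ∫ t in (0 : ℝ)..h, ‖-d * ((1 / 2 - p t : ℝ) : ℂ)‖ ^ 2 ≤
      h / 4 * ‖d‖ ^ 2 := fun d => by
    simp_rw [norm_mul, norm_neg, mul_pow, Complex.norm_real, Real.norm_eq_abs, sq_abs]
    rw [intervalIntegral.integral_const_mul, mul_comm]
    exact mul_le_mul_of_nonneg_right kP (sq_nonneg _)
  have kB := integral_norm_add_sq_le hh (A := fun t => -d0 0 * ((1 / 2 - p t : ℝ) : ℂ))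
    (B := fun t => -d1 0 * ((1 / 2 - p (h - t) : ℝ) : ℂ)) (by fun_prop) (by fun_prop)
  rw [integral_reflect h fun t => ‖-d1 0 * ((1 / 2 - p t : ℝ) : ℂ)‖ ^ 2] at kB
  have kG := integral_norm_add_sq_le hh (A := G d0) (B := fun t => G d1 (h - t))
    (hGc _) (by fun_prop)
  rw [integral_reflect h fun t => ‖G d1 t‖ ^ 2, integral_norm_sum_oddCos_sq hh,
    integral_norm_sum_oddCos_sq hh] at kG
  have g0 := sum_norm_hiCoef_sq_le hl hl1 hN d0
  have g1 := sum_norm_hiCoef_sq_le hl hl1 hN d1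
  have k0 := kP0 (d0 0)
  have k1 := kP0 (d1 0)
  have kB' := kB.trans (mul_le_mul_of_nonneg_left (add_le_add k0 k1) zero_le_two)
  have kG' := kG.trans (mul_le_mul_of_nonneg_left (add_le_add
    (mul_le_mul_of_nonneg_left g0 (show 0 ≤ h / 2 by positivity))
    (mul_le_mul_of_nonneg_left g1 (show 0 ≤ h / 2 by positivity))) zero_le_two)
  have key' := key.trans (add_le_add (mul_le_mul_of_nonneg_left
    (add_le_add (mul_le_mul_of_nonneg_left kA (by norm_num : (0 : ℝ) ≤ 13 / 3))
      (mul_le_mul_of_nonneg_left kB' (by norm_num : (0 : ℝ) ≤ 13 / 10)))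
    (show 0 ≤ 1 + θ by positivity))
    (mul_le_mul_of_nonneg_left kG' (show 0 ≤ 1 + 1 / θ by positivity)))
  refine (mul_le_mul_of_nonneg_left key' (show 0 ≤ 2 / h by positivity)).trans_eq ?_
  field_simp
  ring

lemma norm_add_sq_le_convex {σ a b : ℝ} (h0 : 0 ≤ σ) (h1 : σ ≤ 1) (ha : 0 ≤ a) (hb : 0 ≤ b)
    {P Q : ℂ} (hP : ‖P‖ ^ 2 ≤ (1 - σ) ^ 2 * a) (hQ : ‖Q‖ ^ 2 ≤ σ ^ 2 * b) :
    ‖P + Q‖ ^ 2 ≤ (1 - σ) * a + σ * b := by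
  have hσ : 0 ≤ 1 - σ := by linarith
  have hP' : ‖P‖ ≤ (1 - σ) * Real.sqrt a :=
    abs_le_of_sq_le_sq' (by rwa [mul_pow, Real.sq_sqrt ha]) (by positivity) |>.2
  have hQ' : ‖Q‖ ≤ σ * Real.sqrt b :=
    abs_le_of_sq_le_sq' (by rwa [mul_pow, Real.sq_sqrt hb]) (by positivity) |>.2
  calc ‖P + Q‖ ^ 2 ≤ ((1 - σ) * Real.sqrt a + σ * Real.sqrt b) ^ 2 :=
        pow_le_pow_left₀ (norm_nonneg _) ((norm_add_le _ _).trans (add_le_add hP' hQ')) 2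
    _ = (1 - σ) * Real.sqrt a ^ 2 + σ * Real.sqrt b ^ 2 -
        σ * (1 - σ) * (Real.sqrt a - Real.sqrt b) ^ 2 := by ring
    _ ≤ (1 - σ) * Real.sqrt a ^ 2 + σ * Real.sqrt b ^ 2 := by
        have : 0 ≤ σ * (1 - σ) * (Real.sqrt a - Real.sqrt b) ^ 2 := by positivity
        linarith
    _ = _ := by rw [Real.sq_sqrt ha, Real.sq_sqrt hb]

lemma integral_norm_add_sq_le_convex {h a b : ℝ} (hh : 0 < h) (ha : 0 ≤ a) (hb : 0 ≤ b)
    {P Q : ℝ → ℂ} (hPc : Continuous P) (hQc : Continuous Q)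
    (hP : ∀ s ∈ Icc 0 h, ‖P s‖ ^ 2 ≤ (1 - s / h) ^ 2 * a)
    (hQ : ∀ s ∈ Icc 0 h, ‖Q s‖ ^ 2 ≤ (s / h) ^ 2 * b) :
    ∫ s in (0 : ℝ)..h, ‖P s + Q s‖ ^ 2 ≤ h / 2 * (a + b) := by
  have h1 : ∫ s in (0 : ℝ)..h, ‖P s + Q s‖ ^ 2 ≤
      ∫ s in (0 : ℝ)..h, (a + (b - a) / h * s) :=
    intervalIntegral.integral_mono_on hh.le ((by fun_prop : Continuous _).intervalIntegrable _ _)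
      ((by fun_prop : Continuous _).intervalIntegrable _ _) fun s hs => by
        have := norm_add_sq_le_convex (div_nonneg hs.1 hh.le) ((div_le_one hh).2 hs.2) ha hb
          (hP s hs) (hQ s hs)
        refine this.trans_eq ?_
        ring
  refine h1.trans_eq ?_
  rw [intervalIntegral.integral_add (by simp)
    ((by fun_prop : Continuous _).intervalIntegrable _ _), intervalIntegral.integral_const_mul,
    intervalIntegral.integral_const, integral_id, smul_eq_mul]
  field_simp
  ring

/-- Bound for the remainder on an edge carrying evanescent traces. -/
lemma evanescent_edge_remainder_le {h l θ : ℝ} (hh : 0 < h) (hl : 0 ≤ l) (hl1 : l ≤ 1)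
    (hθ : 0 < θ) {N : ℕ} (hN : 0 < N) {r : ℕ → ℝ → ℝ} (hrc : ∀ m, Continuous (r m))
    (hr : ∀ s ∈ Icc 0 h, ∀ m, 0 ≤ r m s) (hmono : ∀ s ∈ Icc 0 h, ∀ m, r (m + 1) s ≤ r m s)
    (hr0 : ∀ s ∈ Icc 0 h, r 0 s ≤ s / h)
    {f f' : ℝ → ℂ} (hf : ∀ t, HasDerivAt f (f' t) t) (hf' : Continuous f')
    (d0 d1 : ℕ → ℂ) (h0 : d0 0 = f 0) (h1 : d1 0 = f h) :
    2 / h * ∫ s in (0 : ℝ)..h, ‖f s -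
      ((∑ m ∈ Finset.range N, ((oddWeight N m : ℝ) * d0 0 + hiCoef l N d0 m) *
        (r m (h - s) : ℂ)) +
      ∑ m ∈ Finset.range N, ((oddWeight N m : ℝ) * d1 0 + hiCoef l N d1 m) * (r m s : ℂ))‖ ^ 2 ≤
      (1 + θ) * (13 / 12 * h * (∫ t in (0 : ℝ)..h, ‖f' t‖ ^ 2) +
        13 / 10 * (‖d0 0‖ ^ 2 + ‖d1 0‖ ^ 2)) +
      (1 + 1 / θ) * (0.7214 * l ^ 2 * ((∑ n ∈ Finset.range (N - 1), ‖d0 (n + 1)‖ ^ 2) +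
        ∑ n ∈ Finset.range (N - 1), ‖d1 (n + 1)‖ ^ 2)) := by
  have hfc : Continuous f := continuous_iff_continuousAt.2 fun t => (hf t).continuousAt
  set p : ℝ → ℝ := fun t => ∑ m ∈ Finset.range N, oddWeight N m * r m t with hp
  have hpc : Continuous p := by fun_prop
  set G : (ℕ → ℂ) → ℝ → ℂ := fun d t =>
    ∑ m ∈ Finset.range N, hiCoef l N d m * (r m t : ℂ) with hG
  have hGc : ∀ d, Continuous (G d) := fun d => by fun_prop
  have split : ∀ (d : ℕ → ℂ) (t : ℝ), ∑ m ∈ Finset.range N,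
      ((oddWeight N m : ℝ) * d 0 + hiCoef l N d m) * (r m t : ℂ) =
      d 0 * (p t : ℂ) + G d t := fun d t => by
    simp only [hp, hG, Complex.ofReal_sum, Complex.ofReal_mul, Finset.mul_sum,
      ← Finset.sum_add_distrib]
    exact Finset.sum_congr rfl fun m _ => by ring
  have e : ∀ s, f s - ((∑ m ∈ Finset.range N,
      ((oddWeight N m : ℝ) * d0 0 + hiCoef l N d0 m) * (r m (h - s) : ℂ)) +
      ∑ m ∈ Finset.range N, ((oddWeight N m : ℝ) * d1 0 + hiCoef l N d1 m) *
        (r m s : ℂ)) =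
      (f s - (f 0 + ((s - 0) / (h - 0) : ℝ) * (f h - f 0))) -
        (d0 0 * ((p (h - s) - (1 - s / h) : ℝ) : ℂ) + d1 0 * ((p s - s / h : ℝ) : ℂ)) -
        (G d0 (h - s) + G d1 s) := fun s => by
    rw [split, split, h0, h1, sub_zero, sub_zero]; push_cast; ring
  simp_rw [e]
  have key := integral_norm_add_sub_sq_le hh hθ
    (A := fun s => f s - (f 0 + ((s - 0) / (h - 0) : ℝ) * (f h - f 0)))
    (B := fun s => d0 0 * ((p (h - s) - (1 - s / h) : ℝ) : ℂ) + d1 0 * ((p s - s / h : ℝ) : ℂ))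
    (G := fun s => G d0 (h - s) + G d1 s) (by fun_prop) (by fun_prop) (by fun_prop)
  have kA := (poincare_interp hh hf hf').trans_eq
    (congrArg (fun z => z ^ 2 / 8 * ∫ t in (0 : ℝ)..h, ‖f' t‖ ^ 2) (sub_zero h))
  have kp : ∀ s ∈ Icc 0 h, (p s - s / h) ^ 2 ≤ (s / h) ^ 2 := fun s hs => by
    have k1 := weighted_sum_zero_mem hN (fun m => r m s) (fun m _ => hr s hs m)
      (fun m _ => hmono s hs m)
    have k2 := hr0 s hs
    have k3 : 4 / π * r 0 s ≤ 2 * (s / h) :=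
      mul_le_mul ((div_le_iff₀ Real.pi_pos).2 (by linarith [Real.pi_gt_three])) k2 (hr s hs 0)
        zero_le_two
    refine sq_le_sq' ?_ ?_
    · have := k1.1
      simp only [hp]; linarith
    · have := k1.2
      simp only [hp]; linarith
  have kg : ∀ d, ∀ s ∈ Icc 0 h, ‖G d s‖ ^ 2 ≤ (s / h) ^ 2 *
      (0.7214 * l ^ 2 * ∑ n ∈ Finset.range (N - 1), ‖d (n + 1)‖ ^ 2) := fun d s hs => by
    refine (norm_sum_hiCoef_mul_sq_le hl hl1 hN (fun m => r m s) (fun m _ => hr s hs m)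
      (fun m _ => hmono s hs m) d).trans ?_
    have k2 := pow_le_pow_left₀ (hr s hs 0) (hr0 s hs) 2
    have hS : 0 ≤ 0.7214 * l ^ 2 * ∑ n ∈ Finset.range (N - 1), ‖d (n + 1)‖ ^ 2 :=
      mul_nonneg (by positivity) (Finset.sum_nonneg fun n _ => sq_nonneg _)
    refine le_of_eq_of_le ?_ (mul_le_mul_of_nonneg_right k2 hS)
    ring
  have refl : ∀ s ∈ Icc 0 h, h - s ∈ Icc 0 h := fun s hs =>
    ⟨by linarith [hs.2], by linarith [hs.1]⟩
  have hsub : ∀ s, 1 - s / h = (h - s) / h := fun s => by field_simp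
  have kB := integral_norm_add_sq_le_convex hh (sq_nonneg ‖d0 0‖) (sq_nonneg ‖d1 0‖)
    (P := fun s => d0 0 * ((p (h - s) - (1 - s / h) : ℝ) : ℂ))
    (Q := fun s => d1 0 * ((p s - s / h : ℝ) : ℂ)) (by fun_prop) (by fun_prop)
    (fun s hs => by
      rw [norm_mul, mul_pow, Complex.norm_real, Real.norm_eq_abs, sq_abs, mul_comm, hsub]
      exact mul_le_mul_of_nonneg_right (kp _ (refl s hs)) (sq_nonneg _))
    (fun s hs => by
      rw [norm_mul, mul_pow, Complex.norm_real, Real.norm_eq_abs, sq_abs, mul_comm]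
      exact mul_le_mul_of_nonneg_right (kp _ hs) (sq_nonneg _))
  have hS : ∀ d : ℕ → ℂ, 0 ≤ 0.7214 * l ^ 2 * ∑ n ∈ Finset.range (N - 1), ‖d (n + 1)‖ ^ 2 :=
    fun d => mul_nonneg (by positivity) (Finset.sum_nonneg fun n _ => sq_nonneg _)
  have kG := integral_norm_add_sq_le_convex hh (hS d0) (hS d1)
    (P := fun s => G d0 (h - s)) (Q := G d1) (by fun_prop) (by fun_prop)
    (fun s hs => by rw [hsub]; exact kg d0 _ (refl s hs)) (kg d1)
  have key' := key.trans (add_le_add (mul_le_mul_of_nonneg_left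
    (add_le_add (mul_le_mul_of_nonneg_left kA (by norm_num : (0 : ℝ) ≤ 13 / 3))
      (mul_le_mul_of_nonneg_left kB (by norm_num : (0 : ℝ) ≤ 13 / 10)))
    (show 0 ≤ 1 + θ by positivity))
    (mul_le_mul_of_nonneg_left kG (show 0 ≤ 1 + 1 / θ by positivity)))
  refine (mul_le_mul_of_nonneg_left key' (show 0 ≤ 2 / h by positivity)).trans_eq ?_
  field_simp
  ring

lemma convexOn_sinh : ConvexOn ℝ (Ici 0) Real.sinh := by
  refine convexOn_of_deriv2_nonneg (convex_Ici 0) Real.continuous_sinh.continuousOn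
    Real.differentiable_sinh.differentiableOn ?_ fun x hx => ?_
  · rw [Real.deriv_sinh]; exact Real.differentiable_cosh.differentiableOn
  · rw [interior_Ici] at hx
    simpa using (Real.sinh_pos_iff.2 hx).le

lemma sinh_mul_le {σ z : ℝ} (h0 : 0 ≤ σ) (h1 : σ ≤ 1) (hz : 0 ≤ z) :
    Real.sinh (σ * z) ≤ σ * Real.sinh z := by
  have := convexOn_sinh.2 hz (Set.mem_Ici.2 le_rfl : (0 : ℝ) ∈ Ici 0) h0 (sub_nonneg.2 h1) (by ring)
  simpa using this

lemma sinh_ratio_antitoneOn {s L : ℝ} (hs : 0 ≤ s) (hsL : s ≤ L) (hL : 0 < L) :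
    AntitoneOn (fun a => Real.sinh (s * a) / Real.sinh (L * a)) (Ioi 0) := by
  have hpos : ∀ a ∈ Ioi (0 : ℝ), 0 < Real.sinh (L * a) := fun a ha =>
    Real.sinh_pos_iff.2 (mul_pos hL ha)
  have hd : ∀ a ∈ Ioi (0 : ℝ), HasDerivAt (fun a => Real.sinh (s * a) / Real.sinh (L * a))
      ((Real.cosh (s * a) * s * Real.sinh (L * a) - Real.sinh (s * a) * (Real.cosh (L * a) * L)) /
        Real.sinh (L * a) ^ 2) a := fun a ha => by
    have e : ∀ c : ℝ, HasDerivAt (fun a => Real.sinh (c * a)) (Real.cosh (c * a) * c) a := fun c =>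
      (hasDerivAt_mul_const c (x := a)).congr_deriv rfl |>.sinh.congr_deriv (by rw [mul_comm a]) |>
        fun h => by simpa only [mul_comm] using h
    exact (e s).div (e L) (hpos a ha).ne'
  refine antitoneOn_of_deriv_nonpos (convex_Ioi 0)
    (fun a ha => (hd a ha).continuousAt.continuousWithinAt)
    (fun a ha => (hd a (interior_subset ha)).differentiableAt.differentiableWithinAt)
    fun a ha => ?_
  rw [interior_Ioi] at ha
  have ha' : (0 : ℝ) < a := ha
  rw [(hd a ha).deriv]
  refine div_nonpos_of_nonpos_of_nonneg ?_ (sq_nonneg _)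
  have h1 := sinh_mul_le (σ := (L - s) / (L + s)) (z := (L + s) * a)
    (div_nonneg (by linarith) (by linarith)) ((div_le_one (by linarith)).2 (by linarith))
    (by positivity)
  have hLs : L + s ≠ 0 := by positivity
  rw [show (L - s) / (L + s) * ((L + s) * a) = L * a - s * a by field_simp,
    show (L + s) * a = L * a + s * a by ring, div_mul_eq_mul_div, le_div_iff₀ (by positivity),
    Real.sinh_sub, Real.sinh_add] at h1
  linarith

/-- Basic facts on the evanescent node modes. -/
lemma colMode_of_one_lt {κ h1 h2 : ℝ} {k : ℕ} (hk : 1 < nuTil κ h1 (k + 1)) (s : ℝ) :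
    colMode κ h1 h2 k s = Real.sinh (s * (κ * Real.sqrt (nuTil κ h1 (k + 1) ^ 2 - 1))) /
      Real.sinh (h2 * (κ * Real.sqrt (nuTil κ h1 (k + 1) ^ 2 - 1))) := by
  rw [colMode, vertRatio, nuHat_odd_eq_nuTil, if_neg (by nlinarith), neg_sub, mul_assoc, mul_assoc]

lemma nuTil_mono {κ h1 : ℝ} (hκ : 0 < κ) (hh1 : 0 < h1) {i j : ℕ} (h : i ≤ j) :
    nuTil κ h1 (i + 1) ≤ nuTil κ h1 (j + 1) := by
  unfold nuTil
  gcongr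

lemma colMode_nonneg {κ h1 h2 : ℝ} (hκ : 0 < κ) {k : ℕ} (hk : 1 < nuTil κ h1 (k + 1)) {s : ℝ}
    (hs : s ∈ Icc 0 h2) : 0 ≤ colMode κ h1 h2 k s := by
  rw [colMode_of_one_lt hk]
  exact div_nonneg (Real.sinh_nonneg_iff.2 (mul_nonneg hs.1 (by positivity)))
    (Real.sinh_nonneg_iff.2 (mul_nonneg (hs.1.trans hs.2) (by positivity)))

lemma colMode_succ_le {κ h1 h2 : ℝ} (hκ : 0 < κ) (hh1 : 0 < h1) (hh2 : 0 < h2) {k : ℕ}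
    (hk : 1 < nuTil κ h1 (k + 1)) {s : ℝ} (hs : s ∈ Icc 0 h2) :
    colMode κ h1 h2 (k + 1) s ≤ colMode κ h1 h2 k s := by
  have hm := nuTil_mono hκ hh1 (Nat.le_succ k)
  rw [colMode_of_one_lt hk, colMode_of_one_lt (hk.trans_le hm)]
  have hp : 0 < nuTil κ h1 (k + 1) ^ 2 - 1 := by nlinarith
  have hq : nuTil κ h1 (k + 1) ^ 2 - 1 ≤ nuTil κ h1 (k.succ + 1) ^ 2 - 1 :=
    sub_le_sub_right (pow_le_pow_left₀ (by linarith) hm 2) 1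
  exact sinh_ratio_antitoneOn hs.1 hs.2 hh2 (mem_Ioi.2 (mul_pos hκ (Real.sqrt_pos.2 hp)))
    (mem_Ioi.2 (mul_pos hκ (Real.sqrt_pos.2 (hp.trans_le hq))))
    (mul_le_mul_of_nonneg_left (Real.sqrt_le_sqrt hq) hκ.le)

lemma colMode_le_div {κ h1 h2 : ℝ} (hκ : 0 < κ) (hh2 : 0 < h2) {k : ℕ}
    (hk : 1 < nuTil κ h1 (k + 1)) {s : ℝ} (hs : s ∈ Icc 0 h2) :
    colMode κ h1 h2 k s ≤ s / h2 := by
  rw [colMode_of_one_lt hk]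
  set a := κ * Real.sqrt (nuTil κ h1 (k + 1) ^ 2 - 1) with ha
  have ha0 : 0 < a := mul_pos hκ (Real.sqrt_pos.2 (by nlinarith))
  rw [div_le_iff₀ (Real.sinh_pos_iff.2 (mul_pos hh2 ha0))]
  have := sinh_mul_le (div_nonneg hs.1 hh2.le) ((div_le_one hh2).2 hs.2) (mul_pos hh2 ha0).le
  rwa [show s / h2 * (h2 * a) = s * a by field_simp] at this

lemma one_lt_nuTil {κ h1 h2 : ℝ} (hκ : 0 < κ) (hh1 : 0 < h1) (hh2 : 0 < h2)
    (hA : A2cond κ h1 h2) (hν : ¬ nuTil κ h1 1 < 1) (k : ℕ) : 1 < nuTil κ h1 (k + 1) := by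
  refine lt_of_lt_of_le ?_ (nuTil_mono hκ hh1 (Nat.zero_le k))
  refine lt_of_le_of_ne (not_lt.1 hν) fun h => ?_
  have e := nuHat_odd_eq_nuTil κ h1 0
  rw [← h] at e
  have := sin_vertical_ne_zero hκ hh2 hA (2 * 0 + 1) (by rw [e]; norm_num)
  rw [e] at this
  simp at this

lemma dTil_eq_zero {κ h1 h2 : ℝ} (h : ∀ k, 1 < nuTil κ h1 (k + 1)) : dTil κ h1 h2 = 0 := by
  have : {d : ℝ | ∃ n : ℕ, 1 ≤ n ∧ nuTil κ h1 n < 1 ∧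
      ∃ m : ℕ, d = |Real.sqrt (1 - nuTil κ h1 n ^ 2) - m * π / (κ * h2)|} = ∅ := by
    refine eq_empty_of_forall_notMem ?_
    rintro d ⟨n, hn, hlt, -⟩
    obtain ⟨k, rfl⟩ : ∃ k, n = k + 1 := ⟨n - 1, by omega⟩
    exact absurd hlt (h k).not_gt
  rw [dTil, this, Real.sInf_empty]

lemma pi_sq_mem : 9.869 ≤ π ^ 2 ∧ π ^ 2 ≤ 9.87 := by
  have h1 := Real.pi_gt_d4
  have h2 := Real.pi_lt_d4
  constructor <;> nlinarith

/-- The four coefficients arising in the evanescent cell estimate are at most `16 X ^ 2`. -/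
lemma evanescent_coefficients_le {x y X : ℝ} (hx : 0 < x) (hy : 0 < y) (hyπ : y ≤ π / 2)
    (hX : 1 ≤ X) (hxX : x ≤ X) (hyX : y ≤ X) :
    52 / 5 * (traceMu x * traceMu y) +
        8.68 * (4 * y ^ 2 / π ^ 2) ^ 2 * (traceMu x * traceMu y) ≤ 16 * X ^ 2 ∧
      104 / 15 * (traceMu x * traceMu y) + 13 / 6 * (y ^ 2 * traceMu x) +
        8.68 * (4 * y ^ 2 / π ^ 2) ^ 2 * (traceMu x * traceMu y) ≤ 16 * X ^ 2 ∧
      104 / 15 * (traceMu x * traceMu y) + 13 / 6 * (x ^ 2 * traceMu y) +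
        8.68 * (4 * y ^ 2 / π ^ 2) ^ 2 * (traceMu x * traceMu y) ≤ 16 * X ^ 2 ∧
      208 / 45 * (traceMu x * traceMu y) + 13 / 9 * (y ^ 2 * traceMu x + x ^ 2 * traceMu y) +
        8.68 * (4 * y ^ 2 / π ^ 2) ^ 2 * (traceMu x * traceMu y) ≤ 16 * X ^ 2 := by
  obtain ⟨p1, p2⟩ := pi_sq_mem
  have ha0 := traceMu_pos x
  have hb0 := traceMu_pos y
  have hxv : x ^ 2 ≤ X ^ 2 := pow_le_pow_left₀ hx.le hxX 2
  have hyv : y ^ 2 ≤ X ^ 2 := pow_le_pow_left₀ hy.le hyX 2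
  have hv1 : 1 ≤ X ^ 2 := one_le_pow₀ hX
  have hy2 : y ^ 2 ≤ 2.4675 := by
    have := pow_le_pow_left₀ hy.le hyπ 2
    rw [div_pow] at this; linarith
  have hx0 : 0 < x ^ 2 := by positivity
  have hy0 : 0 < y ^ 2 := by positivity
  set q := 8.68 * (4 * y ^ 2 / π ^ 2) ^ 2 with hq
  have hq0 : 0 ≤ q := by positivity
  have hqy : q ≤ 1.4262 * (y ^ 2) ^ 2 := by
    have : 4 * y ^ 2 / π ^ 2 ≤ 4 * y ^ 2 / 9.869 := by gcongr
    have := pow_le_pow_left₀ (by positivity) this 2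
    calc q ≤ 8.68 * (4 * y ^ 2 / 9.869) ^ 2 := mul_le_mul_of_nonneg_left this (by norm_num)
      _ = 8.68 * 16 / 9.869 ^ 2 * (y ^ 2) ^ 2 := by ring
      _ ≤ _ := mul_le_mul_of_nonneg_right (by norm_num) (sq_nonneg _)
  set v := X ^ 2 with hv
  set a := traceMu x with ha
  set b := traceMu y with hb
  set s := x ^ 2 with hs
  set t := y ^ 2 with ht
  have hae : a = max (1 + s / 8) (3 * s / 8) := rfl
  have hbe : b = max (1 + t / 8) (3 * t / 8) := rfl
  by_cases hc : v ≤ 2.4675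
  · have haw : a ≤ 1 + v / 8 := by rw [hae]; exact max_le (by linarith) (by linarith)
    have hbw : b ≤ 1 + v / 8 := by rw [hbe]; exact max_le (by linarith) (by linarith)
    have hab : a * b ≤ (1 + v / 8) ^ 2 := by
      rw [sq]; exact mul_le_mul haw hbw hb0.le (by linarith)
    have hab0 : 0 ≤ a * b := by positivity
    have hqv : q ≤ 1.4262 * v ^ 2 := hqy.trans (by gcongr)
    have hqab : q * (a * b) ≤ 1.4262 * v ^ 2 * (1 + v / 8) ^ 2 :=
      mul_le_mul hqv hab hab0 (by positivity)
    have hta : t * a ≤ v * (1 + v / 8) := mul_le_mul hyv haw ha0.le (by linarith)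
    have hsb : s * b ≤ v * (1 + v / 8) := mul_le_mul hxv hbw hb0.le (by linarith)
    have k0 : 0 ≤ (v - 1) * (2.4675 - v) := mul_nonneg (by linarith) (by linarith)
    have k1 : 0 ≤ (v - 1) * (2.4675 - v) * v := mul_nonneg k0 (by linarith)
    have k2 : 0 ≤ (v - 1) * (2.4675 - v) * v ^ 2 := mul_nonneg k0 (by positivity)
    refine ⟨?_, ?_, ?_, ?_⟩ <;> linarith
  · have haw : a ≤ 0.5304 * v := by rw [hae]; exact max_le (by linarith) (by linarith)
    have hbw : b ≤ 1.3085 := by rw [hbe]; exact max_le (by linarith) (by linarith)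
    have hab : a * b ≤ 0.5304 * v * 1.3085 := mul_le_mul haw hbw hb0.le (by linarith)
    have hab0 : 0 ≤ a * b := by positivity
    have hqv : q ≤ 8.684 := by
      have := pow_le_pow_left₀ hy0.le hy2 2
      linarith
    have hqab : q * (a * b) ≤ 8.684 * (0.5304 * v * 1.3085) :=
      mul_le_mul hqv hab hab0 (by norm_num)
    have hta : t * a ≤ 2.4675 * (0.5304 * v) := mul_le_mul hy2 haw ha0.le (by norm_num)
    have hsb : s * b ≤ v * 1.3085 := mul_le_mul hxv hbw hb0.le (by linarith)
    refine ⟨?_, ?_, ?_, ?_⟩ <;> linarith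

/-- The sum of the higher node data at `q`. -/
def hiDatumSq (κ h1 h2 : ℝ) (u : ℝ × ℝ → ℂ) (N : ℕ) (q : ℤ × ℤ) : ℝ :=
  ∑ n ∈ Finset.range (N - 1), ‖nodeDatum κ h1 h2 u q (n + 1)‖ ^ 2

lemma nodeDatum_zero (κ h1 h2 : ℝ) (u : ℝ × ℝ → ℂ) (q : ℤ × ℤ) :
    nodeDatum κ h1 h2 u q 0 = u (nodePt h1 h2 q) := by
  simp [nodeDatum, pdM]

lemma sum_nodeCoef_mul {κ h1 h2 : ℝ} (hκ : 0 < κ) (hh1 : 0 < h1) (hh2 : 0 < h2)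
    (hA : A2cond κ h1 h2) {cells : Finset (ℤ × ℤ)} {N : ℕ} {u : ℝ × ℝ → ℂ}
    {β : {p : ℤ × ℤ // p ∈ meshNodes cells} × Fin N → ℂ}
    (hβ : CollocationSystem κ h1 h2 cells N u β) {q : ℤ × ℤ} (hq : q ∈ meshNodes cells)
    (g : ℕ → ℂ) :
    ∑ m ∈ Finset.range N, nodeCoef β q m * g m =
      ∑ m ∈ Finset.range N, ((oddWeight N m : ℝ) * nodeDatum κ h1 h2 u q 0 +
        hiCoef (4 * (κ * h1) ^ 2 / π ^ 2) N (nodeDatum κ h1 h2 u q) m) * g m := by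
  refine Finset.sum_congr rfl fun m hm => ?_
  have hm := Finset.mem_range.1 hm
  rw [nodeCoef_eq_sum hκ hh1 hh2 hA hβ hq hm, sum_oddWeight_mul_eq_add_hiCoef _ (by omega)]

lemma row_remainder_le {κ h1 h2 θ : ℝ} (hκ : 0 < κ) (hh1 : 0 < h1) (hh2 : 0 < h2)
    (hA : A2cond κ h1 h2) (hl1 : 4 * (κ * h1) ^ 2 / π ^ 2 ≤ 1) (hθ : 0 < θ)
    {cells : Finset (ℤ × ℤ)} {N : ℕ} (hN : 0 < N) {u : ℝ × ℝ → ℂ} (hu : ContDiff ℝ (1 : ℕ) u)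
    {β : {p : ℤ × ℤ // p ∈ meshNodes cells} × Fin N → ℂ}
    (hβ : CollocationSystem κ h1 h2 cells N u β) {e : ℤ × ℤ} (he : e ∈ meshNodes cells)
    (he' : (e.1 + 1, e.2) ∈ meshNodes cells) :
    2 / h1 * ∫ t in (0 : ℝ)..h1, ‖rowRem h1 h2 u β e t‖ ^ 2 ≤
      (1 + θ) * (13 / 12 * h1 * (∫ t in (0 : ℝ)..h1, ‖pdM 1 0 u (e.1 * h1 + t, e.2 * h2)‖ ^ 2) +
        13 / 10 * (‖u (nodePt h1 h2 e)‖ ^ 2 + ‖u (nodePt h1 h2 (e.1 + 1, e.2))‖ ^ 2)) +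
      (1 + 1 / θ) * (1.4304 * (4 * (κ * h1) ^ 2 / π ^ 2) ^ 2 *
        (hiDatumSq κ h1 h2 u N e + hiDatumSq κ h1 h2 u N (e.1 + 1, e.2))) := by
  have hc : Continuous (pdM 1 0 u) := continuous_pdM_zero hu
  have := cos_edge_remainder_le hh1 (by positivity) hl1 hθ hN
    (f := fun t => u (e.1 * h1 + t, e.2 * h2)) (f' := fun t => pdM 1 0 u (e.1 * h1 + t, e.2 * h2))
    (fun t => HasDerivAt.comp_const_add (e.1 * h1) t
      (hasDerivAt_pdM_fst (i := 0) hu (e.1 * h1 + t) (e.2 * h2)))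
    (by fun_prop) (nodeDatum κ h1 h2 u e) (nodeDatum κ h1 h2 u (e.1 + 1, e.2))
    (by simp [nodeDatum_zero, nodePt])
    (by rw [nodeDatum_zero, nodePt]; push_cast; congr 2; ring)
  refine le_trans (le_of_eq ?_) (this.trans (le_of_eq ?_))
  · refine congrArg _ (intervalIntegral.integral_congr fun t _ => ?_)
    simp only [rowRem, oddCos]
    rw [sum_nodeCoef_mul hκ hh1 hh2 hA hβ he, sum_nodeCoef_mul hκ hh1 hh2 hA hβ he']
  · rw [nodeDatum_zero, nodeDatum_zero]; rfl

lemma col_remainder_le {κ h1 h2 θ : ℝ} (hκ : 0 < κ) (hh1 : 0 < h1) (hh2 : 0 < h2)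
    (hA : A2cond κ h1 h2) (hν : ∀ k, 1 < nuTil κ h1 (k + 1))
    (hl1 : 4 * (κ * h1) ^ 2 / π ^ 2 ≤ 1) (hθ : 0 < θ)
    {cells : Finset (ℤ × ℤ)} {N : ℕ} (hN : 0 < N) {u : ℝ × ℝ → ℂ} (hu : ContDiff ℝ (1 : ℕ) u)
    {β : {p : ℤ × ℤ // p ∈ meshNodes cells} × Fin N → ℂ}
    (hβ : CollocationSystem κ h1 h2 cells N u β) {e : ℤ × ℤ} (he : e ∈ meshNodes cells)
    (he' : (e.1, e.2 + 1) ∈ meshNodes cells) :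
    2 / h2 * ∫ s in (0 : ℝ)..h2, ‖colRem κ h1 h2 u β e s‖ ^ 2 ≤
      (1 + θ) * (13 / 12 * h2 * (∫ s in (0 : ℝ)..h2, ‖pdM 0 1 u (e.1 * h1, e.2 * h2 + s)‖ ^ 2) +
        13 / 10 * (‖u (nodePt h1 h2 e)‖ ^ 2 + ‖u (nodePt h1 h2 (e.1, e.2 + 1))‖ ^ 2)) +
      (1 + 1 / θ) * (0.7214 * (4 * (κ * h1) ^ 2 / π ^ 2) ^ 2 *
        (hiDatumSq κ h1 h2 u N e + hiDatumSq κ h1 h2 u N (e.1, e.2 + 1))) := by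
  have hc : Continuous (pdM 0 1 u) := continuous_pdM_one (i := 0) hu
  have hd : ∀ y, HasDerivAt (fun y => u (e.1 * h1, y)) (pdM 0 1 u (e.1 * h1, y)) y := fun y => by
    rw [pdM_zero_one]
    exact hasDerivAt_pd2 (hu.differentiable (by norm_num)) (e.1 * h1) y
  have := evanescent_edge_remainder_le hh2 (l := 4 * (κ * h1) ^ 2 / π ^ 2) (by positivity) hl1 hθ hN
    (r := colMode κ h1 h2) (continuous_colMode κ h1 h2)
    (fun s hs m => colMode_nonneg hκ (hν m) hs) (fun s hs m => colMode_succ_le hκ hh1 hh2 (hν m) hs)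
    (fun s hs => colMode_le_div hκ hh2 (hν 0) hs)
    (f := fun s => u (e.1 * h1, e.2 * h2 + s)) (f' := fun s => pdM 0 1 u (e.1 * h1, e.2 * h2 + s))
    (fun s => HasDerivAt.comp_const_add (e.2 * h2) s (hd (e.2 * h2 + s)))
    (by fun_prop) (nodeDatum κ h1 h2 u e) (nodeDatum κ h1 h2 u (e.1, e.2 + 1))
    (by simp [nodeDatum_zero, nodePt])
    (by rw [nodeDatum_zero, nodePt]; push_cast; congr 2; ring)
  refine le_trans (le_of_eq ?_) (this.trans (le_of_eq ?_))
  · refine congrArg _ (intervalIntegral.integral_congr fun t _ => ?_)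
    simp only [colRem]
    rw [sum_nodeCoef_mul hκ hh1 hh2 hA hβ he, sum_nodeCoef_mul hκ hh1 hh2 hA hβ he']
  · rw [nodeDatum_zero, nodeDatum_zero]; rfl

lemma sum_range_two_mul (F : ℕ → ℝ) (k : ℕ) :
    ∑ i ∈ Finset.range (2 * k), F i = ∑ n ∈ Finset.range k, (F (2 * n) + F (2 * n + 1)) := by
  induction k with
  | zero => simp
  | succ k ih => rw [mul_add, mul_one, Finset.sum_range_succ, Finset.sum_range_succ, ih,
      Finset.sum_range_succ, add_assoc]

lemma weighted_add_le {T₁ T₂ G₁ G₂ s₁ s₂ : ℝ} (h₁ : 0 < T₁) (h₂ : 0 < T₂) (g₁ : G₁ ≤ T₁ * s₁)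
    (g₂ : G₂ ≤ T₂ * s₂) :
    (1 + T₂ / T₁) * G₁ + (1 + 1 / (T₂ / T₁)) * G₂ ≤ (T₁ + T₂) * (s₁ + s₂) := by
  calc _ ≤ (1 + T₂ / T₁) * (T₁ * s₁) + (1 + 1 / (T₂ / T₁)) * (T₂ * s₂) := by gcongr
    _ = _ := by field_simp; ring

/-- The higher node data at the corners of a cell are controlled by the interior terms. -/
lemma cell_hiDatumSq_le {κ h1 h2 : ℝ} (hκ : 0 < κ) (hh1 : 0 < h1) (hh2 : 0 < h2) {N : ℕ}
    {u : ℝ × ℝ → ℂ} (hu : ContDiff ℝ (2 * N : ℕ) u) (c : ℤ × ℤ) :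
    hiDatumSq κ h1 h2 u N c + hiDatumSq κ h1 h2 u N (c.1 + 1, c.2) +
        (hiDatumSq κ h1 h2 u N (c.1, c.2 + 1) + hiDatumSq κ h1 h2 u N (c.1 + 1, c.2 + 1)) ≤
      4 / (h1 * h2) * traceMu (κ * h1) * traceMu (κ * h2) *
        ∑ n ∈ Finset.range (N - 1),
          (cellTerm κ h1 h2 u c (2 * (n + 1)) 0 + cellTerm κ h1 h2 u c (2 * (n + 1)) 1 +
            (cellTerm κ h1 h2 u c (2 * (n + 1) + 1) 0 +
              cellTerm κ h1 h2 u c (2 * (n + 1) + 1) 1)) := by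
  simp only [hiDatumSq, ← Finset.sum_add_distrib, norm_nodeDatum_sq_le_cornerSum hκ]
  rw [Finset.mul_sum]
  refine Finset.sum_le_sum fun n hn => ?_
  have hn := Finset.mem_range.1 hn
  have h := cornerSum_pdM_le hκ hh1 hh2 (i := 2 * (n + 1))
    (hu.of_le (by exact_mod_cast by omega)) c
  have a0 := traceMu_pos (κ * h1)
  have b0 := traceMu_pos (κ * h2)
  refine (le_of_eq ?_).trans (h.trans (mul_le_mul_of_nonneg_left ?_ (by positivity)))
  · rw [cornerSum]; ring
  · have t0 := fun i j => cellTerm_nonneg hκ h1 h2 u c i j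
    rw [cornerBound]
    linarith [t0 (2 * (n + 1) + 1) 0, t0 (2 * (n + 1)) 1, t0 (2 * (n + 1) + 1) 1]

lemma cell_low_le {κ h1 h2 T : ℝ} (hκ : 0 < κ) (hh1 : 0 < h1) (hh2 : 0 < h2)
    {u : ℝ × ℝ → ℂ} (hu : ContDiff ℝ (2 : ℕ) u) (c : ℤ × ℤ)
    (k1 : 52 / 5 * (traceMu (κ * h2) * traceMu (κ * h1)) ≤ T)
    (k2 : 104 / 15 * (traceMu (κ * h2) * traceMu (κ * h1)) +
      13 / 6 * ((κ * h1) ^ 2 * traceMu (κ * h2)) ≤ T)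
    (k3 : 104 / 15 * (traceMu (κ * h2) * traceMu (κ * h1)) +
      13 / 6 * ((κ * h2) ^ 2 * traceMu (κ * h1)) ≤ T)
    (k4 : 208 / 45 * (traceMu (κ * h2) * traceMu (κ * h1)) +
      13 / 9 * ((κ * h1) ^ 2 * traceMu (κ * h2) + (κ * h2) ^ 2 * traceMu (κ * h1)) ≤ T) :
    13 / 12 * h1 * ((∫ t in (0 : ℝ)..h1, ‖pdM 1 0 u (c.1 * h1 + t, c.2 * h2)‖ ^ 2) +
        ∫ t in (0 : ℝ)..h1, ‖pdM 1 0 u (c.1 * h1 + t, (c.2 + 1 : ℤ) * h2)‖ ^ 2) +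
      13 / 12 * h2 * ((∫ s in (0 : ℝ)..h2, ‖pdM 0 1 u (c.1 * h1, c.2 * h2 + s)‖ ^ 2) +
        ∫ s in (0 : ℝ)..h2, ‖pdM 0 1 u ((c.1 + 1 : ℤ) * h1, c.2 * h2 + s)‖ ^ 2) +
      13 / 5 * cornerSum h1 h2 c u ≤
    T * (1 / (h1 * h2) * (cellTerm κ h1 h2 u c 0 0 + cellTerm κ h1 h2 u c 0 1 +
      (cellTerm κ h1 h2 u c 1 0 + cellTerm κ h1 h2 u c 1 1))) := by
  have r := cell_row_pdM_le hκ hh1 hh2 c (i := 1) hu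
  have s := cell_col_pdM_one_le hκ hh1 hh2 c hu
  have z := cornerSum_pdM_le hκ hh1 hh2 (i := 0) hu c
  have t0 := fun i j => cellTerm_nonneg hκ h1 h2 u c i j
  simp only [mul_zero, pow_zero, inv_one, one_mul, pdM_zero_zero, cornerBound, zero_add, mul_one]
    at z r
  rw [inv_mul_le_iff₀ (by positivity)] at r s
  set a := traceMu (κ * h1) with ha
  set b := traceMu (κ * h2) with hb
  have r' := mul_le_mul_of_nonneg_left r (show 0 ≤ 13 / 12 * h1 by positivity)
  have s' := mul_le_mul_of_nonneg_left s (show 0 ≤ 13 / 12 * h2 by positivity)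
  have m1 := mul_le_mul_of_nonneg_right k1 (t0 0 0)
  have m2 := mul_le_mul_of_nonneg_right k2 (t0 1 0)
  have m3 := mul_le_mul_of_nonneg_right k3 (t0 0 1)
  have m4 := mul_le_mul_of_nonneg_right k4 (t0 1 1)
  have m := mul_le_mul_of_nonneg_left (add_le_add (add_le_add m1 m2) (add_le_add m3 m4))
    (show 0 ≤ 1 / (h1 * h2) by positivity)
  refine (add_le_add (add_le_add r' s') (mul_le_mul_of_nonneg_left z (by norm_num))).trans
    (le_trans (le_of_eq ?_) (m.trans (le_of_eq ?_)))
  · field_simp; ring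
  · ring

/-- Bound for the four edge remainders of a cell when no node mode propagates. -/
lemma evanescent_cell_remainder_le {κ h1 h2 : ℝ} (hκ : 0 < κ) (hh1 : 0 < h1) (hh2 : 0 < h2)
    (hA : A2cond κ h1 h2) (hν : ∀ k, 1 < nuTil κ h1 (k + 1))
    {cells : Finset (ℤ × ℤ)} {N : ℕ} (hN : 0 < N) {u : ℝ × ℝ → ℂ} (hu : ContDiff ℝ (2 * N : ℕ) u)
    {β : {p : ℤ × ℤ // p ∈ meshNodes cells} × Fin N → ℂ}
    (hβ : CollocationSystem κ h1 h2 cells N u β) {c : ℤ × ℤ} (hc : c ∈ cells) :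
    (2 / h1 * ∫ t in (0 : ℝ)..h1, ‖rowRem h1 h2 u β c t‖ ^ 2) +
        (2 / h1 * ∫ t in (0 : ℝ)..h1, ‖rowRem h1 h2 u β (c.1, c.2 + 1) t‖ ^ 2) +
      ((2 / h2 * ∫ s in (0 : ℝ)..h2, ‖colRem κ h1 h2 u β c s‖ ^ 2) +
        2 / h2 * ∫ s in (0 : ℝ)..h2, ‖colRem κ h1 h2 u β (c.1 + 1, c.2) s‖ ^ 2) ≤
      16 * (max 1 (κ * meshH h1 h2) ^ 2 / (h1 * h2)) *
        ∑ i ∈ Finset.range (2 * N), (cellTerm κ h1 h2 u c i 0 + cellTerm κ h1 h2 u c i 1) := by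
  have hu2 : ContDiff ℝ (2 : ℕ) u := hu.of_le (by exact_mod_cast by omega)
  have hu1 : ContDiff ℝ (1 : ℕ) u := hu.of_le (by exact_mod_cast by omega)
  have n00 : c ∈ meshNodes cells := by simp [meshNodes, hc]
  have n10 : (c.1 + 1, c.2) ∈ meshNodes cells := by
    simp only [meshNodes, Finset.mem_union, Finset.mem_image]
    exact Or.inl (Or.inl (Or.inr ⟨c, hc, rfl⟩))
  have n01 : (c.1, c.2 + 1) ∈ meshNodes cells := by
    simp only [meshNodes, Finset.mem_union, Finset.mem_image]
    exact Or.inl (Or.inr ⟨c, hc, rfl⟩)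
  have n11 : (c.1 + 1, c.2 + 1) ∈ meshNodes cells := by
    simp only [meshNodes, Finset.mem_union, Finset.mem_image]
    exact Or.inr ⟨c, hc, rfl⟩
  have hy : 0 < κ * h1 := mul_pos hκ hh1
  have hx : 0 < κ * h2 := mul_pos hκ hh2
  have hyπ : κ * h1 ≤ π / 2 := by
    have := hν 0
    rw [nuTil, lt_div_iff₀ (by positivity)] at this
    norm_num at this
    linarith
  have hl1 : 4 * (κ * h1) ^ 2 / π ^ 2 ≤ 1 := by
    rw [div_le_one (by positivity)]
    have := pow_le_pow_left₀ hy.le hyπ 2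
    rw [div_pow] at this; linarith
  obtain ⟨k1, k2, k3, k4⟩ := evanescent_coefficients_le hx hy hyπ
    (le_max_left 1 (κ * meshH h1 h2))
    ((mul_le_mul_of_nonneg_left (le_max_right h1 h2) hκ.le).trans (le_max_right _ _))
    ((mul_le_mul_of_nonneg_left (le_max_left h1 h2) hκ.le).trans (le_max_right _ _))
  have a0 := traceMu_pos (κ * h1)
  have b0 := traceMu_pos (κ * h2)
  set X := max 1 (κ * meshH h1 h2) with hX
  set T₂ := 8.68 * (4 * (κ * h1) ^ 2 / π ^ 2) ^ 2 * (traceMu (κ * h2) * traceMu (κ * h1)) with hT₂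
  set T₁ := 16 * X ^ 2 - T₂ with hT₁
  have hT₂0 : 0 < T₂ := by positivity
  have hT₁0 : 0 < T₁ := by
    have : 0 < 52 / 5 * (traceMu (κ * h2) * traceMu (κ * h1)) := by positivity
    linarith
  have hθ : 0 < T₂ / T₁ := div_pos hT₂0 hT₁0
  have r1 := row_remainder_le hκ hh1 hh2 hA hl1 hθ hN hu1 hβ n00 n10
  have r2 := row_remainder_le hκ hh1 hh2 hA hl1 hθ hN hu1 hβ (e := (c.1, c.2 + 1)) n01 n11
  have s1 := col_remainder_le hκ hh1 hh2 hA hν hl1 hθ hN hu1 hβ n00 n01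
  have s2 := col_remainder_le hκ hh1 hh2 hA hν hl1 hθ hN hu1 hβ (e := (c.1 + 1, c.2)) n10 n11
  have g1 := cell_low_le (T := T₁) hκ hh1 hh2 hu2 c (by linarith) (by linarith) (by linarith)
    (by linarith)
  have g2 := cell_hiDatumSq_le hκ hh1 hh2 hu c
  set F : ℕ → ℝ := fun i => cellTerm κ h1 h2 u c i 0 + cellTerm κ h1 h2 u c i 1 with hF
  have hF0 : ∀ i, 0 ≤ F i := fun i =>
    add_nonneg (cellTerm_nonneg hκ _ _ _ _ _ _) (cellTerm_nonneg hκ _ _ _ _ _ _)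
  have hsum : ∑ i ∈ Finset.range (2 * N), F i = (F 0 + F 1) +
      ∑ n ∈ Finset.range (N - 1), (F (2 * (n + 1)) + F (2 * (n + 1) + 1)) := by
    obtain ⟨k, rfl⟩ : ∃ k, N = k + 1 := ⟨N - 1, by omega⟩
    rw [sum_range_two_mul, Finset.sum_range_succ', add_comm, Nat.add_sub_cancel]
  have hS : 0 ≤ ∑ n ∈ Finset.range (N - 1), (F (2 * (n + 1)) + F (2 * (n + 1) + 1)) :=
    Finset.sum_nonneg fun n _ => add_nonneg (hF0 _) (hF0 _)
  have g2' : 2.1518 * (4 * (κ * h1) ^ 2 / π ^ 2) ^ 2 * (hiDatumSq κ h1 h2 u N c +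
      hiDatumSq κ h1 h2 u N (c.1 + 1, c.2) + (hiDatumSq κ h1 h2 u N (c.1, c.2 + 1) +
      hiDatumSq κ h1 h2 u N (c.1 + 1, c.2 + 1))) ≤
      T₂ * (1 / (h1 * h2) * ∑ n ∈ Finset.range (N - 1), (F (2 * (n + 1)) + F (2 * (n + 1) + 1))) := by
    refine (mul_le_mul_of_nonneg_left g2 (by positivity)).trans ?_
    have : 0 ≤ (4 * (κ * h1) ^ 2 / π ^ 2) ^ 2 * (traceMu (κ * h2) * traceMu (κ * h1)) *
      (1 / (h1 * h2) * ∑ n ∈ Finset.range (N - 1), (F (2 * (n + 1)) + F (2 * (n + 1) + 1))) := by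
      positivity
    rw [hT₂]
    linear_combination 0.0728 * this
  have key := weighted_add_le hT₁0 hT₂0 g1 g2'
  refine le_trans ?_ (key.trans (le_of_eq ?_))
  · refine (add_le_add (add_le_add r1 r2) (add_le_add s1 s2)).trans (le_of_eq ?_)
    rw [cornerSum]
    ring
  · rw [hsum, hT₁]
    simp only [hF]
    ring

/-- Bound for the edge remainders when no node mode propagates. -/
lemma sum_evanescent_remainder_le {κ h1 h2 : ℝ} (hκ : 0 < κ) (hh1 : 0 < h1) (hh2 : 0 < h2)
    (hA : A2cond κ h1 h2) (hν : ∀ k, 1 < nuTil κ h1 (k + 1))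
    {cells : Finset (ℤ × ℤ)} {Ω : Set (ℝ × ℝ)} (hT : IsTessellation h1 h2 cells Ω)
    {L K N : ℕ} {u : ℝ × ℝ → ℂ} (hreg : ContDiff ℝ (L : ℕ) u) (hmem : MemSob L Ω u) (hKL : K ≤ L)
    (hNK : 2 * N ≤ K) (hN : 0 < N) {β : {p : ℤ × ℤ // p ∈ meshNodes cells} × Fin N → ℂ}
    (hβ : CollocationSystem κ h1 h2 cells N u β) :
    ∑ e ∈ hEdges cells, (2 / h1 * ∫ t in (0 : ℝ)..h1, ‖rowRem h1 h2 u β e t‖ ^ 2) +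
      ∑ e ∈ vEdges cells, (2 / h2 * ∫ s in (0 : ℝ)..h2, ‖colRem κ h1 h2 u β e s‖ ^ 2) ≤
      (4 * meshRho h1 h2 * max 1 (κ * meshH h1 h2) / meshH h1 h2 * sobNorm κ K Ω u) ^ 2 := by
  have hu : ContDiff ℝ (2 * N : ℕ) u := hreg.of_le (by exact_mod_cast hNK.trans hKL)
  have hρ := one_le_meshRho hh1 hh2
  have hS := sum_cellTerm_le hκ hh1 hh2 hT hmem hKL hNK
  have hS0 : 0 ≤ sobNormSq κ K Ω u := (Finset.sum_nonneg fun c _ => Finset.sum_nonneg fun i _ =>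
      add_nonneg (cellTerm_nonneg hκ _ _ _ _ _ _) (cellTerm_nonneg hκ _ _ _ _ _ _)).trans hS
  have h_int : ∀ {b : ℝ} (F : ℝ → ℂ), 0 ≤ b → 0 ≤ ∫ t in (0 : ℝ)..b, ‖F t‖ ^ 2 := fun F hb =>
    intervalIntegral.integral_nonneg hb fun _ _ => by positivity
  refine (sum_edges_le cells
    (EH := fun e => 2 / h1 * ∫ t in (0 : ℝ)..h1, ‖rowRem h1 h2 u β e t‖ ^ 2)
    (EV := fun e => 2 / h2 * ∫ s in (0 : ℝ)..h2, ‖colRem κ h1 h2 u β e s‖ ^ 2)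
    (fun e => mul_nonneg (by positivity) (h_int _ hh1.le))
    (fun e => mul_nonneg (by positivity) (h_int _ hh2.le))).trans ?_
  calc _ ≤ ∑ c ∈ cells, 16 * (max 1 (κ * meshH h1 h2) ^ 2 / (h1 * h2)) *
        ∑ i ∈ Finset.range (2 * N), (cellTerm κ h1 h2 u c i 0 + cellTerm κ h1 h2 u c i 1) :=
        Finset.sum_le_sum fun c hc => evanescent_cell_remainder_le hκ hh1 hh2 hA hν hN hu hβ hc
    _ ≤ 16 * (max 1 (κ * meshH h1 h2) ^ 2 / (h1 * h2)) * sobNormSq κ K Ω u := by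
        rw [← Finset.mul_sum]
        exact mul_le_mul_of_nonneg_left hS (by positivity)
    _ = 1 * (16 * (max 1 (κ * meshH h1 h2) ^ 2 * (meshRho h1 h2 / meshH h1 h2 ^ 2)) *
        sobNormSq κ K Ω u) := by
        rw [meshRho_div_sq hh1 hh2]; ring
    _ ≤ meshRho h1 h2 * (16 * (max 1 (κ * meshH h1 h2) ^ 2 * (meshRho h1 h2 / meshH h1 h2 ^ 2)) *
        sobNormSq κ K Ω u) := mul_le_mul_of_nonneg_right hρ (by positivity)
    _ = _ := by
        rw [mul_pow _ (sobNorm κ K Ω u), sobNorm, Real.sq_sqrt hS0]; ring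

/-- The propagative contribution to the edge remainders is covered by the constant `C₂`. -/
lemma propagative_bound_le_C2const {κ h1 h2 : ℝ} (hκ : 0 < κ) (hh1 : 0 < h1) (hh2 : 0 < h2)
    {cells : Finset (ℤ × ℤ)} (hc : cells.Nonempty) (hd : 0 < dTil κ h1 h2) {N χ S : ℝ}
    (hN : 0 ≤ N) (hχ : 0 ≤ χ) (hS : 0 ≤ S) :
    2 * Real.sqrt (meshNodes cells).card * (2 * N *
        (3 * meshRho h1 h2 * max 1 (κ * meshH h1 h2) ^ 2 / meshH h1 h2 * χ * S) *
          (π / (2 * (κ * h2 * dTil κ h1 h2)))) ≤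
      8 * meshRho h1 h2 * max 1 (κ * meshH h1 h2) / meshH h1 h2 *
        (C2const κ h1 h2 cells * χ * N) * S := by
  have hρ := one_le_meshRho hh1 hh2
  have hh := meshH_pos (h2 := h2) hh1
  obtain ⟨c, hc⟩ := hc
  have hn : 1 ≤ ((meshNodes cells).card : ℝ) := by
    have : 0 < (meshNodes cells).card := Finset.card_pos.2 ⟨c, by simp [meshNodes, hc]⟩
    exact_mod_cast this
  have hx := (one_div_le_meshRho_div hh1 hh2).2
  rw [C2const]
  set n : ℝ := ((meshNodes cells).card : ℝ)
  set ρ := meshRho h1 h2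
  set h := meshH h1 h2
  set X := max 1 (κ * h)
  set d := dTil κ h1 h2
  have hX : 1 ≤ X := le_max_left _ _
  have hsn : Real.sqrt n ≤ n := Real.sqrt_le_iff.2 ⟨by linarith, by nlinarith⟩
  have hρ32 : ρ ≤ ρ ^ ((3 : ℝ) / 2) := by
    simpa using Real.rpow_le_rpow_of_exponent_le hρ (show (1 : ℝ) ≤ 3 / 2 by norm_num)
  have h2' : Real.sqrt 2 ≤ 3 / 2 := Real.sqrt_le_iff.2 ⟨by norm_num, by norm_num⟩
  have h2p : 0 < Real.sqrt 2 := by positivity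
  have hc2 : 6 ≤ 16 / Real.sqrt 2 := by rw [le_div_iff₀ h2p]; linarith
  calc _ = 6 * Real.sqrt n * ρ * 1 * (X ^ 2 * (1 / h2) * (π * N * χ * S / (h * κ * d))) := by
        field_simp; ring
    _ ≤ (16 / Real.sqrt 2) * n * ρ ^ ((3 : ℝ) / 2) * X *
          (X ^ 2 * (ρ / h) * (π * N * χ * S / (h * κ * d))) := by
        gcongr
    _ = _ := by field_simp; ring

/-- Theorem 5.5, edge-and-node stability: under Assumptions A1 and A2, for
a Helmholtz solution `u ∈ H^{M+1}_κ(Ω)`, with `N = min(N_n,⌈M/2⌉)`, `μ = min(2N_n,M)`,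
`β` the solution of the nodal collocation system and `α` the edge coefficients of `u − 𝒱u`,
one has the stability bounds
`‖α‖_{ℓ²} ≤ (8ρ max(1,κh)/h)[1/2 + C₂χ_{⌈μ/2⌉}(⌈μ/2⌉ + C₃⌈μ/2⌉²√(πρ/(κh)))]‖u‖_{H^{μ+1}_κ(Ω)}`
and `‖β‖_{ℓ²} ≤ (3ρ max(1,κh)²/h)χ_{⌈μ/2⌉}√(|N_h|⌈μ/2⌉)‖u‖_{H^{μ+1}_κ(Ω)}`. -/
theorem coefficient_stability (κ h1 h2 : ℝ) (hκ : 0 < κ) (hh1 : 0 < h1) (hh2 : 0 < h2)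
    (cells : Finset (ℤ × ℤ)) (Ω : Set (ℝ × ℝ)) (hT : IsTessellation h1 h2 cells Ω)
    (hA1 : A0cond κ h1 h2) (hA2 : A2cond κ h1 h2)
    (M : ℕ) (hM : 1 ≤ M) (Ne Nn : ℕ) (hNe : 1 ≤ Ne) (hNn : 1 ≤ Nn)
    (u : ℝ × ℝ → ℂ) (hreg : ContDiff ℝ (M + 1 : ℕ) u) (hmem : MemSob (M + 1) Ω u)
    (hhelm : ∀ x ∈ Ω, pdM 2 0 u x + pdM 0 2 u x + (κ : ℂ) ^ 2 * u x = 0)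
    (β : {p : ℤ × ℤ // p ∈ meshNodes cells} × Fin (min Nn ((M + 1) / 2)) → ℂ)
    (hβ : CollocationSystem κ h1 h2 cells (min Nn ((M + 1) / 2)) u β) :
    (Real.sqrt
        ((∑ e ∈ hEdges cells, ∑ n : Fin Ne,
            ‖alphaH κ h1 h2 cells
                (u - nodeInterp κ h1 h2 cells (min Nn ((M + 1) / 2)) β) e ((n : ℕ) + 1)‖ ^ 2) +
          ∑ e ∈ vEdges cells, ∑ n : Fin Ne,
            ‖alphaV κ h1 h2 cells
                (u - nodeInterp κ h1 h2 cells (min Nn ((M + 1) / 2)) β) e ((n : ℕ) + 1)‖ ^ 2) ≤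
      (8 * meshRho h1 h2 * max 1 (κ * meshH h1 h2) / meshH h1 h2) *
        (1 / 2 + C2const κ h1 h2 cells *
          chiN (meshRho h1 h2) (κ * meshH h1 h2) ((min (2 * Nn) M + 1) / 2) *
          ((((min (2 * Nn) M + 1) / 2 : ℕ) : ℝ) +
            C3const κ h1 h2 * (((min (2 * Nn) M + 1) / 2 : ℕ) : ℝ) ^ 2 *
              Real.sqrt (π * meshRho h1 h2 / (κ * meshH h1 h2)))) *
        sobNorm κ (min (2 * Nn) M + 1) Ω u) ∧
    (Real.sqrt (∑ i : {p : ℤ × ℤ // p ∈ meshNodes cells} × Fin (min Nn ((M + 1) / 2)),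
        ‖β i‖ ^ 2) ≤
      (3 * meshRho h1 h2 * max 1 (κ * meshH h1 h2) ^ 2 / meshH h1 h2) *
        chiN (meshRho h1 h2) (κ * meshH h1 h2) ((min (2 * Nn) M + 1) / 2) *
        Real.sqrt (((meshNodes cells).card : ℝ) * (((min (2 * Nn) M + 1) / 2 : ℕ) : ℝ)) *
        sobNorm κ (min (2 * Nn) M + 1) Ω u) := by
  have hNeq : (min (2 * Nn) M + 1) / 2 = min Nn ((M + 1) / 2) := by omega
  rw [hNeq]
  have hN : 0 < min Nn ((M + 1) / 2) := by omega
  have hNK : 2 * min Nn ((M + 1) / 2) ≤ min (2 * Nn) M + 1 := by omega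
  have hKL : min (2 * Nn) M + 1 ≤ M + 1 := by omega
  have hK2 : 2 ≤ min (2 * Nn) M + 1 := by omega
  generalize min Nn ((M + 1) / 2) = N at *
  generalize min (2 * Nn) M + 1 = K at *
  have hu : Continuous u := hreg.continuous
  have hρ := one_le_meshRho hh1 hh2
  have hh := meshH_pos (h2 := h2) hh1
  have hB := norm_nodeCoef_le hκ hh1 hh2 hA2 hT hreg hmem hKL hNK hβ
  have hS : 0 ≤ sobNorm κ K Ω u := Real.sqrt_nonneg _
  have hχ : 0 ≤ chiN (meshRho h1 h2) (κ * meshH h1 h2) N := by rw [chiN]; positivity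
  refine ⟨?_, (sqrt_sum_norm_sq_le β hB).trans_eq (by ring)⟩
  refine (Real.sqrt_le_sqrt (add_le_add
    (Finset.sum_le_sum fun e he => sum_alphaH_sq_le hκ hh1 hh2 hA1 hA2 hu β he Ne)
    (Finset.sum_le_sum fun e he => sum_alphaV_sq_le hκ hh1 hh2 hA1 hu β he Ne))).trans ?_
  by_cases hν : nuTil κ h1 1 < 1
  · have hd := dTil_pos hκ hh1 hh2 hA2 hν
    have hC2 : 0 ≤ C2const κ h1 h2 cells := by rw [C2const]; positivity
    have hC3 : 0 ≤ C3const κ h1 h2 := by rw [C3const]; positivity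
    refine (sqrt_sum_edge_remainders_le hκ hh1 hh2 hA2 hν hu β (by positivity) hB
      (sum_edge_trace_le hκ hh1 hh2 hT hreg hmem hKL hK2)).trans ?_
    refine (add_le_add le_rfl (propagative_bound_le_C2const hκ hh1 hh2 hT.1 hd
      (Nat.cast_nonneg N) hχ hS)).trans ?_
    have h3 : 0 ≤ 8 * meshRho h1 h2 * max 1 (κ * meshH h1 h2) / meshH h1 h2 *
        (C2const κ h1 h2 cells * chiN (meshRho h1 h2) (κ * meshH h1 h2) N *
          (C3const κ h1 h2 * (N : ℝ) ^ 2 *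
            Real.sqrt (π * meshRho h1 h2 / (κ * meshH h1 h2)))) * sobNorm κ K Ω u := by
      positivity
    linear_combination h3
  · have hν' := one_lt_nuTil hκ hh1 hh2 hA2 hν
    have h := sum_evanescent_remainder_le hκ hh1 hh2 hA2 hν' hT hreg hmem hKL hNK hN hβ
    rw [C2const, dTil_eq_zero hν', mul_zero, div_zero]
    refine (Real.sqrt_le_sqrt h).trans ?_
    rw [Real.sqrt_sq (by positivity)]
    exact le_of_eq (by ring)

end
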